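/- Let t be a positive integer with t < 10^6, t congruent to 2 modulo 4, whose square-free part contains at least one odd prime factor congruent to 2 modulo 3. Then there exist five vectors in Z^3, each with squared Euclidean norm t, summing to the zero vector if and only if t is not an element of the set {22, 58, 70, 82, 142, 190, 298, 330, 358, 382, 478, 658, 742, 862, 1222, 1978}. -/

import Mathlib

/-- The disjunction of the bit masks `f lo, …, f (lo + 2 ^ d - 1)`. -/
def orTree (f : ℕ → ℕ) (d : ℕ) : ℕ → ℕ :=
  Nat.rec f (fun k ih lo => Nat.lor (ih lo) (ih (Nat.add lo (Nat.pow 2 k)))) d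

/-- `f n`, with `n` brought to normal form before `f` is unfolded. -/
def force (n : ℕ) (f : ℕ → ℕ) : ℕ :=
  Nat.rec (f 0) (fun k _ => f (Nat.succ k)) n

/-- The disjunction of `f 0, …, f 23`. -/
def or24 (f : ℕ → ℕ) : ℕ := Nat.lor (orTree f 3 0) (orTree f 4 8)

/-- The value `A k² + B k + C`. -/
def quad (A B C k : ℕ) : ℕ := Nat.add (Nat.mul (Nat.add (Nat.mul A k) B) k) C

/-- The mask of the quotients by `M` of the values `A k² + B k + C` with residue `r` modulo `M`, for
`k` below `24 * 2 ^ d`. Bit `J - i` of a mask stands for the quotient `i`. -/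
def progBits (J M A B C r : ℕ) : ℕ :=
  force (Nat.sub (Nat.div (Nat.log2 (Nat.div (Nat.mul M J) A)) 2) 3) fun d =>
  or24 fun k₀ => cond (Nat.beq (Nat.mod (quad A B C k₀) M) r)
    (orTree (fun k => Nat.shiftRight (Nat.pow 2 J)
      (Nat.div (quad A B C (Nat.add k₀ (Nat.mul 24 k))) M)) d 0) 0

/-- The mask, as in `progBits`, of the values `A k² + R k` with `k` an integer of either sign. -/
def seqBits (J M A R r : ℕ) : ℕ :=
  cond (Nat.beq (Nat.add (Nat.mod (Nat.mul 48 A) M) (Nat.mod (Nat.mul 24 R) M)) 0)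
    (Nat.lor (progBits J M A R 0 r)
      (force (Nat.sub A R) fun C => progBits J M A (Nat.add A C) C r)) 0

/-- The mask of the `i` for which `M i + r₀` is a value `A k² + R k + s`. -/
def shiftedSeqBits (J M r₀ A R s : ℕ) : ℕ :=
  cond (Nat.ble s (Nat.mul M (Nat.succ J)))
    (force R fun R => force (Nat.mod (Nat.add r₀ (Nat.sub M (Nat.mod s M))) M) fun r =>
      Nat.shiftRight (seqBits J M A R r) (Nat.div (Nat.sub (Nat.add s r) r₀) M)) 0

/-- The mask of the `i` for which `M i + r₀` is a value `A k² + B k + C`, `k` an integer. -/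
def lineBits (J M r₀ A B C : ℕ) : ℕ :=
  force (Nat.div (Nat.add B A) (Nat.mul 2 A)) fun q =>
    cond (Nat.ble (Nat.mul B q) (Nat.add C (Nat.mul A (Nat.mul q q))))
      (shiftedSeqBits J M r₀ A
        (Nat.add (Nat.sub B (Nat.mul (Nat.mul 2 A) q)) (Nat.sub (Nat.mul (Nat.mul 2 A) q) B))
        (Nat.sub (Nat.add C (Nat.mul A (Nat.mul q q))) (Nat.mul B q))) 0

/-- The mask of the `i` for which `M i + e` is a value `α x² + 2 β x y + γ y²` with `y = 2 l + y₀`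
and `x ≡ x₀` modulo `2`. -/
def pairLineBits (J M α β γ x₀ y₀ e l : ℕ) : ℕ :=
  force (Nat.add (Nat.mul 2 l) y₀) fun y =>
    lineBits J M e (Nat.mul 4 α) (Nat.mul 4 (Nat.add (Nat.mul α x₀) (Nat.mul β y)))
      (Nat.add (Nat.mul (Nat.add (Nat.mul α x₀) (Nat.mul (Nat.mul 2 β) y)) x₀)
        (Nat.mul γ (Nat.mul y y)))

/-- The disjunction of `pairLineBits` over a range of `l`. A residue of `l` modulo `24` is skipped
if its first line gives nothing. -/
def pairBits (J M α β γ x₀ y₀ d e : ℕ) : ℕ :=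
  or24 fun ρ => Nat.rec 0
    (fun _ _ => orTree (fun l =>
      pairLineBits J M α β γ x₀ y₀ e (Nat.add ρ (Nat.mul 24 l))) d 0)
    (pairLineBits J M α β γ x₀ y₀ e ρ)

/-- The mask of the `i` for which `M i + r₀ - s` is a value of the form in `pairBits`. -/
def shiftedPairBits (J M r₀ α β γ d x₀ y₀ s : ℕ) : ℕ :=
  force (Nat.mod (Nat.add r₀ (Nat.sub M (Nat.mod s M))) M) fun e =>
    Nat.shiftRight (pairBits J M α β γ x₀ y₀ d e) (Nat.div (Nat.sub (Nat.add s e) r₀) M)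

/-- The mask of the `i` for which `t = M i + r₀` is a value `A k² + 2 κ c k + B c²` and
`4 t - W c²` is a value of the form in `pairBits`, with parities `x₁ c` and `y₁ c`. -/
def cycleBits (J M r₀ A κ B W α β γ d x₁ y₁ c : ℕ) : ℕ :=
  Nat.rec 0 (fun _ _ =>
    Nat.land (lineBits J M r₀ A (Nat.mul (Nat.mul 2 κ) c) (Nat.mul B (Nat.mul c c)))
      (force (Nat.mod (Nat.mul x₁ c) 2) fun x₀ => force (Nat.mod (Nat.mul y₁ c) 2) fun y₀ =>
        shiftedPairBits J (Nat.mul 4 M) (Nat.mul 4 r₀) α β γ d x₀ y₀ (Nat.mul W (Nat.mul c c))))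
    (lineBits J M r₀ A (Nat.mul (Nat.mul 2 κ) c) (Nat.mul B (Nat.mul c c)))

/-- Every bit `b` of `X` comes from an index `i = J - b` with property `P`. -/
def Covers (J X : ℕ) (P : ℕ → Prop) : Prop :=
  ∀ b, X.testBit b = true → ∃ i, i + b = J ∧ P i

theorem natDiv_eq (a b : ℕ) : Nat.div a b = a / b := rfl

theorem natMod_eq (a b : ℕ) : Nat.mod a b = a % b := rfl

section Covers

variable {J X Y : ℕ} {P Q : ℕ → Prop}

theorem Covers.zero : Covers J 0 P := by
  intro b hb
  simp at hb

theorem Covers.mono (h : Covers J X P) (hPQ : ∀ i, P i → Q i) : Covers J X Q := by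
  intro b hb
  obtain ⟨i, hi, hp⟩ := h b hb
  exact ⟨i, hi, hPQ i hp⟩

theorem Covers.lor (hX : Covers J X P) (hY : Covers J Y P) : Covers J (Nat.lor X Y) P := by
  intro b hb
  have hb' : (X ||| Y).testBit b = true := hb
  rw [Nat.testBit_or, Bool.or_eq_true] at hb'
  exact hb'.elim (hX b) (hY b)

theorem Covers.land (hX : Covers J X P) (hY : Covers J Y Q) :
    Covers J (Nat.land X Y) fun i => P i ∧ Q i := by
  intro b hb
  have hb' : (X &&& Y).testBit b = true := hb
  rw [Nat.testBit_and, Bool.and_eq_true] at hb'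
  obtain ⟨i, hi, hp⟩ := hX b hb'.1
  obtain ⟨j, hj, hq⟩ := hY b hb'.2
  obtain rfl : i = j := by omega
  exact ⟨i, hi, hp, hq⟩

theorem Covers.shiftRight (s : ℕ) (hX : Covers J X P) (h : ∀ i, P i → Q (i + s)) :
    Covers J (Nat.shiftRight X s) Q := by
  intro b hb
  have hb' : (X >>> s).testBit b = true := hb
  rw [Nat.testBit_shiftRight] at hb'
  obtain ⟨i, hi, hp⟩ := hX _ hb'
  exact ⟨i + s, by omega, h i hp⟩

theorem Covers.single (p : ℕ) (hp : P p) : Covers J (Nat.shiftRight (Nat.pow 2 J) p) P := by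
  intro b hb
  have hb' : ((2 ^ J) >>> p).testBit b = true := hb
  rw [Nat.testBit_shiftRight, Nat.testBit_two_pow] at hb'
  exact ⟨p, (of_decide_eq_true hb').symm, hp⟩

theorem Covers.cond {c : Bool} (h : c = true → Covers J X P) : Covers J (cond c X 0) P := by
  cases c
  · exact Covers.zero
  · exact h rfl

theorem Covers.natRec (n : ℕ) (h : Covers J X P) :
    Covers J (Nat.rec 0 (fun _ _ => X) n) P := by
  cases n
  · exact Covers.zero
  · exact h

theorem Covers.orTree {f : ℕ → ℕ} (h : ∀ k, Covers J (f k) P) (d lo : ℕ) :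
    Covers J (orTree f d lo) P := by
  induction d generalizing lo with
  | zero => exact h lo
  | succ d ih => exact (ih _).lor (ih _)

theorem Covers.or24 {f : ℕ → ℕ} (h : ∀ k, Covers J (f k) P) : Covers J (or24 f) P :=
  (Covers.orTree h _ _).lor (Covers.orTree h _ _)

theorem force_eq (n : ℕ) (f : ℕ → ℕ) : force n f = f n := by
  cases n <;> rfl

theorem quad_eq (A B C k : ℕ) : quad A B C k = A * k ^ 2 + B * k + C := by
  simp only [quad, Nat.add_eq, Nat.mul_eq]
  ring

theorem covers_progBits {M A B : ℕ} (C r : ℕ) (hA : M ∣ 48 * A) (hB : M ∣ 24 * B) :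
    Covers J (progBits J M A B C r) fun i => ∃ k : ℕ, M * i + r = A * k ^ 2 + B * k + C := by
  rw [progBits, force_eq]
  refine Covers.or24 fun k₀ => Covers.cond fun hr => Covers.orTree (fun k => Covers.single _ ?_) _ _
  have hr' : quad A B C k₀ % M = r := Nat.eq_of_beq_eq_true hr
  refine ⟨k₀ + 24 * k, ?_⟩
  simp only [Nat.add_eq, Nat.mul_eq, natDiv_eq]
  rw [← quad_eq]
  have hmod : quad A B C (k₀ + 24 * k) % M = r := by
    rw [← hr']
    obtain ⟨a, ha⟩ := hA
    obtain ⟨b, hb⟩ := hB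
    have : quad A B C (k₀ + 24 * k) = quad A B C k₀ + M * (a * k₀ * k + 12 * a * k ^ 2 + b * k) := by
      rw [quad_eq, quad_eq]
      linear_combination (k₀ * k + 12 * k ^ 2) * ha + k * hb
    rw [this, Nat.add_mul_mod_self_left]
  have := Nat.div_add_mod (quad A B C (k₀ + 24 * k)) M
  rw [hmod] at this
  exact this

theorem covers_seqBits {A R : ℕ} (M r : ℕ) (hR : R ≤ A) :
    Covers J (seqBits J M A R r) fun i => ∃ k : ℤ, (M * i + r : ℤ) = A * k ^ 2 + R * k := by
  refine Covers.cond fun hg => ?_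
  have hg' : 48 * A % M + 24 * R % M = 0 := Nat.eq_of_beq_eq_true hg
  have hA : M ∣ 48 * A := Nat.dvd_of_mod_eq_zero (by omega)
  have hB : M ∣ 24 * R := Nat.dvd_of_mod_eq_zero (by omega)
  refine Covers.lor ?_ ?_
  · refine (covers_progBits 0 r hA hB).mono ?_
    rintro i ⟨k, hk⟩
    exact ⟨k, by exact_mod_cast hk⟩
  · rw [force_eq]
    have hC : M ∣ 24 * (A + (A - R)) := by
      have : 24 * (A + (A - R)) = 48 * A - 24 * R := by omega
      rw [this]
      exact Nat.dvd_sub hA hB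
    refine (covers_progBits (A - R) r hA hC).mono ?_
    rintro i ⟨k, hk⟩
    refine ⟨-(k + 1), ?_⟩
    zify [hR] at hk
    rw [hk]
    ring

/-- Writing `s + r ≡ r₀` modulo `M` with `0 ≤ r < M`, the quotient computed by truncated
subtraction is exact. -/
theorem shift_eq {M r₀ : ℕ} (hr₀ : r₀ < M) (s : ℕ) :
    M * ((s + (r₀ + (M - s % M)) % M - r₀) / M) + r₀ = s + (r₀ + (M - s % M)) % M := by
  have hM : 0 < M := by omega
  have hs := Nat.mod_lt s hM
  have hr := Nat.mod_lt (r₀ + (M - s % M)) hM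
  set r := (r₀ + (M - s % M)) % M with hrdef
  have hmod : (s + r) % M = r₀ := by
    have h1 : (s + (r₀ + (M - s % M))) % M = r₀ := by
      have h2 := Nat.div_add_mod s M
      have : s + (r₀ + (M - s % M)) = r₀ + M * (s / M + 1) := by
        rw [Nat.mul_add, Nat.mul_one]
        omega
      rw [this, Nat.add_mul_mod_self_left, Nat.mod_eq_of_lt hr₀]
    rw [hrdef, Nat.add_mod_mod, h1]
  have hle : r₀ ≤ s + r := hmod ▸ Nat.mod_le _ _
  have hdvd : M ∣ s + r - r₀ := by
    have := Nat.div_add_mod (s + r) M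
    exact ⟨(s + r) / M, by omega⟩
  rw [Nat.mul_div_cancel' hdvd]
  omega

theorem covers_shiftedSeqBits {M r₀ A R : ℕ} (s : ℕ) (hr₀ : r₀ < M) (hR : R ≤ A) :
    Covers J (shiftedSeqBits J M r₀ A R s) fun i =>
      ∃ k : ℤ, (M * i + r₀ : ℤ) = A * k ^ 2 + R * k + s := by
  refine Covers.cond fun _ => ?_
  rw [force_eq, force_eq]
  refine (covers_seqBits M _ hR).shiftRight _ ?_
  rintro i ⟨k, hk⟩
  refine ⟨k, ?_⟩
  have h := shift_eq hr₀ s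
  simp only [Nat.add_eq, Nat.sub_eq, natDiv_eq, natMod_eq] at hk ⊢
  have h : ((_ : ℕ) : ℤ) = (_ : ℕ) := congrArg Nat.cast h
  simp only [Nat.cast_add, Nat.cast_mul] at h hk ⊢
  linear_combination hk + h

theorem covers_lineBits {M r₀ A : ℕ} (B C : ℕ) (hr₀ : r₀ < M) (hA : 0 < A) :
    Covers J (lineBits J M r₀ A B C) fun i =>
      ∃ k : ℤ, (M * i + r₀ : ℤ) = A * k ^ 2 + B * k + C := by
  rw [lineBits, force_eq]
  refine Covers.cond fun hle => ?_
  simp only [Nat.add_eq, Nat.sub_eq, natDiv_eq, Nat.mul_eq] at hle ⊢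
  have hle' := Nat.le_of_ble_eq_true hle
  set q := (B + A) / (2 * A) with hq
  have h1 := Nat.div_add_mod (B + A) (2 * A)
  have h2 := Nat.mod_lt (B + A) (show 0 < 2 * A by omega)
  rw [← hq] at h1
  refine (covers_shiftedSeqBits _ hr₀ ?_).mono ?_
  · omega
  · rintro i ⟨k, hk⟩
    rw [Nat.cast_sub hle'] at hk
    rcases le_total B (2 * A * q) with h | h
    · refine ⟨-k - q, ?_⟩
      rw [Nat.sub_eq_zero_of_le h, Nat.zero_add, Nat.cast_sub h] at hk
      push_cast at hk
      linear_combination hk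
    · refine ⟨k - q, ?_⟩
      rw [Nat.sub_eq_zero_of_le h, Nat.add_zero, Nat.cast_sub h] at hk
      push_cast at hk
      linear_combination hk

end Covers

section Covers

variable {J : ℕ}

theorem covers_pairLineBits {M α e : ℕ} (β γ x₀ y₀ l : ℕ) (he : e < M) (hα : 0 < α) :
    Covers J (pairLineBits J M α β γ x₀ y₀ e l) fun i => ∃ k l : ℤ,
      (M * i + e : ℤ) = α * (2 * k + x₀) ^ 2 + 2 * β * (2 * k + x₀) * (2 * l + y₀)
        + γ * (2 * l + y₀) ^ 2 := by
  rw [pairLineBits, force_eq]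
  refine (covers_lineBits _ _ he (Nat.mul_pos (by norm_num) hα)).mono ?_
  rintro i ⟨k, hk⟩
  refine ⟨k, l, ?_⟩
  simp only [Nat.add_eq, Nat.mul_eq] at hk
  push_cast at hk
  linear_combination hk

theorem covers_pairBits {M α e : ℕ} (β γ x₀ y₀ d : ℕ) (he : e < M) (hα : 0 < α) :
    Covers J (pairBits J M α β γ x₀ y₀ d e) fun i => ∃ k l : ℤ,
      (M * i + e : ℤ) = α * (2 * k + x₀) ^ 2 + 2 * β * (2 * k + x₀) * (2 * l + y₀)
        + γ * (2 * l + y₀) ^ 2 :=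
  Covers.or24 fun _ => Covers.natRec _
    (Covers.orTree (fun _ => covers_pairLineBits β γ x₀ y₀ _ he hα) _ _)

theorem covers_shiftedPairBits {M r₀ α : ℕ} (β γ d x₀ y₀ s : ℕ) (hr₀ : r₀ < M) (hα : 0 < α) :
    Covers J (shiftedPairBits J M r₀ α β γ d x₀ y₀ s) fun i => ∃ k l : ℤ,
      (M * i + r₀ : ℤ) = α * (2 * k + x₀) ^ 2 + 2 * β * (2 * k + x₀) * (2 * l + y₀)
        + γ * (2 * l + y₀) ^ 2 + s := by
  rw [shiftedPairBits, force_eq]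
  refine (covers_pairBits β γ x₀ y₀ d (Nat.mod_lt _ (by omega)) hα).shiftRight _ ?_
  rintro i ⟨k, l, hk⟩
  refine ⟨k, l, ?_⟩
  have h : ((_ : ℕ) : ℤ) = (_ : ℕ) := congrArg Nat.cast (shift_eq hr₀ s)
  simp only [Nat.add_eq, Nat.sub_eq, natDiv_eq, natMod_eq] at hk ⊢
  simp only [Nat.cast_add, Nat.cast_mul] at h hk ⊢
  linear_combination hk + h

theorem covers_cycleBits {M r₀ A α : ℕ} (κ B W β γ d x₁ y₁ c : ℕ) (hr₀ : r₀ < M)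
    (hA : 0 < A) (hα : 0 < α) :
    Covers J (cycleBits J M r₀ A κ B W α β γ d x₁ y₁ c) fun i =>
      (∃ m : ℤ, (M * i + r₀ : ℤ) = A * m ^ 2 + 2 * κ * c * m + B * c ^ 2) ∧
      ∃ x y k l : ℤ, x = 2 * k + x₁ * c ∧ y = 2 * l + y₁ * c ∧
        (4 * (M * i + r₀) : ℤ) = α * x ^ 2 + 2 * β * x * y + γ * y ^ 2 + W * c ^ 2 := by
  have hpair := covers_shiftedPairBits (J := J) β γ d (x₁ * c % 2) (y₁ * c % 2) (W * (c * c))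
    (show 4 * r₀ < 4 * M by omega) hα
  rw [cycleBits, force_eq, force_eq]
  refine Covers.natRec _ (((covers_lineBits _ _ hr₀ hA).land hpair).mono ?_)
  rintro i ⟨⟨m, hm⟩, k, l, h⟩
  simp only [Nat.mul_eq, Nat.cast_mul, Nat.cast_ofNat] at hm h
  refine ⟨⟨m, by linear_combination hm⟩, 2 * k + (x₁ * c % 2 : ℕ), 2 * l + (y₁ * c % 2 : ℕ),
    k - (x₁ * c / 2 : ℕ), l - (y₁ * c / 2 : ℕ), ?_, ?_, by linear_combination h⟩
  · have := Nat.div_add_mod (x₁ * c) 2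
    zify at this ⊢
    linarith
  · have := Nat.div_add_mod (y₁ * c) 2
    zify at this ⊢
    linarith

end Covers

/-- A vector of `ℤ³`. -/
structure V3 where
  x : ℤ
  y : ℤ
  z : ℤ

/-- The sum of two vectors. -/
def V3.add (u v : V3) : V3 := ⟨Int.add u.x v.x, Int.add u.y v.y, Int.add u.z v.z⟩

/-- The negative of a vector. -/
def V3.neg (u : V3) : V3 := ⟨Int.neg u.x, Int.neg u.y, Int.neg u.z⟩

/-- A multiple of a vector. -/
def V3.smul (k : ℤ) (u : V3) : V3 := ⟨Int.mul k u.x, Int.mul k u.y, Int.mul k u.z⟩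

/-- The dot product. -/
def V3.dot (u v : V3) : ℤ :=
  Int.add (Int.add (Int.mul u.x v.x) (Int.mul u.y v.y)) (Int.mul u.z v.z)

theorem V3.dot_eq (u v : V3) : u.dot v = u.x * v.x + u.y * v.y + u.z * v.z := rfl

theorem V3.add_x (u v : V3) : (u.add v).x = u.x + v.x := rfl
theorem V3.add_y (u v : V3) : (u.add v).y = u.y + v.y := rfl
theorem V3.add_z (u v : V3) : (u.add v).z = u.z + v.z := rfl
theorem V3.neg_x (u : V3) : u.neg.x = -u.x := rfl
theorem V3.neg_y (u : V3) : u.neg.y = -u.y := rfl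
theorem V3.neg_z (u : V3) : u.neg.z = -u.z := rfl
theorem V3.smul_x (k : ℤ) (u : V3) : (u.smul k).x = k * u.x := rfl
theorem V3.smul_y (k : ℤ) (u : V3) : (u.smul k).y = k * u.y := rfl
theorem V3.smul_z (k : ℤ) (u : V3) : (u.smul k).z = k * u.z := rfl

theorem V3.neg_dot_neg (u : V3) : u.neg.dot u.neg = u.dot u := by
  simp only [V3.dot_eq, V3.neg_x, V3.neg_y, V3.neg_z, neg_mul_neg]

/-- Five vectors of `ℤ³` of squared norm `t` sum to zero. -/
def HasFiveCycle (t : ℕ) : Prop :=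
  ∃ v : Fin 5 → (Fin 3 → ℤ), (∀ i, ∑ j, (v i j) ^ 2 = (t : ℤ)) ∧ (∑ i, v i) = 0

theorem hasFiveCycle_of_vectors {t : ℕ} (v₁ v₂ v₃ v₄ v₅ : V3) (h₁ : v₁.dot v₁ = t)
    (h₂ : v₂.dot v₂ = t) (h₃ : v₃.dot v₃ = t) (h₄ : v₄.dot v₄ = t) (h₅ : v₅.dot v₅ = t)
    (hx : v₁.x + v₂.x + v₃.x + v₄.x + v₅.x = 0) (hy : v₁.y + v₂.y + v₃.y + v₄.y + v₅.y = 0)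
    (hz : v₁.z + v₂.z + v₃.z + v₄.z + v₅.z = 0) : HasFiveCycle t := by
  refine ⟨![![v₁.x, v₁.y, v₁.z], ![v₂.x, v₂.y, v₂.z], ![v₃.x, v₃.y, v₃.z], ![v₄.x, v₄.y, v₄.z],
    ![v₅.x, v₅.y, v₅.z]], fun i => ?_, ?_⟩
  · simp only [V3.dot_eq, ← sq] at h₁ h₂ h₃ h₄ h₅
    fin_cases i <;> simpa [Fin.sum_univ_three]
  · ext j
    fin_cases j <;> simpa [Fin.sum_univ_five]

/-- The relations between the vectors of a family: the `aᵢ` sum to zero, `aᵢ`, `bᵢ` and `aᵢ ⬝ bᵢ`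
have constant norms and value, `u₁` and `u₂` are orthogonal to `w = ∑ bᵢ`, and
`w + x₁ u₁ + y₁ u₂` is even. -/
def familyCond (a₁ a₂ b₁ b₂ b₃ u₁ u₂ : V3) (x₁ y₁ : ℕ) : Bool :=
  let a₃ := (a₁.add a₂).neg
  let w := (b₁.add b₂).add b₃
  let p := w.add ((u₁.smul x₁).add (u₂.smul y₁))
  a₂.dot a₂ == a₁.dot a₁ && a₃.dot a₃ == a₁.dot a₁ &&
  b₂.dot b₂ == b₁.dot b₁ && b₃.dot b₃ == b₁.dot b₁ &&
  a₂.dot b₂ == a₁.dot b₁ && a₃.dot b₃ == a₁.dot b₁ &&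
  w.dot u₁ == 0 && w.dot u₂ == 0 &&
  Int.emod p.x 2 == 0 && Int.emod p.y 2 == 0 && Int.emod p.z 2 == 0

theorem hasFiveCycle_of_family {a₁ a₂ b₁ b₂ b₃ u₁ u₂ : V3} {x₁ y₁ : ℕ}
    (h : familyCond a₁ a₂ b₁ b₂ b₃ u₁ u₂ x₁ y₁ = true) {t : ℕ} {c m x y k l : ℤ}
    (hm : (t : ℤ) = a₁.dot a₁ * m ^ 2 + 2 * a₁.dot b₁ * c * m + b₁.dot b₁ * c ^ 2)
    (hx : x = 2 * k + x₁ * c) (hy : y = 2 * l + y₁ * c)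
    (ht : (4 * t : ℤ) = u₁.dot u₁ * x ^ 2 + 2 * u₁.dot u₂ * x * y + u₂.dot u₂ * y ^ 2
      + ((b₁.add b₂).add b₃).dot ((b₁.add b₂).add b₃) * c ^ 2) : HasFiveCycle t := by
  simp only [familyCond, Bool.and_eq_true, beq_iff_eq] at h
  obtain ⟨⟨⟨⟨⟨⟨⟨⟨⟨⟨ha₂, ha₃⟩, hb₂⟩, hb₃⟩, hab₂⟩, hab₃⟩, hw₁⟩, hw₂⟩, hpx⟩, hpy⟩, hpz⟩ := h
  obtain ⟨px, hpx⟩ := Int.dvd_of_emod_eq_zero hpx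
  obtain ⟨py, hpy⟩ := Int.dvd_of_emod_eq_zero hpy
  obtain ⟨pz, hpz⟩ := Int.dvd_of_emod_eq_zero hpz
  have hnorm : ∀ a b : V3, a.dot a = a₁.dot a₁ → a.dot b = a₁.dot b₁ → b.dot b = b₁.dot b₁ →
      ((a.smul m).add (b.smul c)).dot ((a.smul m).add (b.smul c)) = t := by
    intro a b haa hab hbb
    rw [← haa, ← hab, ← hbb] at hm
    rw [hm]
    simp only [V3.dot_eq, V3.add_x, V3.add_y, V3.add_z, V3.smul_x, V3.smul_y, V3.smul_z]
    ring
  obtain ⟨w, hw⟩ : ∃ w, w = (b₁.add b₂).add b₃ := ⟨_, rfl⟩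
  rw [← hw] at hw₁ hw₂ hpx hpy hpz ht
  obtain ⟨g, hg⟩ : ∃ g : V3, g = ⟨c * px + k * u₁.x + l * u₂.x, c * py + k * u₁.y + l * u₂.y,
    c * pz + k * u₁.z + l * u₂.z⟩ := ⟨_, rfl⟩
  simp only [V3.add_x, V3.add_y, V3.add_z, V3.smul_x, V3.smul_y, V3.smul_z] at hpx hpy hpz
  have hgx : 2 * g.x = c * w.x + (x * u₁.x + y * u₂.x) := by
    rw [hg, hx, hy]
    linear_combination (-c) * hpx
  have hgy : 2 * g.y = c * w.y + (x * u₁.y + y * u₂.y) := by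
    rw [hg, hx, hy]
    linear_combination (-c) * hpy
  have hgz : 2 * g.z = c * w.z + (x * u₁.z + y * u₂.z) := by
    rw [hg, hx, hy]
    linear_combination (-c) * hpz
  have hhalf : ∀ ε : ℤ, ε ^ 2 = 1 → ∀ v : V3, 2 * v.x = ε * (c * w.x) + (x * u₁.x + y * u₂.x) →
      2 * v.y = ε * (c * w.y) + (x * u₁.y + y * u₂.y) →
      2 * v.z = ε * (c * w.z) + (x * u₁.z + y * u₂.z) → v.dot v = t := by
    intro ε hε v hvx hvy hvz
    have : 4 * v.dot v = 4 * t := by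
      rw [ht]
      have : 4 * v.dot v = (2 * v.x) ^ 2 + (2 * v.y) ^ 2 + (2 * v.z) ^ 2 := by
        rw [V3.dot_eq]
        ring
      rw [this, hvx, hvy, hvz]
      simp only [V3.dot_eq] at hw₁ hw₂ ⊢
      linear_combination 2 * ε * c * x * hw₁ + 2 * ε * c * y * hw₂
        + c ^ 2 * (w.x ^ 2 + w.y ^ 2 + w.z ^ 2) * hε
    linarith
  have hg₅ := hhalf (-1) (by norm_num) (g.add (w.smul (-c)))
    (by rw [V3.add_x, V3.smul_x]; linear_combination hgx)
    (by rw [V3.add_y, V3.smul_y]; linear_combination hgy)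
    (by rw [V3.add_z, V3.smul_z]; linear_combination hgz)
  have hg₄ := (V3.neg_dot_neg g).trans (hhalf 1 (by norm_num) g (by linear_combination hgx)
    (by linear_combination hgy) (by linear_combination hgz))
  refine hasFiveCycle_of_vectors _ _ _ _ _ (hnorm a₁ b₁ rfl rfl rfl) (hnorm a₂ b₂ ha₂ hab₂ hb₂)
    (hnorm _ b₃ ha₃ hab₃ hb₃) hg₄ hg₅ ?_ ?_ ?_ <;>
  · simp only [hw, V3.add_x, V3.add_y, V3.add_z, V3.smul_x, V3.smul_y, V3.smul_z, V3.neg_x,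
      V3.neg_y, V3.neg_z]
    ring

/-- The `j`-th seven-bit digit of `n`, in offset binary. -/
def digit (n j : ℕ) : ℤ := Int.subNatNat (Nat.mod (Nat.shiftRight n (Nat.mul 7 j)) 128) 64

/-- The vector with digits `3 j`, `3 j + 1`, `3 j + 2` of `n` as coordinates. -/
def vec (n j : ℕ) : V3 :=
  ⟨digit n (Nat.mul 3 j), digit n (Nat.add (Nat.mul 3 j) 1), digit n (Nat.add (Nat.mul 3 j) 2)⟩

/-- The `j`-th bit of `f`. -/
def flag (f j : ℕ) : ℕ := Nat.mod (Nat.shiftRight f j) 2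

/-- The values of `t` reached by the family `f` (holding `a₁, a₂, b₁, b₂, b₃`, two flags and a mask
of values of `c`) with plane `D` (holding `u₁, u₂` and the search depth). -/
def familyBits (J M r₀ D f : ℕ) : ℕ :=
  force ((vec f 0).dot (vec f 0)).toNat fun A =>
  force ((vec f 0).dot (vec f 2)).toNat fun κ =>
  force ((vec f 2).dot (vec f 2)).toNat fun B =>
  force ((((vec f 2).add (vec f 3)).add (vec f 4)).dot
    (((vec f 2).add (vec f 3)).add (vec f 4))).toNat fun W =>
  force ((vec D 0).dot (vec D 0)).toNat fun α =>
  force ((vec D 0).dot (vec D 1)).toNat fun β =>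
  force ((vec D 1).dot (vec D 1)).toNat fun γ =>
  force (Nat.mod (Nat.shiftRight D 42) 16) fun d =>
  force (flag f 105) fun x₁ =>
  force (flag f 106) fun y₁ =>
  force (Nat.shiftRight f 112) fun mask =>
  orTree (fun c => cond (Nat.beq (Nat.land (Nat.shiftRight mask c) 1) 1)
    (force c (cycleBits J M r₀ A κ B W α β γ d x₁ y₁)) 0) (Nat.mod (Nat.shiftRight f 107) 16) 0

/-- The conditions on the vectors of a family under which `familyBits` is sound. -/
def familyOk (D f : ℕ) : Bool :=
  familyCond (vec f 0) (vec f 1) (vec f 2) (vec f 3) (vec f 4) (vec D 0) (vec D 1)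
    (flag f 105) (flag f 106) &&
  decide (0 < (vec f 0).dot (vec f 0)) && decide (0 < (vec D 0).dot (vec D 0)) &&
  decide (0 ≤ (vec f 0).dot (vec f 2)) && decide (0 ≤ (vec D 0).dot (vec D 1))

/-- The disjunction of `familyBits` over families in the same plane. -/
def familiesBits (J M r₀ D : ℕ) : List ℕ → ℕ
  | [] => 0
  | f :: l => Nat.lor (familyBits J M r₀ D f) (familiesBits J M r₀ D l)

/-- The disjunction of `familiesBits` over the planes of a table. -/
def tableBits (J M r₀ : ℕ) : List (ℕ × List ℕ) → ℕ
  | [] => 0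
  | p :: l => Nat.lor (familiesBits J M r₀ p.1 p.2) (tableBits J M r₀ l)

theorem V3.dot_self_nonneg (v : V3) : 0 ≤ v.dot v := by
  rw [V3.dot_eq]
  nlinarith [mul_self_nonneg v.x, mul_self_nonneg v.y, mul_self_nonneg v.z]

section Families

variable {J M r₀ : ℕ}

theorem covers_familyBits {D f : ℕ} (hr₀ : r₀ < M) (h : familyOk D f = true) :
    Covers J (familyBits J M r₀ D f) fun i => HasFiveCycle (M * i + r₀) := by
  simp only [familyOk, Bool.and_eq_true, decide_eq_true_eq] at h
  obtain ⟨⟨⟨⟨hf, hA⟩, hα⟩, hκ⟩, hβ⟩ := h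
  simp only [familyBits, force_eq]
  refine Covers.orTree (fun c => Covers.cond fun _ => ?_) _ _
  refine (covers_cycleBits _ _ _ _ _ _ _ _ c hr₀ (by simpa using hA) (by simpa using hα)).mono ?_
  rintro i ⟨⟨m, hm⟩, x, y, k, l, hx, hy, h⟩
  simp only [Int.toNat_of_nonneg hκ, Int.toNat_of_nonneg hβ,
    Int.toNat_of_nonneg (V3.dot_self_nonneg _)] at hm h
  exact hasFiveCycle_of_family hf (by push_cast; exact hm) hx hy (by push_cast; exact h)

theorem covers_familiesBits {D : ℕ} (hr₀ : r₀ < M) (l : List ℕ) (h : l.all (familyOk D) = true) :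
    Covers J (familiesBits J M r₀ D l) fun i => HasFiveCycle (M * i + r₀) := by
  induction l with
  | nil => exact Covers.zero
  | cons f l ih =>
    rw [List.all_cons, Bool.and_eq_true] at h
    exact (covers_familyBits hr₀ h.1).lor (ih h.2)

theorem covers_tableBits (hr₀ : r₀ < M) (l : List (ℕ × List ℕ))
    (h : (l.all fun p => p.2.all (familyOk p.1)) = true) :
    Covers J (tableBits J M r₀ l) fun i => HasFiveCycle (M * i + r₀) := by
  induction l with
  | nil => exact Covers.zero
  | cons p l ih =>
    rw [List.all_cons, Bool.and_eq_true] at h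
    exact (covers_familiesBits hr₀ _ h.1).lor (ih h.2)

end Families

/-- The `j`-th eleven-bit digit of `n`. -/
def certDigit (n j : ℕ) : ℕ := Nat.land (Nat.shiftRight n (Nat.mul 11 j)) 2047

/-- Pass the digits `3 j`, `3 j + 1`, `3 j + 2` of `n` on to `f`. -/
def withVec (n j : ℕ) (f : ℕ → ℕ → ℕ → ℕ) : ℕ :=
  force (certDigit n (Nat.mul 3 j)) fun a =>
  force (certDigit n (Nat.add (Nat.mul 3 j) 1)) fun b =>
  force (certDigit n (Nat.add (Nat.mul 3 j) 2)) fun c => f a b c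

/-- The squared norm of `(a - o, b - o, c - o)` is `t`. -/
def normEq (o t a b c : ℕ) : Bool :=
  Nat.beq (Nat.add t (Nat.mul (Nat.mul 2 o) (Nat.add (Nat.add a b) c)))
    (Nat.add (Nat.add (Nat.add (Nat.mul a a) (Nat.mul b b)) (Nat.mul c c))
      (Nat.mul 3 (Nat.mul o o)))

/-- The bit of `t`, if `n` holds four vectors (with coordinates offset by `1024`) which together
with the negative of their sum all have squared norm `t = M i + r₀`. -/
def certBits (J M r₀ n : ℕ) : ℕ :=
  withVec n 0 fun a₁ b₁ c₁ => withVec n 1 fun a₂ b₂ c₂ =>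
  withVec n 2 fun a₃ b₃ c₃ => withVec n 3 fun a₄ b₄ c₄ =>
  force (Nat.sub (Nat.add (Nat.add (Nat.add (Nat.mul a₁ a₁) (Nat.mul b₁ b₁)) (Nat.mul c₁ c₁))
    3145728) (Nat.mul 2048 (Nat.add (Nat.add a₁ b₁) c₁))) fun t =>
  cond (Nat.beq (Nat.add (Nat.mul M (Nat.div t M)) r₀) t)
    (cond (normEq 1024 t a₁ b₁ c₁) (cond (normEq 1024 t a₂ b₂ c₂) (cond (normEq 1024 t a₃ b₃ c₃)
      (cond (normEq 1024 t a₄ b₄ c₄)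
        (cond (normEq 4096 t (Nat.add (Nat.add (Nat.add a₁ a₂) a₃) a₄)
            (Nat.add (Nat.add (Nat.add b₁ b₂) b₃) b₄) (Nat.add (Nat.add (Nat.add c₁ c₂) c₃) c₄))
          (Nat.shiftRight (Nat.pow 2 J) (Nat.div t M)) 0) 0) 0) 0) 0) 0

/-- The disjunction of `certBits` over a list. -/
def certListBits (J M r₀ : ℕ) : List ℕ → ℕ
  | [] => 0
  | n :: l => Nat.lor (certBits J M r₀ n) (certListBits J M r₀ l)

/-- The disjunction of `certListBits` over a list. -/
def certTableBits (J M r₀ : ℕ) : List (List ℕ) → ℕ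
  | [] => 0
  | l :: L => Nat.lor (certListBits J M r₀ l) (certTableBits J M r₀ L)

theorem withVec_eq (n j : ℕ) (f : ℕ → ℕ → ℕ → ℕ) : withVec n j f =
    f (certDigit n (Nat.mul 3 j)) (certDigit n (Nat.add (Nat.mul 3 j) 1))
      (certDigit n (Nat.add (Nat.mul 3 j) 2)) := by
  simp only [withVec, force_eq]

theorem dot_eq_of_normEq {o t a b c : ℕ} (h : normEq o t a b c = true) :
    (V3.mk (a - o) (b - o) (c - o)).dot (V3.mk (a - o) (b - o) (c - o)) = t := by
  have h' : t + 2 * o * (a + b + c) = a * a + b * b + c * c + 3 * (o * o) :=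
    Nat.eq_of_beq_eq_true h
  zify at h'
  rw [V3.dot_eq]
  linear_combination -h'

section Certificates

variable {J M r₀ : ℕ}

theorem covers_certBits (n : ℕ) :
    Covers J (certBits J M r₀ n) fun i => HasFiveCycle (M * i + r₀) := by
  simp only [certBits, withVec_eq, force_eq]
  refine Covers.cond fun ht => Covers.cond fun h₁ => Covers.cond fun h₂ => Covers.cond fun h₃ =>
    Covers.cond fun h₄ => Covers.cond fun h₅ => Covers.single _ ?_
  have ht' := Nat.eq_of_beq_eq_true ht
  simp only [Nat.add_eq, Nat.mul_eq, Nat.sub_eq, natDiv_eq] at h₁ h₂ h₃ h₄ h₅ ht' ⊢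
  rw [ht']
  refine hasFiveCycle_of_vectors _ _ _ _ _ (dot_eq_of_normEq h₁) (dot_eq_of_normEq h₂)
    (dot_eq_of_normEq h₃) (dot_eq_of_normEq h₄)
    ((V3.neg_dot_neg _).trans (dot_eq_of_normEq h₅)) ?_ ?_ ?_
  all_goals
    simp only [V3.neg_x, V3.neg_y, V3.neg_z]
    push_cast
    ring

theorem covers_certListBits (l : List ℕ) :
    Covers J (certListBits J M r₀ l) fun i => HasFiveCycle (M * i + r₀) := by
  induction l with
  | nil => exact Covers.zero
  | cons n l ih => exact (covers_certBits n).lor ih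

theorem covers_certTableBits (L : List (List ℕ)) :
    Covers J (certTableBits J M r₀ L) fun i => HasFiveCycle (M * i + r₀) := by
  induction L with
  | nil => exact Covers.zero
  | cons l L ih => exact (covers_certListBits l).lor ih

end Certificates

/-- The `i` for which `M i + r₀ - s` is odd and of the form `u² + 3 v²`. -/
def loeschBits (J M r₀ s : ℕ) : ℕ :=
  Nat.lor (shiftedPairBits J M r₀ 1 0 3 4 1 0 s) (shiftedPairBits J M r₀ 1 0 3 4 0 1 s)

/-- The values of `t = 4 i + 2` reached by the hexagonal construction. -/
def hexBits (J : ℕ) : ℕ :=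
  orTree (fun q => force q fun q =>
    Nat.land (loeschBits J 6 3 (Nat.mul 8 (Nat.mul q q)))
      (loeschBits J 2 1 (Nat.mul 6 (Nat.mul q q)))) 9 0

/-- The indices `i ≡ 2` modulo `3`. -/
def residueTwoBits (J : ℕ) : ℕ :=
  Nat.rec (Nat.shiftRight (Nat.pow 2 J) 2) (fun k X => force X fun X =>
    Nat.lor X (Nat.shiftRight X (Nat.mul 3 (Nat.pow 2 k)))) 17

/-- The indices `i` with `M i + r₀` in the given list. -/
def listBits (J M r₀ : ℕ) : List ℕ → ℕ
  | [] => 0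
  | t :: l => Nat.lor (cond (Nat.beq (Nat.add (Nat.mul M (Nat.div t M)) r₀) t)
      (Nat.shiftRight (Nat.pow 2 J) (Nat.div t M)) 0) (listBits J M r₀ l)

/-- If `3 τ - 8 q²` and `τ - 6 q²` are both of the form `u² + 3 v²`, then three cyclic permutations
of one vector, and two vectors symmetric about the diagonal, form a five-cycle for `2 τ`. -/
theorem hasFiveCycle_of_hex {i : ℕ} {q u v a b : ℤ}
    (h₁ : (6 * i + 3 : ℤ) = u ^ 2 + 3 * v ^ 2 + 8 * q ^ 2)
    (h₂ : (2 * i + 1 : ℤ) = a ^ 2 + 3 * b ^ 2 + 6 * q ^ 2) : HasFiveCycle (4 * i + 2) := by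
  wlog h : ∃ n, u = q + 3 * n generalizing u
  · refine this (u := -u) (by rw [h₁]; ring) ?_
    have hdvd : (3 : ℤ) ∣ (u - q) * (u + q) :=
      ⟨2 * i + 1 - v ^ 2 - 3 * q ^ 2, by linear_combination -h₁⟩
    rcases Int.prime_three.dvd_or_dvd hdvd with ⟨n, hn⟩ | ⟨n, hn⟩
    · exact absurd ⟨n, by linear_combination hn⟩ h
    · exact ⟨-n, by linear_combination -hn⟩
  obtain ⟨n, rfl⟩ := h
  have h₃ : (2 * i + 1 : ℤ) = 3 * q ^ 2 + 2 * q * n + 3 * n ^ 2 + v ^ 2 := by linarith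
  refine hasFiveCycle_of_vectors ⟨2 * q + 2 * n, q - n + v, q - n - v⟩
    ⟨q - n + v, q - n - v, 2 * q + 2 * n⟩ ⟨q - n - v, 2 * q + 2 * n, q - n + v⟩
    ⟨-2 * q + (a - b), -2 * q + 2 * b, -2 * q - (a + b)⟩
    ⟨-2 * q - (a - b), -2 * q - 2 * b, -2 * q + (a + b)⟩ ?_ ?_ ?_ ?_ ?_
    (by ring) (by ring) (by ring)
  all_goals
    rw [V3.dot_eq]
    push_cast
  · linear_combination -2 * h₃
  · linear_combination -2 * h₃
  · linear_combination -2 * h₃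
  · linear_combination -2 * h₂
  · linear_combination -2 * h₂

section Coverage

variable {J : ℕ}

theorem covers_loeschBits {M r₀ : ℕ} (s : ℕ) (hr₀ : r₀ < M) :
    Covers J (loeschBits J M r₀ s) fun i =>
      ∃ u v : ℤ, (M * i + r₀ : ℤ) = u ^ 2 + 3 * v ^ 2 + s := by
  have h (x₀ y₀ : ℕ) : Covers J (shiftedPairBits J M r₀ 1 0 3 4 x₀ y₀ s) fun i =>
      ∃ u v : ℤ, (M * i + r₀ : ℤ) = u ^ 2 + 3 * v ^ 2 + s := by
    refine (covers_shiftedPairBits 0 3 4 x₀ y₀ s hr₀ one_pos).mono ?_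
    rintro i ⟨k, l, h⟩
    exact ⟨2 * k + x₀, 2 * l + y₀, h.trans (by push_cast; ring)⟩
  exact (h 1 0).lor (h 0 1)

theorem covers_hexBits : Covers J (hexBits J) fun i => HasFiveCycle (4 * i + 2) := by
  refine Covers.orTree (fun q => ?_) _ _
  rw [force_eq]
  refine ((covers_loeschBits _ (by norm_num)).land (covers_loeschBits _ (by norm_num))).mono ?_
  rintro i ⟨⟨u, v, h₁⟩, a, b, h₂⟩
  simp only [Nat.mul_eq] at h₁ h₂
  push_cast at h₁ h₂
  exact hasFiveCycle_of_hex (q := q) (u := u) (v := v) (a := a) (b := b)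
    (by linear_combination h₁) (by linear_combination h₂)

theorem covers_residueTwoBits : Covers J (residueTwoBits J) fun i => i % 3 = 2 := by
  unfold residueTwoBits
  generalize 17 = n
  induction n with
  | zero => exact Covers.single _ rfl
  | succ n ih =>
    dsimp only
    rw [force_eq]
    refine ih.lor (ih.shiftRight _ fun i hi => ?_)
    simp only [Nat.mul_eq]
    omega

theorem covers_listBits (M r₀ : ℕ) (l : List ℕ) :
    Covers J (listBits J M r₀ l) fun i => M * i + r₀ ∈ l := by
  induction l with
  | nil => exact Covers.zero
  | cons t l ih =>
    refine Covers.lor (Covers.cond fun ht => Covers.single _ ?_)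
      (ih.mono fun i => List.mem_cons_of_mem t)
    rw [show M * Nat.div t M + r₀ = t from Nat.eq_of_beq_eq_true ht]
    exact List.mem_cons_self

theorem Covers.of_full {X : ℕ} {P : ℕ → Prop} (h : Covers J X P)
    (hX : Nat.beq X (Nat.sub (Nat.pow 2 (Nat.succ J)) 1) = true) {i : ℕ} (hi : i ≤ J) : P i := by
  have hX' : X = 2 ^ (J + 1) - 1 := Nat.eq_of_beq_eq_true hX
  obtain ⟨j, hj, hp⟩ := h (J - i) (by
    rw [hX', Nat.testBit_two_pow_sub_one]
    exact decide_eq_true (by omega))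
  obtain rfl : j = i := by omega
  exact hp

end Coverage

/-- The disjunction of `f (K + x)` and `f (K - x)`. -/
def orSigns (K x : ℕ) (f : ℕ → ℕ) : ℕ := Nat.lor (f (Nat.add K x)) (f (Nat.sub K x))

/-- The disjunction of `g e` over the codes `e = a + B b + B² c` of all vectors
`(a - K, b - K, c - K)` of squared norm `t`. -/
def orVectors (t K B d : ℕ) (g : ℕ → ℕ) : ℕ :=
  force (orTree (fun z => Nat.pow 2 (Nat.mul z z)) d 0) fun squares =>
  orTree (fun x => orTree (fun y => force (Nat.add (Nat.mul x x) (Nat.mul y y)) fun s =>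
    cond (Nat.ble s t) (cond (Nat.beq (Nat.land (Nat.shiftRight squares (Nat.sub t s)) 1) 1)
      (orTree (fun z => cond (Nat.beq (Nat.add s (Nat.mul z z)) t)
        (orSigns K x fun a => orSigns K y fun b => orSigns K z fun c =>
          g (Nat.add a (Nat.mul B (Nat.add b (Nat.mul B c))))) 0) d 0) 0) 0) d 0) d 0

theorem testBit_orTree {f : ℕ → ℕ} {d lo k b : ℕ} (hk : k < 2 ^ d)
    (h : (f (lo + k)).testBit b = true) : (orTree f d lo).testBit b = true := by
  induction d generalizing lo k with
  | zero =>
    obtain rfl : k = 0 := by simpa using hk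
    exact h
  | succ d ih =>
    change (orTree f d lo ||| orTree f d (lo + 2 ^ d)).testBit b = true
    rw [Nat.testBit_or, Bool.or_eq_true]
    rw [pow_succ] at hk
    rcases lt_or_ge k (2 ^ d) with hlt | hge
    · exact Or.inl (ih hlt h)
    · refine Or.inr (ih (k := k - 2 ^ d) (by omega) ?_)
      rwa [show lo + 2 ^ d + (k - 2 ^ d) = lo + k by omega]

theorem testBit_orTree_zero {f : ℕ → ℕ} {d k b : ℕ} (hk : k < 2 ^ d)
    (h : (f k).testBit b = true) : (orTree f d 0).testBit b = true :=
  testBit_orTree hk (by rwa [Nat.zero_add])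

theorem testBit_orSigns {K b : ℕ} {f : ℕ → ℕ} {x : ℤ} (hx : x.natAbs ≤ K)
    (h : (f (K + x).toNat).testBit b = true) : (orSigns K x.natAbs f).testBit b = true := by
  change (f (K + x.natAbs) ||| f (K - x.natAbs)).testBit b = true
  rw [Nat.testBit_or, Bool.or_eq_true]
  rcases le_total 0 x with hx₀ | hx₀
  · exact Or.inl (by rwa [show K + x.natAbs = (K + x).toNat by omega])
  · exact Or.inr (by rwa [show K - x.natAbs = (K + x).toNat by omega])

/-- The code of the vector `v`. -/
def code (K B : ℕ) (v : Fin 3 → ℤ) : ℕ :=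
  (K + v 0).toNat + B * ((K + v 1).toNat + B * (K + v 2).toNat)

section NoCycle

variable {t K B d : ℕ}

theorem natAbs_le_of_norm (hK : t < (K + 1) ^ 2) {v : Fin 3 → ℤ}
    (hv : ∑ j, (v j) ^ 2 = (t : ℤ)) (j : Fin 3) : (v j).natAbs ≤ K := by
  have h₁ : (v j) ^ 2 ≤ t :=
    hv ▸ Finset.single_le_sum (fun i _ => sq_nonneg (v i)) (Finset.mem_univ j)
  rw [← Int.natAbs_sq] at h₁
  have h₂ : (v j).natAbs ^ 2 < (K + 1) ^ 2 := lt_of_le_of_lt (by exact_mod_cast h₁) hK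
  exact Nat.lt_succ_iff.mp (lt_of_pow_lt_pow_left₀ 2 (by omega) h₂)

/-- Every bit set in some `g e` with `e` the code of a vector of squared norm `t` is set in
`orVectors t K B d g`. -/
theorem testBit_orVectors (hK : t < (K + 1) ^ 2) (hd : K < 2 ^ d) {g : ℕ → ℕ} {v : Fin 3 → ℤ}
    (hv : ∑ j, (v j) ^ 2 = (t : ℤ)) {b : ℕ} (h : (g (code K B v)).testBit b = true) :
    (orVectors t K B d g).testBit b = true := by
  have hle := natAbs_le_of_norm hK hv
  have hnorm : (v 0).natAbs * (v 0).natAbs + (v 1).natAbs * (v 1).natAbs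
      + (v 2).natAbs * (v 2).natAbs = t := by
    zify
    rw [Fin.sum_univ_three] at hv
    simpa only [sq, abs_mul_abs_self] using hv
  rw [orVectors, force_eq]
  refine testBit_orTree_zero (k := (v 0).natAbs) (lt_of_le_of_lt (hle 0) hd)
    (testBit_orTree_zero (k := (v 1).natAbs) (lt_of_le_of_lt (hle 1) hd) ?_)
  simp only [force_eq, Nat.add_eq, Nat.mul_eq, Nat.sub_eq]
  rw [Nat.ble_eq_true_of_le (by omega), cond_true]
  have hsq : Nat.beq (Nat.land (Nat.shiftRight (orTree (fun z => Nat.pow 2 (z * z)) d 0)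
      (t - ((v 0).natAbs * (v 0).natAbs + (v 1).natAbs * (v 1).natAbs))) 1) 1 = true := by
    have hbit : (orTree (fun z => Nat.pow 2 (z * z)) d 0).testBit
        ((v 2).natAbs * (v 2).natAbs) = true :=
      testBit_orTree_zero (lt_of_le_of_lt (hle 2) hd) Nat.testBit_two_pow_self
    rw [show t - ((v 0).natAbs * (v 0).natAbs + (v 1).natAbs * (v 1).natAbs)
      = (v 2).natAbs * (v 2).natAbs by omega]
    rw [← Nat.zero_add ((v 2).natAbs * (v 2).natAbs), Nat.add_comm, ← Nat.testBit_shiftRight,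
      Nat.testBit_zero, decide_eq_true_eq] at hbit
    rw [Nat.beq_eq]
    exact (Nat.and_one_is_mod _).trans hbit
  rw [hsq, cond_true]
  refine testBit_orTree_zero (k := (v 2).natAbs) (lt_of_le_of_lt (hle 2) hd) ?_
  rw [Nat.beq_eq.mpr hnorm, cond_true]
  exact testBit_orSigns (hle 0) (testBit_orSigns (hle 1) (testBit_orSigns (hle 2) h))

/-- No sum of three vectors of squared norm `t` is a sum of two such vectors. -/
def sumsDisjoint (t K B d : ℕ) : Bool :=
  Nat.beq 0 (force (orVectors t K B d fun e => Nat.pow 2 e) fun S₁ =>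
    force (orVectors t K B d fun e => Nat.shiftLeft S₁ e) fun S₂ =>
    Nat.land (orVectors t K B d fun e => Nat.shiftLeft S₂ e)
      (Nat.shiftLeft S₂ (Nat.mul K (Nat.add 1 (Nat.mul B (Nat.add 1 B))))))

theorem testBit_shiftLeft_add {S e b : ℕ} (h : S.testBit b = true) :
    (Nat.shiftLeft S e).testBit (b + e) = true := by
  change (S <<< e).testBit (b + e) = true
  rw [Nat.testBit_shiftLeft]
  simpa using h

theorem code_add_sum (hK : t < (K + 1) ^ 2) {v : Fin 5 → Fin 3 → ℤ}
    (hv : ∀ i, ∑ j, (v i j) ^ 2 = (t : ℤ)) (hsum : ∑ i, v i = 0) :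
    code K B (v 0) + code K B (v 1) + code K B (v 2) =
      code K B (-v 3) + code K B (-v 4) + K * (1 + B * (1 + B)) := by
  have hj : ∀ j, (K + v 0 j).toNat + (K + v 1 j).toNat + (K + v 2 j).toNat =
      (K + -v 3 j).toNat + (K + -v 4 j).toNat + K := by
    intro j
    have h := congrFun hsum j
    rw [Fin.sum_univ_five] at h
    simp only [Pi.add_apply, Pi.zero_apply] at h
    have := fun i => natAbs_le_of_norm hK (hv i) j
    have h₀ := this 0
    have h₁ := this 1
    have h₂ := this 2
    have h₃ := this 3
    have h₄ := this 4
    omega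
  simp only [code, Pi.neg_apply]
  linear_combination hj 0 + B * hj 1 + B ^ 2 * hj 2

theorem not_hasFiveCycle (K B d : ℕ) (hK : t < (K + 1) ^ 2) (hd : K < 2 ^ d)
    (h : sumsDisjoint t K B d = true) : ¬ HasFiveCycle t := by
  rintro ⟨v, hv, hsum⟩
  simp only [sumsDisjoint, force_eq] at h
  have hland := Nat.eq_of_beq_eq_true h
  set S₁ := orVectors t K B d fun e => Nat.pow 2 e with hS₁
  set S₂ := orVectors t K B d fun e => Nat.shiftLeft S₁ e with hS₂
  have one (w : Fin 3 → ℤ) (hw : ∑ j, (w j) ^ 2 = (t : ℤ)) : S₁.testBit (code K B w) = true :=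
    testBit_orVectors hK hd hw Nat.testBit_two_pow_self
  have two (w w' : Fin 3 → ℤ) (hw : ∑ j, (w j) ^ 2 = (t : ℤ)) (hw' : ∑ j, (w' j) ^ 2 = (t : ℤ)) :
      S₂.testBit (code K B w + code K B w') = true :=
    testBit_orVectors hK hd hw' (testBit_shiftLeft_add (one w hw))
  have hneg (i : Fin 5) : ∑ j, ((-v i) j) ^ 2 = (t : ℤ) := by
    simpa only [Pi.neg_apply, neg_sq] using hv i
  have h₃ : (orVectors t K B d fun e => Nat.shiftLeft S₂ e).testBit
      (code K B (v 0) + code K B (v 1) + code K B (v 2)) = true :=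
    testBit_orVectors hK hd (hv 2) (testBit_shiftLeft_add (two _ _ (hv 0) (hv 1)))
  have h₂ : (Nat.shiftLeft S₂ (K * (1 + B * (1 + B)))).testBit
      (code K B (-v 3) + code K B (-v 4) + K * (1 + B * (1 + B))) = true :=
    testBit_shiftLeft_add (two _ _ (hneg 3) (hneg 4))
  rw [← code_add_sum hK hv hsum] at h₂
  have hbit := congrArg
    (fun n => n.testBit (code K B (v 0) + code K B (v 1) + code K B (v 2))) hland
  rw [Nat.zero_testBit] at hbit
  refine Bool.false_ne_true (hbit.trans ((Nat.testBit_and _ _ _).trans ?_))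
  rw [h₃, Bool.true_and]
  exact h₂

end NoCycle

/-- The values of `t` without a five-cycle. -/
def exceptions : List ℕ :=
  [22, 58, 70, 82, 142, 190, 298, 330, 358, 382, 478, 658, 742, 862, 1222, 1978]

/-- For each exception `t`, parameters `(t, K, B, d)` for which `sumsDisjoint` succeeds. -/
def exceptionParams : List (ℕ × ℕ × ℕ × ℕ) :=
  [(22, 4, 11, 3), (58, 7, 6, 3), (70, 8, 28, 4), (82, 9, 28, 4), (142, 11, 37, 4),
   (190, 13, 19, 4), (298, 17, 46, 5), (330, 18, 32, 5), (358, 18, 54, 5), (382, 19, 60, 5),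
   (478, 21, 66, 5), (658, 25, 80, 5), (742, 27, 82, 5), (862, 29, 88, 5), (1222, 34, 110, 6),
   (1978, 44, 146, 6)]

theorem exceptionParams_sumsDisjoint : exceptionParams.all (fun p =>
    Nat.blt p.1 (Nat.pow (Nat.succ p.2.1) 2) && Nat.blt p.2.1 (Nat.pow 2 p.2.2.2) &&
      sumsDisjoint p.1 p.2.1 p.2.2.1 p.2.2.2) = true := by
  decide +kernel

theorem not_hasFiveCycle_of_mem_exceptions {t : ℕ} (ht : t ∈ exceptions) : ¬ HasFiveCycle t := by
  have hmap : exceptionParams.map Prod.fst = exceptions := rfl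
  rw [← hmap, List.mem_map] at ht
  obtain ⟨p, hp, rfl⟩ := ht
  have h := List.all_eq_true.mp exceptionParams_sumsDisjoint p hp
  simp only [Bool.and_eq_true] at h
  exact not_hasFiveCycle _ _ _ (Nat.le_of_ble_eq_true h.1.1) (Nat.le_of_ble_eq_true h.1.2) h.2

/-- The families: for each plane, encoded by `D`, the encodings of the families using it. -/
def table : List (ℕ × List ℕ) := [
  (28604349030463, [3746218286762738992698108500161444749737966139634603156633978472627791858308540575735298957171902153557278678031694601049837146787854076653751695401695464838796229535302983055074088935281484731271034995721489375114748036092168176411156744084922561,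
    328391901614119041073497237758203278854784867898499265,
    75223065477540847641370019774047013580350917510174353832805392576,
    15600954300328874670087184830521828993725045926797505,
    19995391825294718744970047376956505824096866154851967609368207552,
    155072640151469724226766388821732029429453955265,
    52799190273603448796539040099257363194048,
    81842012497878287949481036879846115709127779714746601966436492311454721670628443431521101790893088393224868749504,
    521481209941628445335976410725662768610647201307189063891537937703152658363372556219285758912]),
  (24240393822271, [450332806845898395440082636612319662331531940306116175659009935265613799623900951101328903543756462552906834572793168186752122081202104325807330319010832145424577,
    71037723644738673010223708609372168225787531517761,
    126033588609661407557519762314312235560755009,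
    1338867278804454318544726620850818325600625363190918668609,
    430598717395609825429449464650783691786318487489,
    4391278247564249080315942921501791016686706565066342036252306431938,
    208902008110098342975714766845268588936455533858527830497812289,
    7770675568902916283677847828161331158954829780544650059786275569617001824797173211074]),
  (19842078875711, [82631996099983528680400774372963491539689727167955287373720337511676594162443910676199188173217644417804505211350096503105,
    237146723874213192294014830203631827440931078341979971981190272752733581732700481,
    742882446513667871716232063101639927555909738819,
    742896362029929555723224837074967546257325743937,
    2831159937815807111588250685492943503023937,
    1026164912929872098721151871950515134273,
    161390617380431786853494948250188242160783712828879083991382804526554595165678214068395825747007122727879562748591398721,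
    49043037535271275522852099789065119186281527059164454594,
    2790316738808607665595868659055433511559489,
    2787593161036730396813576621568705000628674]),
  (19841810440255, [978448486627741777483491196707313483454532499789419994914210874233139611366017843925217979171503504171713,
    17535519557938360759657034520762937262765204321017575383619840274063941,
    4778731110354885404304096383930065824506437,
    8205365731869773953816146779934024960248679392186018382192142328714019037380,
    24132655471650007477492204733321981259218093597253,
    192172993230669812989955293510352562985389507837189701,
    219952336681056708767280470010421103610966201737156997157895780982341,
    242655840177388674866649532279189015479854662966853,
    17498085063662885660085626115691331084789474794949680898117735458380194589992451879033654035163980481,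
    49691984163727714512415396043117232132395489026629,
    24252687794262744831873078643637992125859464471109,
    49341203658946879665795953270122580303429,
    22306540799742270012920450446850304689300037,
    21836568727197652638388514399340276408260,
    45694227603071880722975839605766368522570555973,
    16117551968552090633501726570712228036,
    3705346855594118253554271520278013073605384709151212198726728149851901067714500]),
  (19841542004799, [117483752133775390905009452255689686786024894342933473560593837627022676207957079315924189613531150118189983893670678884966903307597133656630485700,
    948626699262896549224731713765249199436719697473365815932467970374992438955630020,
    14355200064428320280455150743393023873180225,
    61134947139625500620303922759021748121907958798930758270116091223617,
    19280308908679831049613025041131614776217154040447077444657170748481423138611908,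
    3885578693527534870738898652249349313560867873349842501921776839919487231705624797761,
    210518299645350089090430882484477439003531764262150869936431681,
    70244250926686162811251293088435694378516057447876,
    232496106222962818301838296141810374425055681733371499511702314195925605572036,
    220631920100729521269555356108548842971844,
    310189259356061917698869555491266641634999088986097195997486532,
    52866657868887353826095623071344543543615157117477112607226651201,
    1440420577006544267010269797903284384587204,
    11417982223708793758706446486635313406904655300,
    645562469521727147413979793000752968582426507007976194032295327667302730228538505396076988560275265725504824034246779588]),
  (15477855232063, [63827697327244440609103642027620278597287482920768290008637748670511056685591144932039,
    19455893121643361534938950688084871003787958904542962375,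
    10215527141385806790422252004177441592374672637384716561065568199618,
    281729343439100474650677828558242040737931975,
    12370887045963247967245502842687185535188866838716229,
    57954585232133374495390061823391955463388267028750475540202965737286665216711,
    242694760106578426345978101372926336725474358728485499684755694575429,
    248661618270026371273681484200036558582081456030533717801253671668675750002077098549959,
    92018489093231441296051354988944410010492359,
    191749061204763759690478344323000906380998490620813637,
    193743179729538703831825928048156616518688581,
    2923185905654333354031291382304070908011745501509,
    11972621415802392392029539034058422093373673206440130,
    178411406117501264066583672267100659630775751]),
  (15477318361151, [1607771735302432005110099299576375644865827039843388893406149,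
    6132975318816809123441791410351234193228227811084459458,
    790779671708211666095631722678438743002292174313642564805,
    189556685769315193734553944215468613265562821,
    45671969733534650987592651237653325495042956738,
    6131484587146905826206323492601616200675023216977011394,
    5455318681541432325246172384866627117762,
    49040044379918021823041793420957690815897601842177154245]),
  (15546574708799, [205766938027641473349193099314979995130397032905394707783212613,
    216522277384516285666721728564730888519328542200343194487548967722433,
    3220153393787931253272860677050945001915525146486314181418948,
    178754421387557942396176651959163684668777153,
    2993161240650421589560956069837090170260156308331969,
    13164036458569836140200150492118773766063820735941042356333125057,
    379990425706035424338720306559249552776161959861829,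
    3369993333399959956496840441311054531767693017914717247504718568897,
    748187771976976049849010644759600709,
    174309643287317974484639091744086808355397,
    11299108725976881457717679549613940161]),
  (15580397576255, [6743298988966737211387361774047280550746048835277516827173863894545866622351855965391513059302855,
    66750614171484933141209323899913884477242560364106765921105663683958496775337793757566653783234,
    252262657260566177375546392605302165606480020426903784448962,
    194558021883801840483418292065067136512819271058891463,
    948630366118823349864659109703820311393101710152897491837181123975579633049492674,
    834468144728481444843099366931748058709804691232767696066,
    33452149456327513990743478445955486430764487,
    3653778028119681291017711502106649345727688318407,
    3138646838716958411835572158080701791929002337773399695173,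
    822752278672955632927529990715595368955659645278596788789533890,
    178602655441607432889683094890867751308420034,
    12451526320938565347974371297066118775993872047638928578,
    5798368710018216362283323734119497979434982594,
    200867255719538073803470087124129364441289999665084394200258,
    730862344265387159656299881632863159314019343554,
    4070815637249397496144558151790372609635174458043112139314009701873150451525]),
  (19842072584383, [2976043004893616954827473516795397574561325795937107533869450925453954231646994345500779166155773067154543842057721660548037,
    948576090357431605751443607881308725826310607901844817580724026712711294234813118,
    421254248772724443162393835570524977773534635940452792656655704766,
    26960975308367119033314992095176489051422247298515395943464715575998,
    216535441646215018697690897912768437769771457211929982692245474679995,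
    7707121516176631177027511836623875425469140236533794627114754396170440867377700290,
    56539116183093993222823114654208883625819061112517370054530253156613333957,
    190829630303781697318838204841564485924514715262402,
    57422556566274606889108023121134055590384296699345473338615763529603457989,
    896432476992980089482934259095275212146515131,
    2177157550585777068319374238768238754979013310,
    46564002604027608076477694637931814985409733573,
    17254365870391152824613565008703001363696721848229241289982620885672898,
    5857603111733345575365352738191117528802618547387,
    189996662404875409293590449993559796926516531454654,
    11158895610037382430146346327365898384563650]),
  (24206835212223, [109733118132263270962704451528663794588529566631627443168747504316620368451434286302251423164719702841651230963606577369603661762,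
    173747443696469054624758097371719261937640803373562776294398091585,
    13199739452444632757102294662013175852719148174598558723756013385968190485417182650177,
    63901508814147070657483964110678818069922253566649589569,
    1620820337164689544572740331560244538761154,
    17103744875735366719414907689483490684505536964059457,
    17080269504286497915313288624381655183354536683102015,
    41019666323766687715492161949538101100264569829318975,
    127084380558824159815433955073597338509303740,
    14103921418473762148547714043931082486132056528085188,
    50134090680604078089027827245458225431592124281047294655,
    145998099763910279541241076566391628917148580166855292845227719775314926211509937850891107006053783069561148659144263588493090108594113093134804711315190256489550414502843981154819416484733771714,
    657302100360875358193392680367167984096333269766003294658492,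
    938968370508706738338838360703079432485392403314913599045,
    194079385858453076529498129138555620379054197170747,
    210823403413999700373960661554895411174642699749178152673476,
    1120150883791206975183247860717820759176250500263720704772209062871484891065251742720474295547185848891,
    146720306062291196128628166006995905928930360914099346218670676452457999299609960555190673727,
    25326623104388203972505251779742765342652,
    1561637932624711027178847912141808915186050597319583801037504967802748548363714312684582330134933150898611564687472972781527524967668410288775871,
    8422736268154161567449125046583416928787112343542424180832938875811749326307234816466084411,
    788045836038812082954547471139847395412888510398,
    28309326428171047167283030570262480329999576936827780588091,
    287807203650230924724002063514917725351399870214288360677041810467192269726918200264695778094700133605947,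
    237639004559921095190207274556887298141081352266428,
    925506251687177400691194051330749997113139771,
    6097165138046442290192750616769814757004975893667309063050292624979012250282212614615854537021953060165290365207069036139070260670548224762427,
    95971714395284782647902543548046050720616790522585659,
    8875645801974479115344552225878526879080391116801836057149234251406860484,
    1689541564879463140415352632396535266456312237515323,
    57996059032469145101745233655521761327628411199,
    1053783602672932728193260337276268432853642423127072700,
    728615190665569609367156251447706869956,
    12855505886567463092873791975909078909624248971197094160228286,
    196013444161980563225187072430074879729596,
    2722425917993020866225231742147610206140,
    42702250988998848036013905726327939268,
    340293591515496545222239989851441094465]),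
  (19842343116990, [206092956726071531223980096459272991604917543046123196452527679,
    53920100636372261134734242534140748832633013642388690153101688119483,
    46768767587478746995019974675338357666307380273729,
    189564513011433698851268632219593941120540223,
    187169284722206273708753661840518473167419273568833,
    883423532389192164794641917142697210997995040680969503506931440405177020,
    21778913456606061393381635508823968013887,
    21778259244008486880492501036313672179140,
    730750826832229259511471006424350706810636820031,
    200867255532373784489023664601402881067206201364105059623612,
    522673882574254948407273494763549796262465,
    11972632830996638636968358932094866996609106370911684,
    187072387984317162767135585681265467300625756806719]),
  (19842877906880, [13963498921641300919858079068543444629544894,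
    110435647033157597576191261651246898476025359024494993471,
    29235923105168868124804130491282809822544718192705,
    29998932076233679041094200941057659625537,
    13164086675383534354582562429058437907397538729006041089117806528,
    1628276604963429461164302651236750577487059820261466306,
    11418330033338081504539333096804380363952529341,
    90388167231047101262067402159455985856,
    1742251036373496968971615625335109411921983,
    12259964326927111207150301940397683012160307556724465598,
    1546288182779155303684747267571242822920096160047167,
    102844041154166617145431452140537733450823982265393688766996543,
    5445183323067168169990073937567176089792]),
  (19842351521727, [30130447317249178483115567340049677655846165680985834281889419426709632911026856787505980955155674969318367013474905915946942718226566967561543227,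
    238384134371191628877684934718409337826653339485691988471278719778873921,
    6638880110050014510469653061034858170966598332,
    6459080351222253011081864017314187868481019332,
    1046780246137418397931066658634607404074078628176577973464359493,
    3604948838816078235985389363556638818986298245718203,
    227227254176326107730881935856720940243819111622736967510798841667131,
    282144249517359676401189250467201206814007877,
    16568888536562574066642328584411023891263439954174592789502420515210223278117599253097422271,
    3251265262781899290418994328232508807364542989410491,
    1690748607049186075163725483238029684970268480495163,
    55348254435208695678011387828808800977827748174318381911252165189,
    15923659191865200438650530896727414106170049,
    15929103709733627874198554382451420527844923,
    44699443835634185607874233807716477385568254925895414356706461644864587872411071,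
    17239184327369195551925219324654055700202611594215462028457214911451461466842979899,
    20466309238362000931635263838269098660636963139186532059665902739565425120453313,
    409173829035600302780143772109808420876749079550396011037322612863227748359559776730130860142015694782666623876600165991496550279785471214474006454212,
    118683827926239911467135744630318175960584790619785327960405384639,
    50012846331076326218961674202610956140532322825055167041,
    5820693234523973519202877231817678441956842943,
    542405946115635087460678859195426358778607096938067516771420124620591320282645724780060866551239,
    17363826055392901241608012373146940586599250894975079285625753378077410565025365363829473998250681,
    359614448603016851048218206504228368200033833864027440469420038203362607978250171972825091467674677210019996377104188116657086,
    746007624003674366347648459978332309066107713259940010514991696294615796640820705075897,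
    6788319506546915331277605754236498031204202057162715375636209467,
    5921072150238760392010883034977553986207244091,
    862245931206393723160108561053332260943185654978830661,
    12463920597162217545052166920331381944667546802071920965,
    200874164346619904095437623969987201072935568216427221606725,
    15914366349291441692434636973642886292466406752845339395954386262182129268705003916321726,
    36827789758838350060911181451154718362328891,
    338460657596687530813014316651112176068265126744878036191664218828441685826719093144959786940869296731488419897507730506621625,
    95969186208111464356605780395234091249969806449729339,
    784640756854771802781262795352008937727737932914606628667,
    226383676669641309500342583579599044731205,
    12825642967101642593962667020718595899,
    12311626340586473369361230845382668801541267781,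
    24501837012389522689428606123376689226433,
    2993166952450564299308341380787003669842095405916485,
    561947413048491194782085058502406481755877860680377,
    393452315678564317156411891569371587265,
    43556974573009384321623404166492044959175]),
  (19808786603839, [12543494289552827260263158170749562375775511043449535,
    92208414090794272949235327114198039693091387,
    103246161662872738538017706273502126091655748194527677997113915,
    526664302869549600869290547801862590988413217568682566060698755006,
    17129766078754451156483342220203250057166791359,
    22119787754312408399733900911368727421249,
    201457962028613741266383927362044803670587,
    3073445963064546404574776085212512051132,
    6309862071231121114240771076241943948899222740924,
    379990425711486006816301255094372268500039247061563,
    1106676591596017200771344443489418993598,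
    111852515419742055413188501869671022492360895,
    178583004145225273039841994064487596531114555,
    1427250797877017468441385461870559947886944577,
    1449570215976973119366165127324520041596083781,
    5445941389327280610154682135479978123460,
    353894991664447896215636177598209982488133,
    65334879890489055861289726418851489472708,
    351213938794166309855054421778140723388607,
    187439679385328899458047222666518085,
    723100862381705023567580818649734176702]),
  (19774697398206, [27606991969180535009912856363014849916617752930967506977714457661119929,
    3445474016580870935250520946323242344255,
    137053455287867881542749362505987899354594139967,
    1732184183823006217572378604642607163206008016828326314630484935662782,
    7068100094513598523386866549059401871863649502584057715902,
    374192332332355685570934202669356046256336589053886,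
    105329974264145958055760179308924787838065787958967179684521008318,
    187169442270219899166000670526881408450437932049346,
    2999001560510400815653772733523489162541244114509241,
    374145134179851846011180885525528070389240157002942,
    233840264766664860325215857127716984250959743984327,
    189578798972394825434557939894713561631399353,
    98845962386652832421160804876186555236648936308284039105,
    22307212558346332192643849568953061585477566,
    5887570999520238546306805483835980069739781310,
    784637716934753077744222544824849670835220292285588561854,
    730929230411924007714661867653634077607343398329,
    25717335041485553615693159603467338550809880994571064095776185,
    174229983070241991184119660207655489723582,
    8168106866809322420462542040011046429383,
    178406046659828849134868551622771885351035842]),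
  (19808784506687, [127563425345858802049318858436239080052552549402120854315148153624396014692198002568700095,
    751652157525691316698728258598659445465571518,
    349172929978960585050741415787390204665663,
    713689904343497633214200621404575364927217471,
    178408683858605513074467237348568560571506878,
    15177100720513508366571152141811386457432573801505978340050131167586134396400296257,
    178406004124575434760593145579782362167746751]),
  (19774693203903, [38752394575537464473015180424761734132527081124040654287163765679719194005797114594505497439624773,
    63697410013259767959535617243356049247729043998793294145,
    802057727316655457571086326802133973520428873319191729286036740705524925856869153338857398296508,
    7772574564142084914438679358446411855426470512137110079080282963474631247364969536961,
    421249402519177662731931411606882011227948808083432194413006151237,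
    215733362459102335182791682095555490868145107217207898225989179661893,
    3186810756930600545213549566737066738311494429121985,
    5851905315242408734984736315171715797343557149243,
    747300971739171282622799043029026908704677313,
    7261922836591939145674784486969816818918564543,
    2962503853510611209220772063750167706279867,
    52094544585537260526061323322308663927270088635,
    8749002899132047758213233177946895400865820884314619221773029314002319306126092926230216004405894593,
    36460246151100871215817061941679272087248453,
    46779503827973028843485963251001570248744854609858,
    12263191328965148168370745345773289213206425532640599489,
    778430094103954320589455747374520410815,
    193649691917636272287134822337113964636611919552443,
    714212545648851125435226709650350504424758716,
    174922604308401821949621564625965185752645,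
    2134283407328451667341815544872139697879690541859371691097208309149007075045564225,
    1396530309780625022796201024242625941692991,
    192923936268833409280780407813334758542583071269435,
    730761969718782727769110562045302520372744184379,
    10800770211848177266785649180839845819]),
  (15444825104320, [206904787693196169153333100201003251534962950426058815,
    44253593872218551001425141968693302911039,
    281590598714354782157353537009217588488560705,
    11973449395082541087171699487090947049552644513194049,
    189556334188500543271027531288213912500035776,
    22118437767851201588160113853389685645383,
    1393839111038280522131617332929343953952833]),
  (19876442824638, [43390921666725007521916291372789465782891171928613620835917761,
    200929636450616291623444109302047269573889304151950844058818,
    12418072667091616193994507554313004491285280020471745,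
    200879551822004216504164105390823953010395515438426794056898,
    1496623437761448039609977291072499918994420081335751,
    3236630792863651585551795054901106015684975993936141180098,
    107759484421072438919183863770506597501829214318485307,
    12856289183584629124658255299278582169709167233540162503924930,
    377084727983914785429411235110758651697423308643522,
    607984696505016617217315928660549081383997971340743,
    1568080557864734922342894642160150403654329,
    178411407612878089759474214488164005942746306,
    17128418172259946182873624958949845365463014594,
    91526440832958771074996433857395108331868216514,
    17138123068564437719425241300168669403802428350,
    17128371905146098585584044033801551584668197561,
    3117123549125808072387868537343588687679,
    11309494961167230924231486151783963842,
    45694229634049178737513581369235365322745176002,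
    374144419157052261190151271399144028984775722114503,
    3743189948367351164243888819749239365569]),
  (19842605244735, [14990040013286954517648505330065090754999907936870593,
    787955064696443361542067994810160945392591561023,
    2234651360504870673822045175768227082826440513,
    46385770558630324008555502951288996350462517186,
    883423953638359330197189011063213154987981646266612621342995189433622466,
    2935135098565751554314613511360378505871183831359,
    44280001951523556508456102919848535826623,
    3447364065495560671011506652735056355265,
    11973403633953765720015485693259117634495132600360898,
    95781702066304872434878188501150359221861148265570113,
    21120151993660946386641817498067135]),
  (19740603998142, [25206584331703533399271399875453385119188668426440313642945,
    1532519383038966078999970977943392589284114307851771838,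
    91343874452969347049717314273086927356828835647,
    5731313299432530840490510085979668692662820287,
    1496670449142445123020194300794750859973639078485439,
    95780971417037359604510122087212445289714623104228799,
    366891860006226810349349765088849234885828648897,
    5786213377328595980584340117761364615749,
    1502790485833278703191395201710815767939061067636676,
    6302725816435366929093649307516356760226730417599,
    5786151064119375208620354830685703233730,
    6729888517845090995817777662218280383,
    27227907093653612966912326722807070139073,
    1496577765829825383360569396997922350616710487203774]),
  (15376904642367, [12274979852587472387085258516692365503308955339069563071,
    3189138186456502942904440324585132391285325618158460985665,
    2831193324336296008268266035665673951109314,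
    11430917716109577762375046320576958930181152702,
    53180214832376927457470781970283733183]),
  (19876971290815, [900456418690493719216432172760696375771587738571204570297706029225900016947653320895784805744001751702972,
    496824213615239708544318818568514090480236799134106549955077050753732,
    243319360067081884632649794231428491272900,
    29416237057842384760997562147391401315511990138187484950138947657971809639868,
    781447485252962676098174730546819473147951703399669183,
    25319333001673112210601284655136241640132,
    1000494339895919711590604465734420278727912456333793195767477820860,
    952339742503592444060349511212020678029181374243398658695610171845715949664690751,
    4171849679533027505130089618445672862206734610645587631521812348055610973631948387762029272511,
    46905090692305778447368279662752529535215135187519,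
    180690768431439500883952563918985514394305,
    91366327314926258313072416265278765420585706180,
    177638040562869430091041234615972442135996,
    91343861181853195320974762991862493141722455484,
    1033485975446317762581868456339129228732,
    22475023771273939982084434698196354641943996,
    179799759005304006231703443068586965691621951,
    47498803213254345835974080145626556200893847510463,
    178408683848175905362941309813884241658798788]),
  (19843146342336, [95767345256766175128551665829361580546065099600308782690812245217231209537978230752332035905670057766866564263974344846602822213695,
    18146434950115221517618316034979891577130836033,
    23601931132566809414314960907033938278264210110855994993642415600744580973936936613624681470091329,
    15648645997734276255169162278366409943597476141080003453847101376,
    8949287961420305887336822992941710565441,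
    46369652151268679964238647647702774440001,
    174309643279640760553135804628541409058879,
    1386340219431279405260048961237623708770799076864779173724687503281626134423854008141176397924237082517024634030296507754203832377,
    961178633692094179873546505525798345976201841573922935610120179988166631481,
    1897137590064188545819787030642307009206607023714968126327811259661663252153229377,
    14821389189223539450962261977404440642537475181482821495912331579119152246186049]),
  (24172746006590, [15922130501869228561384820317661340793274931566641790749572293480400407630676180144725179,
    16542419564117122294655718974614807318977430057639874,
    62226142625829164609886790260361304572704367211040300680336247898176453233231958941631,
    292945790144727657894607777000229378190139719,
    3720472846006826387468283776402111290395707835936715212470573461495609,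
    56144345798030133254562566666112070896342981929807684549,
    3009171563332245790274158190427410850144065,
    17164651482637281279503810532747990885322448834,
    1770351866072840711301077736764230327395528028235883757985926241112267963,
    3554379331674821962958149878471650826075112500977465,
    14245231419723997760523112875247529262757138331507917586935317029626879935,
    102954222390715551830877948452498434038598557497,
    11973358589456476582295386957647345446981356481339719,
    57422530454381113444036319665652990657999459145850994639660159478097109694,
    46406039786358446396848475612978053406529,
    896258540873932482188879468902643092679599045,
    377798362856054649195385778530625825158242965101755,
    13792483983285036774740511061880140784506721319856890050,
    62798901245186691795896154941955073660718915775,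
    6607730022630684936366440044337663801884583117160964977157184699,
    7237229884088532913574912426459068215408969346460046062973513292180305863358,
    192344267703764937242030155778987846423109433,
    205688069665174870046387118352800670010744161001931469726179137,
    43556164566555415097335445314398816559423]),
  (19809055039423, [210380158392790990680366671320988049566403805789110593134877786535560817146592252616092481293309737570587836083867370709792562617,
    11377396361536471417013531971051464697094855,
    52310806276630343233823402138875542536822121410,
    5545339388252031859017350503895126555382422249823629386365912514072032849675250603872928162048092978431861330594565560088323513534,
    4101282941150235487407052489373380335575284557321419166968538809212345,
    1535679571533874863518349228284889994106665821245889726,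
    14104347084069654054021670511504491496197614557498373256305007806,
    2134341382895018800075061413863909723345195409277387128719657819822354912850861893,
    6800562995119207873275503291746078303144864145291827350655132610,
    3077337523938890856666466018004685796392347720894,
    57422533832097541876134865788105460746067469104755564519698548290902645950,
    93687377010128172776330372108664764756975985351,
    9505774050463969208784759082558757299557187542206,
    121446449047819063478361570884338974913617429817739376058473459743223340960964338626,
    3705347078179652298368111195406813222863760120353785704258775464584350633270713,
    46575676380753206820640299559792787000027816647,
    13110543514535173780810709092856730269867198,
    16276622894725493200975820468276277698149801083176463685885369,
    270418313781199849294971203125140972383591614,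
    11172831246695616028384230986052686947738562]),
  (19842080989118, [1491711662467274536908344586067534949233851232032222872144868538876917889314143698063744559574126496173776703,
    2625451563026747128449285747343260684170911540029923265,
    31790589751256603480973252850337067789988711382935165188835836376899778,
    37859531284867227593610741278951570706243521,
    591896784690500249353955566684252775931838,
    18056861651697611144493817425963254568660787394,
    1344997073895708317485728597598877151672232864333454876863,
    466560596716849032245168071429632853939085773434784169301158224851635522415827067041669212131057092,
    5054260616571703862013036716637443602963413124456807903971235516057735907094408814143,
    40959964965671338445932258680707762527595036219315969994203831781487331866314388772873122886967996,
    486592661239418566268844408413251750705948175228496979681087,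
    8438242364994314489971348559479395662469043604305948842805780031,
    15755984447054605858609219968257451145911134392652251371554736465534404,
    3946096213305182320130100543072354844963971138549464249444738438784118803725187833665,
    3671074980704858980953359203590167659818001719873,
    63081015415519542366910173046158602064511361724,
    110648161882141152117330061152263884658829254207,
    248466252686368284851601332992736049621201136542759037344431644504744130,
    25466363468101561081599327591072033014362938117431487,
    15395871648277924449084258480266495011147173615132100,
    3601148078201640097641551756695455127163995929108031,
    18414085439296030966934719831082601582099929447875501508,
    782154581619519023647817476111653849250768428997,
    286688420891119838019825773032902047357884566107434069242218240751193526777244172258913608422575326699707,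
    55961719063300057809312636115666679084755693893453800001,
    742893819769898584980976873038152443545460400828,
    189738741747572583672313534524174677899664959,
    236764157459891465036719534408508635246419313091137,
    33497444219044265665271078734155235061751359,
    11418025821057867750711645482538364282824794047,
    713667795969197981867994609287104364559753150,
    713800793195193899970296015287899993804988993,
    11309537281478818442311735786800669372,
    5887396732413081374345620350353763249566014916]),
  (19740880806078, [57278673251664901085527573222647319624645411747147975531717,
    6278825792916095866707683703387141335907991467615446982969,
    200867255539042802781310840865597751523565534756376381645506,
    736638220842631642416083343808494770233971612869,
    90605636093079030831255827129437846393217730,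
    725014458314673846605198026315996277712657605,
    57268490618236897072799074411140223738351492293,
    11972638539992854809445498954615075343930123145485509,
    50216814260897506757467766806700267679538327663473958412601,
    217877271605567653236851683083368963104190,
    91343853025710216955749159535825776717862051013,
    5784801063021307529919273750521470639550,
    23384026371529653373397138084938110670197845221689,
    5851715540094446893443579894712832795725752411067,
    1393796741897155468399481132708859508401083,
    374144419330935719920801078987213900494023762617275]),
  (19774963736510, [794002897627311054333058182916717082422422748903413735803615147407574180012223,
    1019462637643701015843965859867191242998718399,
    3203357276621380593941323332761631734851831310924255553257824109964491224769802753534844735,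
    1252715689140770508538430577822951063190693207871,
    4753690486473516728967958766242604483190473280708546,
    111216673508774465107742177079811388580108424373242666945,
    1440118852594593854071326858337390370512830,
    731464486067948401779601045579405976651934195906]),
  (15411004333887, [302358393899395377048026845045423713722943439419465662,
    2993212465509144116335787054820898914940042047627455,
    723215085274522863523209675680521379774,
    23384051286664276962012568573597286384943991086911,
    45683079261460295182515882228821881859259490625,
    43598679094756574378817487019272158863294]),
  (15478134169535, [3885456355565206616490518335119643492547053194273734692958808810176618241531204198203,
    1914187975204383368653125396622110228345554145530073567652656196750270664891586,
    1658360846412146081988853592266150755037200128218027333077933511,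
    948626691076713775357131326090928773074832325145990602594070295936813200713948615,
    13177092879219674817742462617956017863090676871461719030272974018,
    26959959522655188611745194061208682134367457455295433959615711077310,
    784733503786510425046502419920698739568919780070396091586,
    45850381810745260905703095505952285102015864002,
    95786817313520985853839389837859768421908166827023815,
    1431454268664632159262718622197542071923827646,
    47139139648300539100927592342662639080768973954875,
    33626035646253340481275067126279135955082434,
    726168026338630565859614892909734064351536062,
    8215315351274634248832679380434558213314,
    87231255491497930627471105735846192062,
    178580271397848044780168111110144229309914567,
    2787593981415288665091056077761744385008574,
    5711778406509943162058526432020091362954157511]),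
  (15342305796415, [766295315655159197177790768031166600846139701909758145,
    14332735851602878675063218794971001386950594,
    45673366922891331311568225879746193178007461826,
    2934432453535020409834535886936341297651721953218,
    365375758462455954235160439564687410204316262338,
    713623888899656328714130873041089560952414401,
    2787593161038394166617934657124528185925441,
    11417984263907610659683705808375804593601224897]),
  (15445087248320, [116102116019782740590438520255205251908263528556968203745484863,
    10201287604876549998036271988320559104577709970960939999297,
    25613734998859717650461581836097941924732993,
    11975544416294863030668195255716043554207845925773369]),
  (15512221278142, [3451821806776956689998658917002822842910421744373087855308995296223039,
    12236710158863128742163713280388324244648353986,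
    66660639137734716433979631565565613525822047989741945922165661634,
    123049593881981853814467905025574451815620545,
    827918612195024539026221428243548097188192450,
    44237373148962345586511541518911184854974]),
  (15580408078270, [49821141006986779886506411611616273134247184637243711297,
    23389735188788371597929886999366995177340392169410]),
  (10842497114046, [13133968715864600846230965114307192141509375988620844863,
    1107655713988928973500469443922540224665772597439,
    3446024464019781455061307267427882524606]),
  (19911062593727, [88844933654562662512363130575244232244923001933360554219179150968082891580004768142008650696930906935997404715969237626561607245759,
    7849781320243982633621244113424580974017761095146136558253780127853886590645171150784,
    126011810455089427704366690715681492749508800,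
    52549316219189934139921417119842924748992,
    194798085019478434266476971933481267059315020575825856,
    766466932470420972747797326139380211903,
    15177332304695434715456680569650177112303920621285428312171596699036244703466905536,
    12861781455807308907408444515073489535481012681661285416297408]),
  (19911060496575, [98271870664965305979326761389665206198033991708712116159,
    7314824100377224128908558680599670614270173120,
    6154331151849937156668790047368287454135770535299145664,
    7136614140580788934502241854985417298589769664,
    190950178781772892865608854711091117194993856,
    22306189800478082735489414659544549686255553,
    5449835615349981965495564618166764036032,
    22322523354084929491846834816533155034554560,
    43200585360510974490929263587428934593]),
  (15512743452863, [70255668559051973581448686360468327452894852816831,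
    1438078061814100023581042281416955085742016,
    6148355557483001399354444521048891328,
    5534989290921108917946584843531790065855,
    43641214389403752692556649592798080655552,
    348449809176567542266777828768523458978751]),
  (15512475017407, [274242414789004775865794187072279708895802737619768766661578840674194111286620095805067837471465407,
    223382532326192228372055224197485605385223319694517536543960005107648,
    6601194862665104965483066148216430319390154944,
    12855516614036249134236889649278930106770086280924840621662144,
    11418025140337365632144606324923508063353199808,
    2923719686101309666324865191744786180007082746048,
    382818538929484338279886493001184173248]),
  (15512204484799, [4941347118221492389390464671935112389915515054255050786688080196530812503422026129343,
    116129528533772217200714851986438818965062628307391044912177088,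
    2857176405900838831025517541425102708928,
    2993155353427913749380180459767327105546860824141505,
    43609312963756308361546858846126013965248,
    12259965057680717125469249389934130045535023511825702848,
    2923716898550695145869537244099635277612243116224,
    723765522631184861917062876928828005568]),
  (15511663419583, [273812279786771378448394177694517897396469607136319876127515688837055,
    12451599352649883726190026693486531537048408915755163584,
    45850332128179995387310536303961722712254177472]),
  (11113346375871, [9877472719827866398915328373971992712695323320256,
    13176942191997568410835762823862050830202523372966123177430228927]),
  (11112534778047, [13984279446639973480390261396501398899269328349137215423,
    236866208492822796930343461262737276836493980098496]),
  (11111723180223, [46768246138188825164570942506072522248631111131071,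
    23738140629277948919931121706289023778054080]),
  (19740077580607, [53761682644393770049675387726075474731162170730438007447490,
    442138436815921339871650288688107033231329148257107435329,
    1028641215775841248092831837141477769009899922168382489839526207,
    5891678649714941402257307627550819747056193658689,
    6211381958661821464061766861570181664586012336063,
    7067391629106870718293146499812115379681581503924017853746902136689516865,
    43556309986942109117570999825243143381185]),
  (19876438630462, [49818127493483824362279893874979832656378011193491644223,
    724820849600557818578178738449059544017363265,
    1394148156552069351622058090171812080017090,
    2993155353275467248959359510680672437959874646597953]),
  (19773904674624, [85692018025180107722489497194474637577952819393744920993343,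
    3422889946889810044622930816707246017184369415904831,
    209533346956424748787063176089133169168092110556093440945283772,
    781404005023459124531692346168791621124193677814456897,
    11596633205330793411353593147155066437447540287,
    118784860231627747744202428110273206539016103018015186995379199428,
    248508095000196698538689042458225593638463,
    15012647781252969475463822305344860694840792639954495,
    784733687890031871764481060442268270812283332901951496892,
    1402316522191867393935089177703082875609665,
    51403398034272774684368036343885871066360405567,
    201532232645977716862294348609520191660732,
    25711401027002306789886588880520741347503273793993042274804412,
    1569041994711787016564353691073436206521796,
    5731335412448692165056933985774193963334458943]),
  (19841814650814, [2446710330349621607182439797369305688953610559,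
    7098722238464382149937153734188951554279179526081,
    40674843282608168984081612992671520551036799954181951,
    155072640151469723206761537979724188076563472321,
    98079948821054269297375141135203979364877540706470567873]),
  (19807727542079, [994977522169224124001913962175054344744011543901116259557272383816699211582251199,
    1338968952285055081827401412173853518090941794203829070112857497791,
    423451323110954474252982926531214359421263012161,
    227023616799385800093254411868861948223809,
    25484136785421376613657691553069167610421182,
    401251418262274636812758875026221649878974,
    1897137703254557452929553020752045250420107150246468284729322029702515216945766719,
    3151577126615854067555607916821425076706281919123809132351,
    1108469908290310391573403836432398565591181451071]),
  (19740079677759, [393948654937057178255054845869359057993791654881230053314,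
    1516799122644804352969046591631903076893368255,
    27562893322878773848638752225719043038655,
    348450577641895713134039316935370496565057,
    95780971393321034546523594471480301978169269331927231,
    5449835611332520418186231681866062045889,
    5731291516106439018286289848991858682886167999,
    345683189023881606207777001725110590911,
    7136243908048662219526605768557685877865700923,
    392318858461667547739821072601151305880819625530011672123,
    6277101735386680764176072948906103136462259170421901451204]),
  (19773906771776, [7618194605342571781197455719164036420490113790929022645631895132600483278421468091,
    15177100720530766102420413768108810361365484230673725208118502929130708640721919422,
    49708207912984825506045815733097550973686288196539,
    1632844881380251141292119843271130692608455295744371332259013,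
    3183150577306431564028068480193901688816550747872453,
    883639211962529517065732637300183740411083086728732004239589647676694841,
    215679576601298787006180729284715132118312515427936800260702352825790,
    1028446625439835974710125893179927751178514315623561019255661499,
    111503726668649466090108603358459866110731195,
    892247589321790659383931534709596680967199941,
    781216470202487579570023516062120979162851632795917509,
    778220392024367870398173895350027904410855593596722373,
    776422788388352291869537259722403012178898623685,
    178406004789147231354664991074781130575175102,
    21820607735672296999187598867913564464059,
    1427596141850681890423842124690032282383245625]),
  (10912583917758, [200709477158605573086920786881948098107547839]),
  (15375864454976, [27608249163587567223484235000728210811367847056216040523819362852790210]),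
  (15308218687807, [27372528212570897799761611431259398981898183941026617781887169,
    200868021812674850018895688324779302470686048713209466085185,
    220557504128174501131419956582496234102722,
    181237153583504744730541887968504611878199234]),
  (15411541204927, [3708965399853922371123027850732797208395273765813611792277189797144007883710015,
    822978407791319189252251518831529683930008067397350868263132612,
    13038190582107476029197365155789863530330036491797914300,
    695671295958295500645920645796048702762149863987042305790481462404818989474492,
    603442352944682100022324138214776107870256941665372433539772,
    3181009906468285160639926031017182721524182700450369,
    6759732731675804788035547083662390521025763999712794057407154118084,
    46820169415829651749060626132538814111540917034555,
    189608058686863532611997386598313349058846908,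
    177304394072085275584703779455769263562303,
    6601194819288663322700594547802637317520252356,
    561216807337041587118451971375964573590969589521983,
    192963888249848586538850106877717723701333604720068,
    6740192354858091347192635887100704766444201510075227797846636814913,
    766247772038598094108360217467760949616536664734195140,
    2923739199339093548261447533583823733227684716095,
    220546839109560138057625200390676514168383,
    2787593316805633929492328385573728119939772,
    758695684234797601443748157420822079,
    174229889611389424805428296837402295557572]),
  (15479715422144, [12543397337202926273161521455913787943477630441873473,
    3213876280266996286408581331919604271263497500850163104604223,
    3157862901158371907551976776770745363619776,
    1532495540865889539588894521254716627627111479063470145,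
    680648681927095278534556974787759038527]),
  (11081656328128, [366282950657152309557433253121148363029324226625,
    2968887109642001842769228443956031134896328007743,
    178405973718487866721459107241845280046309433,
    45671931653644917010260885340785598857221365823,
    340283245874181451246017727950576672839,
    181193554739099329471501628991168959915089985]),
  (15514081451968, [798442524305051308526613410783808688002220548375530430527,
    181591138297190759640841182377332629025349568,
    13982245657526738899479645945833785624879169,
    42702125462262106888714304732210945984,
    1994518702909421659127095275140702144,
    713623888889269778818204927909737462901006407]),
  (19705719939391, [16539599533341070794162604486637735047830886213984447,
    279834754585812430486850039995536598996904800234553899769665,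
    3439906935984645924536586440748250267764983923554631661166527,
    378499967174638437748378043182784540123411226559,
    46971854794793429079652278511749877964735,
    65820233343339699010688484992035156137544122154610227793336770495,
    49039857411184075424022235630555046610365073480200789951,
    54509449045347623797790152250125950911,
    680586338874828472089714336774591913919,
    22300745947256292060026228424493856852009279]),
  (15443239657407, [1867922037399430775656371932111177416972380987263194680941124805,
    1189983024309319101432035653554671629152392289164425469125,
    1667368286006366865550467779460995560262115781890149496890299,
    3031666683527493929015644236308025481381373140414,
    3669922754529159408449543012343691514821648925205013456656709945631675,
    24158627963845392381472051437425509681997288666194626,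
    16320513743612468946350135811218232434182066047472757938183614,
    2968866390858976453262256499145905906525689470398,
    220855883135864555218124739635081122811384752888933213896859638889013561,
    45939709718554756726112563473810487720568544702,
    290111475700587927104935543685304008964169150,
    189995235327987981523724922321479820371743489286850,
    181194242116083551735446047690767299612106174,
    33475618129205352776176061441753216302833086,
    6130169235673134129300946680619313675067898653987429822,
    187072209578398120206135269685241349622460096422843,
    85081653436603338254240507000467266757,
    43556310077509413312169628415097446572987]),
  (15546576822334, [3990908915275224008087842170615292878275981562816903585217,
    205691215115619336929142429893788817651026464708758133911150524,
    205688070745913678959130907656555828840851763693290416514342337,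
    766434843381409194868283150491692147203134999080459845,
    59421395959313786127927910989839801793,
    192521555564701067918017016877918134081626815,
    786170399548096376413386439791370602014884177359961793215,
    716629571799500266735834338970343082141146693,
    2964584676734875848631258396180908279324479,
    27660905280496556429515429691822330318335922117657934422533777256422849,
    3555102743960856490094918525809863516603046570302913,
    22171700333462803891464747872239024594501,
    51733575275784326221148420737624242676283,
    11975544683898371528949918913031274338255487378743228,
    187163564755291244074891073343773623805625775414853,
    1427250416959732834851661017144375115819016763,
    22203508431924583772741070061347487686081,
    766247782029337376934207902297812459538429890817760705,
    742168802971894366867037621948005342139949063617,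
    22303478092288394323829970520272971817360833,
    174224583076336554650302804958326723436101]),
  (15615281602751, [287719981368242107011888607984639140074690292424384447,
    223353597502793126835251276746623042986175,
    3659464652119893516632418065133715602436573372353,
    189730602791050592241227491218262034905849792]),
  (19911595254079, [47439763774152801454708170412887733460801,
    13792484086056801119281535445747873482490961958974496961,
    179847186379411520199399528785840419111952322,
    12721159299176625379678147316306532186972479,
    1530433258879372162662617692255298979764412351,
    22693772672935034383649299205417822210514753,
    33494716560131007333855021198631384583790786,
    1397200074411486001572819689857334438305727,
    5785559151073623402690451838601840861119,
    4181390390172763723896354437547315703046078]),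
  (15273315787071, [19573682642821178237152138848381822707409379137,
    1550784745890873515563256960061462663524462602693061220167849658814041153474,
    33516027983458801749037983970875506710454521386010869451870622276624319,
    18358729118361513318880693079550203975401558144478593248419649,
    4078666120613500480949745074576645661022370127810,
    57193275762970698224657921972799320913555267519,
    2840391519764621344047299619035971073367873,
    2993202478041666943957667052538774686259554190122817,
    3457333227687356877340570036197965930689,
    11420987639942614197873199566416635389388250945,
    2834594652583797415319793041483560685428545,
    742191100995000113754946220891057457808542785855]),
  (15546039951422, [6417349238014757239426155923663406106308633656009202885,
    793563607299054954324838496215671766720218604726508990,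
    12019526662561080509150239429774628595346100290886853,
    2923181854858766998776384646742559630950942090171,
    52656346701549278571897710041340737009845373468162974448293633470,
    178450591748500545522897063472268227833355710,
    3138550867693362688118412329708578172836799320902108947387,
    365553820792022812930703497884321362072495496389,
    181201764051242797950268090978288055182402491,
    179805209328234845597731845082540513789337022,
    47852961911086005209174002726383625147,
    174226068157549373659224619268051368533438]),
  (15547631657279, [1534065970762188279871340110778884115186979825706360641,
    89205831334978975694838904491424864753672511,
    3450676760443290257604057997472322051905,
    2764795102644955204129352903600370606274]),
  (11150925258688, [3483549242830541585811284616178262050422989013811932271865800679487,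
    52615040395163351770883418938087984386081217830977,
    2729736721418921212089625996264775638976,
    42702126383345714738183595936451682240,
    85154385746613678671822613883210719168,
    742168844443807877837445803006008170842275340351,
    178405972223110178901853297607901123642941497]),
  (11320316403903, [3385021427859334940173098373581531502592425363321268229109361680319,
    50474093599638379840127527793274699325227280654272,
    50216921639609166561714618707622984093014524463359103983808,
    11150373264748820087818238639045954740576448]),
  (11320314306751, [29231459999760620870497244304442520725250733252543,
    5338357032223978718569247323045519296]),
  (11319775338687, [47545381502307160573610970433239243436646823124928,
    1632451221585999847128214627255949175094159507886834078195647]),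
  (11319504806079, [205714067111629169332506554889758527117522270172058356393451455,
    376807527565036195048206377620531122648204206016,
    2787593150690185812713797276951550553612480]),
  (11318963740863, [98081217047229033178057304970270466983830157221277212607,
    178928635969488565866925167242082231715389376]),
  (15238958145855, [597341385675083216552665902658254089002943,
    4175718963802576353173709793305658399284198924097,
    8155701101173490629146052141267887019602730946,
    53986783999072184421290141301157010042202018172367913699276544254145,
    442027563483437410704915680986806329476391872864811895192751677631,
    3787895672512244927498523517188096155457,
    2834979578362188343832311502233308547293121,
    1461854409547979817859399780054491764645697,
    2777433147714438410608790449984191324094,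
    5487064428886846570075205202543356452799]),
  (11150111563584, [2856373388761889574729512034822792827396286]),
  (10807099253055, [95781702857769034629552506556162817296049775431360705,
    11972679216590208388283049501762670411964028768215359,
    2993201025188065163414109044781270342541721163767999,
    351213938834078152757572821706030558764865]),
  (15204600504639, [4175718963802576348113013297446916239517520208065]),
  (11218300428607, [1246076659956566124717993666549594045081394847937,
    89249939761793389591323876807692333251338175,
    502391583293788783050904507684422022254826659775,
    735074327422004455751542961057634967490,
    2722270198350310450476655488527953289025])]

set_option maxRecDepth 100000 in
/-- Five-cycles for the values `t ≡ 10` modulo `24` missed by the families. -/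
def certs₁₀ : List (List ℕ) := [
  [2734234290831081467107818747353802818581, 2625190900634279753857362055769022737396,
   2736892744927991323462176859128332288975, 2659831276806465762436466591676548135944,
   2747426630501218430564058593823257832416, 2840549149947133492960872227607437921229,
   2859216764087421806574167017470243752923, 2625190847411515943787501254085041103871,
   2798099530763026501904052635249198242744, 2819229579038887949146239655040014773324,
   2604060825766843361666794760277426314300, 2779482539621836138518761223214357015645,
   2566829453529075480261147772941808569304, 2683661289623691614952575007817287740459,
   2787515048828714841252264762041352150052, 2540050210341353485278848540127271183325,
   2691808026875982749804139226320498326444, 2635988254059278203828414283166405946336,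
   2747396753880530986847764741593923341312, 2747499268158468457998051759576510909553,
   2816572402103033187386078133338287318007, 2564051534799519976160544632496405545999,
   3018642400078893706656807556916999035847, 2518903219343916391389579887496084167773,
   3010628061318782964258995384701064985587, 2859111589025415107031485077419752045500,
   2521534411904072466737615354995477965836, 2383341499529208318706594324792125228115,
   2468365297162174495036164553878525627508, 2859310222899608416628851748991829740415,
   2755561600719943635960925114997905046536, 2970883577523721755233053843219573136429,
   2851047978027440164042171521319114480715, 2460358769698159590575504407819454569516,
   2364701115120204721178549483817501142055, 2606784168371331336929889300797165044619,
   2736694141492279177817743200244939553876, 2412580555287314163992509508617473645568,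
   2532025470548581380736734032092905774116, 2372772556476980354347051725624356924368,
   2938861361222785194854526240910360124399, 2330211314309048485814120076545561062457,
   2946848408060623731178462341146396118056, 2699801526679918686655631469709820353692,
   2394014201055668702897889527604719887201, 2532053993926277053102684525773816261504,
   2588210030770531142998788699828674415611, 3172836715814592165975123266657365179260,
   2755610914889579117044873978523064411187, 2332708849057476465057006099309715757960,
   2960378293901481181173806690211733756760, 2348637442313834633051868798331052631025,
   2436476953124436719996103155462013147988, 2276886431944195940826642186588217240468,
   2691800173771203179522171991107794304144, 2252996669665008332330605505844547914851,
   2550987733003747848620037860829662342285, 2955031482526020410517462792001711410119,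
   2582842436175027999015026107254946669515, 2625003932340104068188315169306083158861,
   3050754159977274210499480318104869522365, 3178274341694190684883546143549787679624,
   2263718724579687189628436630783356345284, 2851146559416020400890446176285814914144],
  [3034576151382978262181510372325127447567, 2556199443307270313739007828423210075307,
   2678320956539530312929787007893877531789, 2319406091335456945120215663496227023689,
   3034534618070013392793290997062946884536, 3210018780211725795913783698461854538704,
   3202101757133450020291489350025456919519, 2890905301062604032936634024583888084085,
   2651996041951017689184866114449081934995, 2997565622934747811293275106310705519628,
   2827517814539816100655432885439670615212, 2662658438699922821669523565896978447192,
   3034831931010270123698558687700649245561, 2255657662782536234101331333427199110327,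
   3173011976786987664428939860922437723133, 2691480866518983455064080738064359521180,
   2986848539672120053121270222052554269585, 2415196126584828929995645387938448911532,
   2691956031360511991985671382453423014909, 2502707160668069273661756649000535139337,
   2181239151780689869031780632528005782385, 2947144470475932143879887025789862796267,
   2819507489859366731463155230038816811968, 3106316820280077365234854237655831219113,
   2619648075516023225753890206237752974264, 3289829571467429270742743461493450218468,
   2957497768358274606746283042775236689092, 2330078815708702940387279528139274650813,
   2555887929552314241463737782106631545749, 2380419538261711327675611265320389843972,
   2489664029125671723075720419989709134868, 2149309110846740645967365492002823220020,
   2922900192577043538533634077157163123793, 2715675614754107409545640300931365248108,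
   2242474403901464580173030686697482855241, 2444688529344402433386556592278315199461,
   2401833744970635315042393012783284624363, 2627701479435243389397396337947574475600,
   2747275985461469599609786415014442400943, 2587733709171820894863689534194422533224,
   2723615927181024703998024143020955905027, 2832305168035519572618986020527887473568,
   2880659778118816664987946614471794690985, 3074573685599120222644942007631336889368,
   2301018837083558939832662542257198255032, 3252465780440854124400404408376460600443,
   3138506606618428470120405032582720252743, 2353895887104480382158970649859116543072,
   2604086668065646637782861929140982228035, 3002581191497766958777477364135703133396,
   3247129410604361757691388952370342865992, 2752987466287517008952549191888934784096,
   2917811745389324719311844499249344281403, 2850902587271925093060908107083777756265,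
   2986491705443908689429949916622732258240, 3353600013292971234897558475149544713009,
   2638669960713834932025005300068678822957, 2765940952791247894431204150230835356881,
   3361624704863917392230482363438971634459, 2837586996002537986426042926709606837093,
   3348419407416374300510137631705173080980, 2311570848801087511701838857160663587712,
   3146056205579127857672494699780459561831, 2290042468536129931657750302616254254108],
  [2178745463766918728667094386165331602452, 2670719485263600311063591329638570466529,
   2404728444757406037083464009919084831933, 2340507608591821746168080331976040668280,
   2189036658143961929117977498835545877360, 2391032513234250634917722988902842000259,
   3082412736705197365977579338736187948260, 2309135796524378106136511423515656749825,
   2428801379352295909770530121843138571228, 2042957886538275367154930745901207075611,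
   2327759259677700576464382525439234251560, 2284678758774759718792968127346663848820,
   2051092906280240418378832461569684565243, 2673401422660602354093476439790628823803,
   3103915585168276826154084109864916970268, 2205387142685052804757246604492176188557,
   2077533318521623274831679670079234702501, 2149161130315757560575572433214951107620,
   2205372849328806503814693636789621484536, 3082600958125208755721224389816867171449,
   3072002189122743663370018506692626439132, 2720696575959752952289344810503727189208,
   3321673821518806367055038526115156722533, 2508378645335905332857617286160378313492,
   2896372706080085583286369630436064330929, 2141599809991241356879757464799167519543,
   2396358475511392936107794180648201800596, 2436806551033326314985464965653370176563,
   2252761730172129400906515308520161919839, 2779073639230379973890187415744971201683,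
   2348485691216172955020610675749273774951, 2999737190778371219893193595580044950632,
   2810959557065033875090870647339576609567, 2574493167648723833610698260382413521881,
   2915162345476863171919182221427104730220, 3225900580698150330398788285935428954996,
   2181106622737515578018716212401658301308, 2566805935993459563005162587116348664792,
   3194062692269031765228530878325790663907, 1965878227713600116799746482232637631457,
   3337769929147390438222371689709638040345, 2627514431231481748981477399450510459989,
   2967812399193362224882754925907719152409, 2372341589482750896682870528308057709369,
   2859540022050775132982541775312824941383, 2989508232893128928299136876990095123547,
   3247152654243254516570586758099856059429, 2380950365075040869488939638216236409745,
   3002996578991801666699990340810980424956, 2723211045798734797090772994185490570312,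
   2795121646555773074614861881360091227097, 3289602332957127586640283422743274732412,
   2019070631780910552065178288287566349207, 2651466427547316903746010991465062640500,
   1989848398328380058379972394452353612920, 3393380754483124851907036514083292081155,
   3191621018403980464568998322276401466579, 2173070261736574568524516163154282800135,
   3074155823450505012683275874599685999823, 2595732254170396553561821609139340420375,
   2603574087798039018867169329819765263348, 2667723402572439411156651527420688131303,
   2316770893507827435588244703551079054456, 3008355044595017631994212610405615240229],
  [2364676311653939586889133893982187302128, 3449514785417075918841935620691189582913,
   2986485067543835939375291490986251861073, 3465459027979520403470842063140243565633,
   2572451445281495947909096368676670446864, 2380454424650306467087557122226320276669,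
   3258140851828859574065747208999333462971, 3422564087418169449528536928517083265976,
   2755234409921727195595766538468859554828, 2519109512309448659756041186471020084344,
   2308927920873250489745321147875083289687, 2117729505523328982347214850896688557209,
   3170556009530066150747678221691801912623, 1982066487737033005372327016676555094935,
   2340473786362220497112422207800152439988, 2460744269199192767592370033911046251241,
   2000671756428490361388531506725710515164, 3502660542473882308287211053944267152159,
   3391048099910326477086817641284036053704, 2652040429915577250316324130103904254892,
   2978422784306538121325418066609409656049, 2106612743469956109216054161960910177143,
   2085316705240432066563972517394393891735, 3425178437504152614229327592799692817459,
   2891138840426771016200495505413480522723, 3433582111047175418759375621487117001855,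
   2191784527920789252791116078761440886003, 2540227841730599754428806958273162945767,
   1859641232800482528323082864461089000436, 2755912130210165637089611903730466847513,
   2842794859571796538432437557694667742148, 3310920536794939240815407244792842019899,
   1989936626900559423465526794267354580235, 1934023392646318556305339550621646249247,
   3209747398422240566748703993918260046748, 2859254237656752793623848731302917332223,
   2564461691966543145566469584285350521967, 3361512966553319072200868056300796157247,
   2353689651122788812994344926856994118480, 3520927009274018274753231185424985553740,
   2120197033091635486513607661321855712415, 3053264415530143858918365932895452142868,
   2859163364921802703440341162784301067309, 3520945126620330955066021809514822566579,
   2556401890983504534847136627743869009220, 3241743561941941150731189789525928666301,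
   2797904652413003317826999610509665021015, 2599015114228594447232668711414924960783,
   3106534797852188709025985787699320718059, 3406815752184668649515924468950803940187,
   2862213947670001174071933902596512308308, 3358636597064804869785176989395459718183,
   2478586438672624534975878823714190838499, 2285266677993694580885653279727353817911,
   3624687269120049255269797249582860172465, 3553217856545379363217127646350098553883,
   3513269560360024053799743776962410712012, 2444130164766615627115729568998040845201,
   3130477775535332976850536953825393493067, 2308471121818545197950527899953732797295,
   2077733140718223388712513983689625422713, 3513185171111225759517960841990147562796,
   3156796228244543145709378314956938349769, 3098851667759325117714508291681400019857],
  [2221476732610156320776985320995625380619, 3242375862864980283091214867045713308373,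
   3606059852829952195172433393642264235215, 3050874704145676111748961373787604486885,
   3497375943508654803754202263895828405503, 2890853266620882600028443848498705112232,
   2290353747874432841178202044073920646153, 2138428747917578462765606806030178124647,
   2853856822380523977654239765951763008707, 1830416479185281548435857537800809704319,
   3273940937692058700689671555342814260467, 3613988526177418302658806460464729548025,
   3297593184618545743908864092514348164433, 2415601342539000748665234422074885719199,
   1806556443966299052694611753989021629399, 2018770824147691002549131457578040462548,
   1926258314719337896684462593633483951424, 3290151358097550296230283578710479744240,
   2406839119081668936807472270271637363595, 3201774562601845070946192952358167133076,
   3135322230181487380801004576970872458580, 3481564222563302557918362817129883280537,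
   3066659228259841822931149940688168697067, 2641441284438496425772108817798132968697,
   2864054615133041365159101123657890077571, 2295733370447107787454366615894507842224,
   1918358283718695570813981505724344173479, 3656644471325939229212106242341331446651,
   2532199216061669094212946577221564540219, 2776450100828713352771120616918552350008,
   3002980918423934256755218745560594728239, 3167784801001539041712119228153865407141,
   3329704902833902001162444281566935575612, 2667319783395312949983406134458211845365,
   2532521205641534490372114374986144195965, 2710327445045846706407039849101238095167,
   2699304608317438283424656844439827290923, 1917983327343219404737947491464966155168,
   1726776861148909562140654135933485464453, 3095823050237955600338380402002029683673,
   2266688621492585731389429997190623603436, 3306154038573313115855860547015123827508,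
   2380808732377787432832626583031705763161, 2223756034942256106053686525697395039604,
   2787831682687582565685733672337415234935, 1721413266595438223161470343478889519984,
   2024068369669889100056438528095373912905, 2869523304732976979676591853637956625787,
   3361847849400260929687485708631759428488, 3744351513825739507712295838264326249461,
   2843203508903456057282741110727142941937, 1819491742199145791985983957271153419081,
   3449039756155074452664877968030759144448, 2731144758249517668722658123641410886819,
   3768404828407675528681273648627751566448, 3763010019300057941134012666435250576489,
   3433431425445399414965040778667918697739, 2436053564037842075473817113451254867067,
   3688779623141551400954104671910933824481, 3401100496933025915342897611866730093493,
   2638591962211670154852863368816360049556, 2842710527166705951388238803372163427620,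
   2947022191623402209825165600747487341824, 2700150695372260479608097009076927073139],
  [3002232173754168195044703400181719245737, 3497525246855451764137646446414126963540,
   3268926528284448863141065827870130752416, 2947089700343411221547296136749670720825,
   1862398214947419411589854005578621666397, 2093909787165074877762113173445705698339,
   3443979571382633591893754057911786962136, 2394271094139185728059036697753942279269,
   3688845852325214226002551208556126055561, 2085846091341956286478608707061061903589,
   3361437626236445377302768419219171280277, 3114554259189311532683967929584145130881,
   2269466688400783062150252355224826719316, 2276922535952899620042206210645551719515,
   2818759719150743104981912972618371834989, 2519089963330176239773885614718550506784,
   3776491865639151858881590161623947690727, 1978960075830332682720482405777334308137,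
   2883559456023903848613884158848559946396, 2901568815452905853139102321593185717269,
   3662175530638395996837054375858720359391, 2428602494431287746489423801947587869932,
   3457079764873267797533607988587032634613, 2053235973701567946191618707657046164507,
   2700207885473660913800045422422160958083, 1925767610965360024650867600098168966240,
   3550680260892418324749093721675367877295, 2795273400059059883049062259612269120693,
   3656952112919515225422453548645131377940, 2891612854765824403396520162621447120019,
   3489427766616106108588727211630244037663, 2106589283106081534736465815938442830513,
   1766821104456736815889219369177732954891, 2875089384942679789387247570762197451467,
   2476554661062698658225769499949073890684, 2380532210157959448903850905526217974487,
   3425845619672109302172629268777215282497, 2563955279417363628443719706173322517519,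
   2531833601585655294470443838916018391687, 3098124554722690115192316873443574574460,
   1917702741815496481501765823863875145087, 2237565079620475924251727128159066574072,
   3704586193680716207642389996160823976861, 2093518938220641153835959697917395381428,
   2180771833635969258302847608175287065396, 2872123336024423175228057724292064226572,
   3736315052799139980551526767343408342245, 3627319609549333289947583915494412665469,
   1641515361922260278850794027098520292649, 2125332138696342774286883815295820244139,
   2987325028507819576083576020502865792147, 3561293091321527431316355569279343082283,
   3338134881236995895827722229943705639897, 3736268333623294799941313109146720041549,
   2891164730831986482329541911709336822473, 2681618146839044147433007886940625183391,
   3616776627942024463791753290549549671481, 2167473025235736663270201173009087415341,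
   3330149147295268147611539787412169022371, 1755782179877261845892588904069638577287,
   3180348591374276749212426465237956788891, 2146871085842845439122020601581629341032,
   3159049911415074266216688083549735295688, 2763952283360666998811470015890135811423],
  [3582254329051153681511170615757198568575, 3704562810585054173819136994099572097611,
   1806077445011541360922067975136720124780, 2787956357228278647330596224272528983195,
   3874680717442669937976795027261513345901, 1968925965908431541348869809911645895560,
   2393570115171355193884022212178780486532, 3560798477474416835204616136843466452244,
   2555659370951779139768134104072716458981, 2624774034498199637350950091136835353693,
   3704372018409424397095013812664445176508, 1832861794367037725450048927546912212051,
   1917797401721687906419650982632782905953, 1798545906369515505068904782555661575549,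
   2220669310201555298236942949467352685637, 1631016507248866480378593104368793846635,
   3354106206521973416803355455868087074048, 1853945176496923481284757730024597365739,
   1989466711337022236073777342344051600387, 2827825556426974283940483319187897730373,
   2444181986327125053653100810291791825937, 3337723053945206576409884932098973358912,
   3518206066281989195030289608412034997048, 2598173901421562325155007087586056567844,
   1880464870829843380070149836081175913281, 3040334294490752833211514929634266475396,
   2180740702785516285769295496521071455460, 3927862855985389452556357651926531851675,
   2826937349020909909959773954934225715963, 3880161199494147054754471652339520969728,
   3225958848884349420928088994424829090788, 3050241174114317571855869287998499112299,
   3710136784444524808214043926719967151557, 3338195748224560754173253338047264127945,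
   2724116993794565161826793296393426766589, 3874509409688610134343538804186693307197,
   1822772066849043273948423001377379691181, 2109076428143102235106354677658775888441,
   3649124836414697710251753968626701621903, 2223818289391909758796845021115052497525,
   3129797679578628027349629325799915416897, 3895870627953458694156208204283859893476,
   3763212419998019543549088534618014303157, 1511435460663318770646775261110617705085,
   1630679132156868656372540231248405609191, 2923559686566278314667637955284572486848,
   3393396164006582857267360634252044671700, 1514038130005570903976410954999614712540,
   2561609640379313469429454439045216881904, 3512693265080716097853987173973148662424,
   3566708892578452647219957235649955636083, 3337738619440519630861703363042037623736,
   3489401755886637528398137756808807521544, 1742303221316620125021776488705627089612,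
   1511209519856532280261062229744743129947, 3912027758286376008532300228321227623099,
   3848312911310812406803229702240396315204, 2231396509346309557759840207025128324045,
   3848307909008738218178456638972921404248, 2885396118351741878343303559618358754577,
   1641834665235989787191970892267178968525, 3433815695933259569608540051971419554763,
   3401115876172227334281353719534179507420, 1809403033296544444775995995713099785261],
  [3512682870213433166976077249763763457201, 2891636083361065602108128926212322049493,
   2795512214204028097673524213018483072328, 3512663436424406716783263303651824206435,
   2778850300683669295077576299582810881189, 3024597913922491475093152792788368264591,
   1574898209020855762222470067702902465893, 2162790630081142261608775709013509203067,
   3031420494885665440670060482166046657335, 2404847723087302894143068726073528753065,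
   1833204463151204476898885284660746075287, 2755836614858915504379384700129490680564,
   2713285737219148069416136557840591961412, 1989983224498986144949235903614398225401,
   3906823646304971002234417129061130994265, 3031755246017168633210199994567275392441,
   2500160086273731149046189073516756992745, 3361344123064285972502339524590055048135,
   3170805219520012325189049912997344877084, 2349017549328004527091889040706405547251,
   1583411082930004058947475582626219942995, 3797865822705062577998140776340267076276,
   2785247153332895450205739682480429358284, 2269562601416458232109011212174300104137,
   1711107853447024369384191111977191283652, 2061546033605417669627606880825690981793,
   2124875495337097814260290638203186004501, 2657314036941331695455901971309678722135,
   1716407755501423908118576764976606002173, 1854741062723648444422978944149451482433,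
   2755808040981626696155523427195253595476, 3488841033503398353040811919072048782435,
   1976749360153014654518587260439067346331, 2436777748714379334527090469782909877652,
   3831827501763927201617570651232977169864, 2986190410172796853166555265256540072837,
   2780044590024715317715525133454777645789, 3744398069592366055061674375586204830551,
   3924981091331062939569226161494722134971, 1905115188142350660266431377054117348107,
   3613828712765552936326999639804525173492, 3108873825505143363179474186696504188249,
   1798506910992675019804350370992765381832, 1838420089807219790808365790526268891981,
   1575261887752432280302800204451043155145, 1880717833671228439528323174071817673636,
   1471228855023619256996918100045148625620, 3114946374033642013252002783209416100513,
   2109598132380458170025864518807570124280, 2906373244854568390334278307523191397244,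
   2906452573818467613075286801645608838195, 2566101194101425071522914152745846406300,
   3656270624625026506836019910683052719032, 3944083659816529482166043100344821408393,
   2460588893331609889959962806131693873904, 2468263793833027961663654111330697038884,
   1965561302475290763739781166333055993213, 2627747784276593628684644910349152570816,
   1755766530671220550761374769325747290691, 2564721329638601415260169533740364774208,
   3752129439712766887163536761020208956485, 1790022837920406062704186817508468892295,
   2890578057206249293309277563127599995569, 3837306800550533295063980663587832267347],
  [2689569991756687752678407889462089628816, 2021749661002152063247662028244194131220,
   2369605029186385138584023665629857530871, 2148766556415002209053493537329892025287,
   1386264689999512261162580002767871208017, 2269095081941823023194590084479577818483,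
   2212546108331256086788566020346026863571, 2978968350785760414883755435326699092704,
   3201569437607612876374448695363646275001, 1647213849351248119981401433610777985643,
   3478204586502745910199596335307770813545, 3265307575454671239317323967284025084676,
   2467716308325892566370547530953521097632, 3003015873258501494040745455085810961063,
   2523761726539439858624745820848403356765, 1806899109135123627278847905678237205163,
   3521604732045811431544779535586250345159, 4084605357482604610422850998939343440416,
   1684221874192938982493522010752691283021, 1699954533681113472346251668279434726085,
   3135092457687809716721467774859339193632, 3614077859509542496200030217561685280089,
   2381048841356626590386840853728707120349, 2854526879577293779831220117083812941281,
   2715996102798472577497455068668697815764, 2062127672348835886260802626407343514103,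
   1447616780391548302963135636482202397609, 2840050951805091558030146822190215103215,
   3488804671982961589793219517718179978288, 2364319250584022381154944530682848101217,
   1415632241692642447525591804248289543009, 1607025412648081011676127177891285863256,
   3364545141982764897734112580105204114387, 2107118825174470391738472034255392783569,
   1341071001055829026893344882776530504380, 2875790678340103697527484861713223662076,
   2595558191858133817901780080933219282045, 2361738651682236389269279086949245166523,
   2534172601141712454623348860290027102837, 1734288641536006888882624738995423456619,
   2826982713900396372554411091359721917692, 3752599289210904851264534872791881580021,
   2492266462465151279811304476532133381335, 3508148526434295199873830136844540447611,
   2830374631185974534270568423785302809465, 3688708045959100750548486598275685483427,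
   3393056504744444360984293512939090805741, 3384947310966968731661398082253127969357,
   3257901807139188997888587468138500013271, 3776208654879193807163023984212882263321,
   2062225104643125877044569136453264894972, 1471274171592171254294557055695832761479,
   3306252574550224751806432397184163269313, 1774011119768006515057870600231753653163,
   2584823158770177784652697043715468164363, 3289439886865327989892868277994720427375,
   1312040882655129283848400767517921665523, 2021170914040466798999054361679675286869,
   1694283501642615888137097661300788519731, 1466341493150469931945683363426437604667,
   1795993822178866440928698374008665119276, 2683139321920226429748548515932773866436,
   1471248209976293838995743628001432724199, 3991644896359057154540632961595288412959],
  [1343902176992712177577856415212526191097, 2882664184142452398485138239698462653140,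
   3986008807648008442839299324616032086515, 3297821479577891758841128430350771570087,
   1822200627818485037010950647800736283300, 3754878694094559603614464639005463817459,
   3146294665835999498759329315958799084724, 2308188203667413452103289614163668753543,
   3617308870105919113997160953365394842565, 3927613504221251103063955666461360618985,
   2053067391240323936437692255360621421163, 3667231391051596301446417529204348972020,
   2220879415725200518558985391646972313011, 3480909724634853568579604603448116890489,
   2237655848684762137611071064344474410488, 1510931771325334163586433390545986946543,
   2766182173954878568654312701129890253736, 2375973753792776781890494417932094588009,
   2142041210881371545397222585925801016653, 4127296313252259834992063299892060269916,
   1811379928003846525655053504357004127305, 2722910032124081757073750985256788495003,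
   1349124107092022797035688805626776644983, 2712576950646147943370016530277282759803,
   2913012774611752208466225140483545752591, 4084488595548092724083299194802391407385,
   1832554152822617527537317011286171229573, 2481124348690576514956747212307452197549,
   3879787222342998689698164537597884515183, 1702221174857102750171383826587585594323,
   2890370655382442608926710825190970942443, 1832476553549404526813389637361204554557,
   1840961669066062236597476011536070814629, 2768408416771209589943971756988870254055,
   3489191384066118346843014123802785096467, 3042357871663688064309805717831507911803,
   3379604277786076007217212671720233665621, 1525002801173187966770365269350103925529,
   3904017051003515382197516643703820526691, 3912323560726546451499089289033373361677,
   2084919353783502142359223085473859371715, 2287185076314937328367155303306276611447,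
   2245368883339890761318109896877477698932, 1450379050107293488280444129970261904228,
   3946840630867159828841122562540878953472, 3975560446647794790497565691640024067312,
   3640241966314902727483480073118595886043, 3561499444990689566201454525333474688144,
   1534962863173658395686429574843186563924, 2890603962674333764594932153403379858651,
   1958575308527524104438528704847994513984, 2826806206389555121186573145641163263060,
   3106243879680251843425654935614876534135, 3797421770902823819455233831156766256561,
   3933174393188158169018849921205128932124, 3816478822715450841602307006411199778303,
   1858998744816278302210072498486395378527, 3234410596026675860196391999048141819356,
   3199970138625437228069272526267409276236, 2397282917324387646365825358516083256404,
   3842985930242201397955503598239296298148, 2157995721385735355646485611330252423873,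
   2851626669281234292285213726106350758489, 3233644720924126529369962576443845771761],
  [1779774348637956205990587293856682716313, 1901805028312654837253322578606422735452,
   1811516170780948311671388569574970048013, 3959813893070669233431080297110374599200,
   3959381338578962109351161903375895735080, 2592888607109992168651524952834242657285,
   3853183167755770768038627769628156552213, 2018704400000153538766536691539659771164,
   1735129820171654654799934557885797510024, 2159875088672669448894576497928548842951,
   1630828155315585997922088495374444612280, 2659914020260914740238350215604226579485,
   1829899565581782443773902015288723491879, 3457090012663501724367270249601130323352,
   2723091378381346408971722306842092927563, 1902711228843028178937096570099046204095,
   1359603446759247647310439106157590211680, 3691356081408694973943676637804379855401,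
   3736838082121947503796304147945464095613, 1991971935568934545798875451174059432408,
   1885614269715467125254173063744355888383, 2755005823570509662195072225377455078872,
   2592826280480436206468617326974943939092, 2955081827888207805804911702195708914916,
   2532923801407134013846488987883923528660, 2289618098950201531386605215865192784641,
   1263915965114635284119303636056823254192, 3816015860635015763709415236059804330468,
   2762869610717575176472025521008384222229, 3374723286446482940074523800736311028880,
   3656789651562869049454726373151850325297, 1341008807308157818573353318989814177068,
   1375710267334948807389527472256800795408, 4118951079022684122753059263924013218741,
   3465858976723443169183102521407836249289, 2778668755560982232165311925762962951561,
   1490302588189991189095019297899944463408, 3715640915663912353500197204637462043300,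
   3959469526486938785330649810784567593768, 3593102235589175928444864694377522111665,
   1950507540007184392417213877505223130581, 3927385195159367892106091905819971459571,
   3609410091090354714639441817520878951464, 3021417299140361382206604522234582991687,
   1255914632460600391758370614977808546867, 2060989302488495823057295573642702371540,
   4255008766937290807280868505884774231105, 2184638766437921229743737571933876724175,
   2624598758262969483358895704926702274121, 1168414079456393551593287272715417139729,
   3145602985737493504113290276983034842616, 1727188206878393412882218741374299225220,
   2467687911698599495408616555374009395984, 1807013322887538497068054693321153551585,
   2734506567037143180816162180957730909765, 2348974630983934059907171105555667873276,
   4199238370595108847111755348967489509864, 3521788962202944679573081522895493279155,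
   4071434889215795449615573268261509864967, 1479058715020183251795123062408661178808,
   3895968159307564071702262034211400665761, 4087662177789570995601880573173960819411,
   1997322551692987779275855645201646373951, 4300072732310157451209417755674165504883],
  [2499620192639020714193768868134709107673, 3991885001314167698310985171026869706172,
   3337848257326325549332298665662509804192, 3893087244324188142572309054064505758879,
   1519678372177124007323918221324186197400, 2724278268054260708709762808479745163903,
   4086982070350228139102915156693723413180, 1168532307357311107040234049167328923101,
   2550636925948674070285850531840800095365, 3258248379526962570031796699064209228761,
   2788112038637337298286667839495653969124, 1168464660587130984827610791741771480205,
   2317604424660608520224672695738896622019, 4190792921513879705610146217845788304119,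
   3704752197505693687723796532262142577580, 2084981520782348295460095897457628702179,
   4002617505785629982282515250545053416919, 2407310059518657458112035530687128708249,
   2242594845345592083310942398573077941443, 2776029566535190202494529364032016745457,
   3616356006380941968808541620553873878484, 2765598101227971173766012568545683496109,
   4060476592215998127266256276226604762133, 2904242720788277017458664382155964048417,
   2842804919433079966948477827199970396944, 2375786397664633974221203207135092014077,
   4020872270012706519727508531344332290952, 2886517989166356436802914533267881274757,
   1274640563015974871488660717507180580440, 3555027330801984103621496178458329622011,
   3251873839704236728071398361524209728736, 1631212371206575146668553050078113434269,
   3925526141861250558679373966811737181452, 4215204706191205793268712141205379803740,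
   3233722552141232175800470865172286287421, 1829868385175452295514406887526473644699,
   3581767522704997030986628295602199413913, 3040673158517640790329721585093694041451,
   2811285020563696035348511382123930721613, 4254816494835070116491074427159508034909,
   1365557832953682612532761733563770806861, 4305521941536481287111722767747748864719,
   1408042389183502843698859434131332024968, 4074134862606747265430048044648534164639,
   1136682683780438916280228841964340120463, 3959291755514467978026655683658144071257,
   1327541042726691894032805044660344134076, 2444211721084782512789659610754595595831,
   1543053663469304310777298147305245031481, 4358559984317226325046043871777671709199,
   4199359068132461722811188919246222433388, 2341210881942476304510747888151050503157,
   1211227262062861775138046641110487300904, 1925609103713241342339774685969822100720,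
   1275115817937172106522823622017045136411, 3521381009580843986021521391110140304924,
   2935731492473035237315199846880404458841, 4071377743333405919421799165386936159424,
   4031864779538835586208408173026758378217, 3470661325120969710882182774190448225561,
   3042887448112469130117426626372792380149, 4219956872812632620913094342265554355555,
   1471316098877874085112742195853875790569, 1359874656220567652147914170004292738123],
  [2162342720349989646335131142229547429368, 3680901375062630519875476080551202335975,
   1338085420845839782156695472594013192631, 3273965416490942479646324726027738547493,
   1869731412831091833304468072613953551443, 3896545532650973892352155897227105753671,
   1658124185388366686763282685042850241559, 1585173837782616496436556018038253141301,
   2042723890954313417343965172831840762700, 1256176734329911490016518507637934582328,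
   2124692337086772026968493914075085865687, 3087018357194404966604849184221199264149,
   3010329164503979712939470629853114482196, 3497802915588489086603398674748844198667,
   2971298697532085882029597267741649247632, 2524702761284015581563570745482877840549,
   1279962636832748271518489337721000802961, 1147280066577571435991757043354966223864,
   1736647461643675388397335351372129707101, 1886174828599907796039731052167521209887,
   4071354370567329694829709368642614070588, 3689085798965202510355633715671862459788,
   3925487165342917790455375387505167305143, 1264258550199680218721445967520772307744,
   3712011117925090571833146485842790132568, 3129724829130712556631545805229381280983,
   2317504686344575404625406369981736786992, 1720696718116703953740826173174591318625,
   3457959836240622281178207578070572702804, 2305552877905794716097803686939315167677,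
   1971463499300120315771917156055002299179, 3306538267516157481603068601299070025256,
   3534682368146602878623416616511100443948, 1184097341045663241975111380303876996119,
   3927806787158646380261225624065226792283, 2842425021778726968184539513450876906868,
   1854960293617916711493058337510456689583, 2746734637228867314944883044361651051221,
   1710593443502578308300111502092335734207, 3353237563610639742983344070851405134800,
   2859742227331587099763185049340549937716, 3810741241898171111871470655954758444197,
   3422330175460636487785837320399524652671, 3007513683376017770208785557191815805940,
   1519350073879264579724435288255360858704, 3896511927240065054181142633257189218920,
   1386681202661634036413667700677161527804, 1886050210906667751870135628928058059828,
   2818585563158776878955319408488394599616, 2096827738163206368258750043269069716564,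
   2946627436442961739115165646458640604232, 4119307828216713490811343439934392224699,
   3624171775719256608068011796296500427157, 4438303313663863275791390074333025806772,
   3403432984089068932489506827582309034472, 2213963605285498859807343360452165544616,
   3043409552591154052915138028110849334893, 1415138975058682866103390929316417277408,
   4390382209712635563081928447466202188567, 3011056068155718699222774991930504486517,
   2084779211393254727111363914656749002108, 2577026774839079600043849524806885968251,
   3241871814458804839339703492436912311395, 3265795324391864454853651786887427431868],
  [3424674708647152538890156778617859644200, 2061413531066238118763478539580646435789,
   3161506011699623039412029411674764772577, 2417585607640975871879605247971842751760,
   2850352255668401135354980067800313080187, 1578117234768515657362097304494708087403,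
   1606418205637207279852995628584228512351, 4403674682832998506709441367367012473400,
   1971494645497643291686592691678164175431, 3840749234250291411981239938979699532221,
   2999643413923337443959121853555159236124, 1269315809049998855481757625965741343921,
   2264127323357958638840595215791086912573, 2668187945661854310965438803662063586939,
   1551826252507600566121922344188814015044, 3976138063722468011611144858198835698576,
   2746906408964154090059198885781830871905, 4151523837258030971707286328426787883732,
   1764244169812499622889831415677755792192, 4438230555663202922225266189352173751248,
   4127093680489703111881572309243921218171, 4275943918006422949850785669196347083140,
   3880608977296390385250956309955094407736, 3571355553411484109053874010387506121683,
   3765037575335478224689125115638425592235, 1901444267807558234529268583473625320112,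
   1056974496824849311971310344627551864065, 1311799166685853041169079294062274726716,
   1765886394652653402153484692417629675039, 4337396064336620231475891390729323029427,
   2372107655848090642408492624196366597424, 1679148209697834376540823136538349369960,
   2436167537493735985439328644191558019784, 4263073511876839111008150777034060251893,
   1745981806948572850429342960338217861621, 1542599567031002649889612371059623005172,
   3392861381442536051745953311555503154107, 2395753659143486562060900976021882706317,
   3052532271114586708831298092751719275508, 2194076754010890690053288152227618644923,
   4105740358335529872292241637845610032504, 3521892734523557122069483210647536362447,
   3162451732970529461935893858265216231833, 1522523728741318502867192374647004078465,
   2818518091146812841712010807206783425935, 1075295319217170675977197116984508850825,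
   2364624149170468076100281848123667465861, 3896611793483105739480360887019149659496,
   3225776994483128657532199416370497871480, 3584203038681229038219267644333054822971,
   2245675251399183703089178078822241715829, 3609337259514001477993933675237703281040,
   3497691179588408394038323544171341843807, 3839552138468593716776604291736928398420,
   4119781768115419583256777919648019557772, 2491499481215736906863710087447132851317,
   3975207379494520231591313885891248331155, 2349462831331865135683161332486589377449,
   1447517956992525702264534329137378200836, 2156515962476045317154442301023439112869,
   4350235392452621772043047260308129721284, 1948000960288562856834970285471341231332,
   3853868509101037449918494381830135104701, 2978515911018457032768562471334331039313],
  [1650066916739181106277936195802271300767, 2232537548790508175736742159936398474136,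
   1822626306114536184491653437873459534701, 3187992946584152503776410528597924897617,
   3574189211548513694002257802992196134053, 1646504224396443116071531894074432578399,
   4438028100360704969225127889966144092512, 2525071671740462819035671546400347421672,
   2648446934058786333656234978109382741163, 1320187320495424734411206474505460433641,
   3850279352946371455300438668134562417520, 2373359046463807042702947915028948089611,
   1950491859342827494336570792881083349844, 4512682909144986544260077632772423805640,
   2200718028886020474841815973990345933929, 3033830018102872250548911802523103308857,
   2658940696544494122935632584142209288632, 2627900840228086763119509993096252597899,
   3098564391008807547098366973072780663128, 2393460924629837015693935201223803112916,
   3819063165268078183727364784198335915523, 4294586819755648581104275745240350417495,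
   2820179803692637263084974246488526039876, 4063768411436333345892720632482554281336,
   3049711841415168031392659919784051072169, 2093825128998342441217434352330065978041,
   3648400151029302392202679985431222535683, 1989689713843322801376121771052793354763,
   3737102912044759539685603020936259790053, 1128230780314427554075054264241755791805,
   3002047525416885861077515766093979827251, 1694541435033330548592916546306793507552,
   3711915054053161139814546346835573866084, 4518062264321833803133363186344808678129,
   2077494033979367989476587257672598338172, 1606454265099636908425769707247643477047,
   2029186304273978235091599295694563654888, 4278977471725154634283093849432009141689,
   3433171607807264211204364709683216049249, 3976195161368382138146872958372067401145,
   2529953403572640131247536308263449435784, 1543892381701549960652579969658780388600,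
   2863692359028303828642039272934657984139, 1542747338041330455412335620906886204428,
   1958600984807163267207731465025451105964, 3361136328621735213718840854329328819461,
   1830904204197126239594695215751168228485, 2253061149818982223892459779274274958621,
   2061944428948166215373794887644306296048, 2753688426444382339144504686298042182296,
   2110295356088626155432105212954709443011, 1585344902453269018530269493643580250465,
   1775278165806632310920247981871846866052, 4319021842995461940273356683337863914031,
   4103611494399886547912280085324242519115, 1136455314668073185344254362527907215889,
   2245236365615731683322108482103771695948, 4478415037766213674356800142665514142132,
   1678073130376207023519824739974486785012, 976688555665090475713820860541554481744,
   2684443828837147353982253304287561494032, 2028894561263320029895153800797156835917,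
   2317424960645606970147572814192682706209, 3784194271067979810354289712300843008627],
  [3577648757826969533073456341802220689823, 2595199966320914271537416863305778109884,
   4076758187111390893134236370358542501179, 1343409011506095603289688731618467936751,
   1838786063010415969871177344158292608447, 3056779860917009366034573753944122591908,
   1566573530896254863625970488994395835920, 1733982656084033380704470607356861656232,
   1476099252354386282322255561139514657411, 2030223434240491374608940206252328388073,
   3205419393524253626041302101751694789311, 2404359486045845709517487248163739089773,
   1870238322914639983234643905241482273795, 4299776527949163317639274156621186926123,
   2659187120230032016293278980157756231292, 1152882778908990064598959593322202627060,
   2372286697617876148014047903893446064895, 1881640888114834162089248413533443302715,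
   3996319397776702048657471704458003153229, 1415881293519707763733591999602261265783,
   2571215494864462375112905526378612993695, 2850990467090965135772757988409434701349,
   3538920977831782549171604234330461383413, 1870471991372304054433679892689398940483,
   3975934151326133815875210059437300771777, 3879301876785924235621381553002645436747,
   1997035761657106583030945149754042043336, 2667131343860578910571087518106347949521,
   1629040885658181377713249694669388114352, 2748050656270354517907459443152503973515,
   1171116462473729238357795390234173105779, 1992777828488353385019090215702354930883,
   2057126214714598753881002818930920598012, 3066592800232686561689769851646142651308,
   2433400032170352539095326012367015377956, 2284095787179578914407423190936926111347,
   2723602640944774803441584923373397992049, 2172405715071404732675610048033185811309,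
   3932531924540462052367509000961361730065, 1550788856185748348873485947212093098456,
   2308014108384293800254545773058299760057, 2094219863007106085801546699765918114153,
   2741325548587051230669409604659804285513, 1232693325817555718422192815036446289496,
   4549714384256342354754284407372398279993, 3140094213380736795136458006384552585535,
   2724316751458657152650087401297837728379, 2231026522178386130667910106123827612588,
   3338303230362686076764676905925276108487, 3354508622313038372908239866631146379947,
   928835114081520185926390810553834211659, 2341304296531800429491185091351092790681,
   1647135747023756135973226978705257381488, 3500211958082146777281525026955070617908,
   3832921776629579777250541487774614282847, 3148042276120812518484008381018793738649,
   4119110455034660048358602815381932695143, 4517885506935419218909369714719425997812,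
   1205193949679115466487048682496956892097, 1545188060455760432298048828629494573720,
   3689335086231527960533052961308946468004, 4478365618475318057216406782000157099127,
   1040335730889473627480115463694943841060, 3295810781880549057836634768448557989495],
  [969112822726802900789198867740715637280, 2522437799209801223847371705375750028576,
   1184259988926068556505038632961195621040, 1630235053913795767665206093954494868825,
   1556027899798114556500092658099735412411, 3999814806356541869250142984887942430356,
   1104194341612591961116325765380920470440, 3656244418480815853401370822073740799108,
   3202490821742655309635542579095886621681, 3255174427687849965250386209022129815236,
   1189546499501884516039786537942069591649, 3214764200935389411680624574778192766129,
   2545347191816443366655348834496288884123, 2109666781065217915736491418299730339245,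
   2531303614514695854648576763396793036305, 4435194395547840345591508677104304187772,
   2598364450205413717105518888757048067207, 3560935832555373547555599497373550370128,
   806744634149393666711529632328762410503, 3103046760910233648291723360710643714551,
   3967957462626485202553429070780028567256, 1373120095762876943388030822486801464784,
   1401654764213236403406477857810645408041, 1839165379718904257821575041440977488276,
   3043521363511321168999705521563362436675, 1224334870950512528343885505193777481409,
   2276660135984264184355853433979618700785, 3959333108971631438476219572764502510817,
   2470439320195182175521213745784233852468, 3768599189806613792889897084567445408372,
   1231835191318449038632777407377005828960, 3179081642633966057658272534644048193837,
   2397529381701562962523079555051632339571, 2168080105835667377228907696591016963729,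
   4360866498761685233494497127630145547024, 4231264120342321647966991787063465092573,
   843939819760140340701952392251097678323, 2865109703937810742890380908725401181140,
   2083691232922775066842492698656280817277, 945475104012734068142970511846532217844,
   4650840843817377072817355750081673222835, 2205925631248253591024135810661435926209,
   2619920245387968737994462652184610270701, 4518382899454776351973562728923780008585,
   2667242912184059306886163853822912985539, 3562893548396617716997325470629950217276,
   3209210208592918493248759227387084237128, 4445901075344367853842240124994280456859,
   3800668150423880485867937870253115694077, 1215761196293930264223643812441713327788,
   4489165649018927729909127606441581366299, 3843577567006242833300167476199567483979,
   2725982010719816714807274268487317634713, 3556429114260397719617978721887321811471,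
   1631721599057305730010590384854952176036, 4231549967965988381607389719459287661133,
   2375377346400028169348486295024604347413, 1062564006839670420432594035048158620180,
   3811504555507323355556890098305004551083, 977392031107021681392155603251207996797,
   3163143887191733218894643757050886085413, 3893266234003527464399757158180625611980,
   4226114723819347464934169153613702675985, 3021869006257711834979769536404692237843],
  [4318245536202886263266255786208677340095, 1893881434631518927844491930264902329887,
   1343622670716607002102048266816572105815, 1765785100618681650534748648756112106443,
   3393816561508092288389981237978051972276, 4683011049625674955227200616080991898940,
   1167845446925378645539226578904950777555, 3552693079620686855182622835137585546831,
   3126930613821348702238274481013368617303, 4380024734122807666233713020620938295764,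
   756288483739264615781881473579783696080, 4469779112417571963394799417729939021156,
   4008183588386044609196492761706469121075, 1428297477050196413236743037362196798068,
   737778011866824652218919666573273594612, 3907364914854607681272870092936544824137,
   1032720988291504765545149196642336533189, 2519541582889704771747243430046348290448,
   2934319159121145451649496211354385386157, 3649062118033983409367539523128877433973,
   1596314295138323053262123378311977650468, 1533009096633629472888917299755053269977,
   3181587326758332221506003085115308505528, 4212725023937891396477099285972340146915,
   2138685203682670306175880660309159772883, 2556086140115735715426023886980493625043,
   1536018264191662244089361523081529738261, 1392268098878729661047538364513820452191,
   894886406489950155032810979694837172843, 1320615886466628032785496724850626190120,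
   3847849219334573708337225957923840329273, 2183376680716280736051254306988918357316,
   1392181081528511730547698001216869403627, 2662915107461061862141560031568257861279,
   4262725492376051388983821055310355479401, 3306548481964845788531974294575568823599,
   1136411114075301605687307770816364087711, 3125591637600803418918912801392896372264,
   3627763303791005279618950493965693795433, 1828140506511761271016270451530606103516,
   2556225034445487577458264020092346457700, 3584662036126866140354093093063250579172,
   2906523405660073783578343623459846767905, 2540559914317265858014595551350602385139,
   1957435191261547399932851235485777585767, 4231426420760421144748262747443780922548,
   2641203457135107918835007627593197077561, 1727494582555648195767341078695902395219,
   1216617849264828512947727656327503536501, 1975784068272968234138742593400274320039,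
   2932874404862426216417294150747334814855, 3783597727513938413486486020449685543669,
   1343642124663453377425975468400310805333, 1851914693938721805559953959993850709679,
   3009903469733503094092337241697772088128, 3284192451660437046070172034545426754124,
   2467765271034068268214142812013056132073, 1816249040547080210293373427099924208171,
   4255447619912551374937494245327210556629, 937499584299564948412708410711226776173,
   993049734417136072366540187083661656371, 4086996096459058181317186700374700920024,
   3949888495567962209112980690759150988885, 2269948158027684002649168785386612219229],
  [1843394125161510694961807545139287270157, 2210179252438680053533857544923746217617,
   3306626416054237365098109826707974159059, 3775531155021080662390986323621062307017,
   896798584068621791150845708055854532884, 4278410173197183045193592964131948799219,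
   2074329379025383265056646794842932268101, 3647852654175254145692502346931985539577,
   2605631455410902735373645158502355807844, 3466149394039376965866478726470397598693,
   2946598801333995022074332761069778860720, 3369110338845169829939217469700391685709,
   2522063676272474556720057206977846078872, 2104336474521333099019136293391517191012,
   2190153149222129970930797055764520296939, 4358911566751139857515258815418499821312,
   3544143105748690155767818731192688278081, 3736705475884812997733288120125578268209,
   2237672524879758942317313037959423024407, 2755130263397787023315793199086959642017,
   790630492938589155123366114030209304245, 929603568723854100911512960096782891821,
   2437413916946544922952499260407726308933, 1224789303577771492346463910039560233897,
   2524666295944397213214412209335158635988, 2305899229622292650739861699883608540757,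
   3726699063596305854850255439038025108561, 3064505567048774513116074193248714275972,
   1647495367108556115887059958276496825176, 3049637947784107827114435325751687111323,
   1629087521328676424772853997520766503372, 1998768859824782988292251754514139841441,
   3402211324060891948065215510290626055423, 3776577124042508161196867219708948638552,
   2220684585228062534565988521619371949436, 3468310440588751354347153890042472648148,
   4382038081787755597112831495256036936304, 2923704162487764983214428957784352080199,
   2897291696953930661126817679722305955413, 1414866409724603491137954558592909572587,
   3319538995117524707919600712240134892220, 3498942723084637366517198024262894445573,
   4263509817062886125237720499137717371337, 4438304333701721029132357337546460226043,
   745818142116192338979996926861231921708, 1194302863795066697231555974146428599401,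
   2987566181326726627402455333405621451876, 2150324122276496610185908290949208490917,
   745574103022432555503886361455431729963, 828378240159707690231332932296418905104,
   1390996050900706163076482333563969153567, 4262573612255442400398924546093857956997,
   1469112653480879210620461826054758965897, 1567876775726437633896851693624583387788,
   4358330546600419013511912114681808929099, 2181854032201644559033678912152788706355,
   4658823880570766437518223839540519701648, 1702236405319727649499892402053527250067,
   3777205731766911985625809179761383482149, 1639804543656467360534025660034639227993,
   3150618797492252086489636660293995429196, 2252118050365811531427518106179393628572,
   1933481816022753496215737787687380241328, 2083862852808475406224203291706832939708],
  [4638075595466177813456907368832724532765, 3201862489181286067379889707984069536959,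
   1179290379024808846642929882377651005960, 2043946870740638757876208362144079567968,
   1232765943088492384190808389460291242963, 3927685950565753870960387549562297370053,
   2028780386606328860239255349580735819067, 1550364646374326353958220558256265026260,
   2999363025917489335916319941750523667397, 3635205128834571297811645675474671845036,
   3480308882756061171000317908336346561980, 3177767661660111855874789859669369111099,
   3883279524198693515856747454956099287671, 3680161387942364963805466286240111544792,
   4669823790531343985061791690799424826029, 3289149019107954522743693599972748846695,
   3832425468267962267425134523515629526656, 2666939256805329061458468055957124646281,
   3469726886595262973031805076163706415459, 3847274648517946275476619013267092405483,
   4691185106444615073818344584921866574764, 3146646317660061628566877000076996255108,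
   1407387920316700692556413133330651913813, 1295867774548182926400628400264376687176,
   3775642643976113347727492245075725157211, 4006844093429117665410296923426501701164,
   1742255981062823543120193199997627402944, 1829463465793378006944676953743476867517,
   1886124089056209543422293101105169583659, 2354378390211534350006537546628989066213,
   1386030725010522956310524644626747747643, 1855114649626662102108787535905176394008,
   4501588438127176415541229752418302411113, 3935267403989398488034320681519969413493,
   2259012868773710355583960780882383514045, 4105942709656691056973669799099559460293,
   1312092397504276307834818309819445004037, 4722961769405658391019927500098917958275,
   2540859835959643636473133634625423229787, 4374230077731040209223767938925467111132,
   3609382593734737475468805686793626733637, 769230299303159206897319308210019556355,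
   2977815493532898203604332311378488535544, 1503980307567409466271725757689661777055,
   734717200554117439783670508870788390056, 3863805111798745719213786971433675517177,
   2490497236759705102675389299276951214600, 2486020285375424010546807836136944676568,
   3319499193413469018454027148713146416408, 4272771666164509888299351087702682716833,
   3241629001808270857578723738182072200527, 3943248650345749182270257338973406397479,
   3672589647150897233727542426454304677005, 4023755916668606007908690256522238065452,
   3832003572062225994529182645314225733067, 3810581470548404362363369189985383564355,
   960462559884102217872589008758822083044, 1288693493261595587909120349087221122593,
   2572917157771100137176107187400492289615, 2636742183359860724642003476476586949644,
   2289500777798756170692879893542288484033, 3992161359934854804299145508975409195585,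
   1830179690764470770206538516960215834925, 1040161880013193655894053650122064108436],
  [4733315514728422983629410634575384453861, 3497397644983752690304440594936633486680,
   2953860802240082915164557344766420738997, 721396322764690938702355483379806151269,
   1605189023261061390667166149084607912789, 1542578541544350718849639494416092757376,
   2945924081579154377292537536964376175793, 674060596399372504006383581931892910405,
   3903918181687631109275991206882954257819, 4510607231657171973523090807724444345047,
   1662350466621609667060849549112562844415, 3147125476284018245941459382570197683716,
   3272909027720582802004968307012382868375, 2891720175933649883165831273502496197052,
   4478157787419277482462543906651564658061, 1884432015867049961103959452633137702443,
   3489632594854766834900003446546245045272, 3104324784653275943227410375979409717807,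
   937668367108015630898439959542936468048, 2890095576518258419940796482604216777071,
   2585430368308415372272662545376426028547, 594275960615845035144703675382754983152,
   2147700876832666211625954063947555219937, 4060698313927458733747939737093302043339,
   2021842917214454717923683995345213406007, 2779369143924670971328740786544680947137,
   915359591275724257966474599955331424745, 3725783428915227490258605946907467284212,
   1894790134793944089000482638283276707233, 2524072998366313237716333735127968842407,
   3105452188980034308093232920101909773153, 4788893681135302463123529074613937414619,
   1127799992428502533875379145247709982104, 3237422061720663170767475638151588204312,
   4711876177396007724355804012788136051567, 1583943090427405175419656989071802198983,
   3013893583315320789016264316794190883612, 4648337972448118223952633563622256059909,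
   2159213082571901033176239812353482344039, 2977898161932650556827742092342628688983,
   4055843550344947937183637003996522612471, 3502387429803575066072734158664137485459,
   1405613542812803909242541027169304026896, 2413572228329796323385851211444007161411,
   738068899774425786652573629023731573141, 3944630278881154243233710019283932223792,
   1991512584511717658676610591904103321337, 3927230424571776585087256985126545924809,
   753502670121286157900779345758865755383, 3775437937146631556966139541104048327875,
   1991660321485153961469165194354876608199, 3647889277623698903015489113987434511432,
   2908075082877664855571577201313421437460, 1447616487627960233684105623581758634396,
   4900805828730046013945512257381047163355, 1408209656147803674220894396928009252332,
   2469330896842526400586039930588821873633, 4499994153812612333769073879022233328787,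
   4900927913404934980875675492281218884851, 1279356433975973855378302889878178257848,
   2539926380529482783740073621839807950224, 4031010134596211720994539164837350530372,
   4359244144816341254718593629719720600833, 1269494776187270203320559085471519229159],
  [1159859571805967301561383996685880667727, 1657625390134255850300038811340904268345,
   2396734511200672213792742304923445022040, 4358911498037923014923071725940825349924,
   1926920188164022631120888938812998831539, 1412117128465680513889530423102816190721,
   2754432272520278378551971103507596927365, 3896871333413343935649563284548544545435,
   4565332787887321822063892041454959947385, 4265037365128356675591579031719486218619,
   2157700673998771619329960207699259803928, 4595698672141731705728599689623092912889,
   2433127436896005133987151467425210720971, 2149861634152590004812857384199653398951,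
   4308679095638545663333422126949044873464, 4906259117717879816440809805348785105236,
   4565895206986631625156200718415567276392, 4374551945502960809536669605314129447824,
   1971404943555682130273688940365199572377, 759192119858963501393047679113052046965,
   1699292470417243853845048326993778867512, 2595192043383075189474004772638301940636,
   3220217279820280277099472733314420179743, 3565384913923926010446169408586406259187,
   1774500078740640146137113483218326273723, 1264575145616020587687977599234497563779,
   3169657298334646779249436007751894552347, 801534475698772393853816788984024713563,
   4565353738576217916474319109086932838087, 2124501381074198361131232418585135072395,
   3976526575228981148869069259586948702801, 4858597713109404539407142135066890200057,
   1907068523500990027762946900606380450189, 4070631734121847037794926515463470186789,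
   4373907353692394882640373246357841128049, 1418267023752547400086136755543338376772,
   4033393572086313211945478852037632478337, 4119184339480410363818248431569424772316,
   3713498950480197390568782349866867955908, 4648579425616235869501510485332994964861,
   4924794328083060667056251137067070104023, 4445851350255455100554849499304362239765,
   4882009751339008673769081761472905820572, 4659080823404631575763419648146631248887,
   4194400147994868233613297853421707943713, 2562501674088425911748141913880279202240,
   1631113522491719468161960319274402273565, 3701000871667806960159473790621354878285,
   1583896770566990636249312998121880239668, 3854098201989932642802050248545431495907,
   2416169556587710238862061410881922194156, 1794802456383255083173944461846062459196,
   4013091417150210096759275898443340343504, 4422904051998523352286378383170701205829,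
   3987009339459712778044643062307438904263, 2892729384374409199556696886381153897163,
   3424433506347535332052484505015290617205, 3221233665882859269996015330047484587080,
   4425237869605396472603490657450162973924, 777594871096431700080006292128752198443,
   3003754600103622894893293629787586701605, 3011422095876918890031812424329160181093,
   2492172807575906288829460320440690982463, 4449019875995058827671906884586531499272],
  [3225159202446352544865260773609072895075, 4351310228533468682895942219826284626551,
   2214997814410732786391886630891182933685, 1321896872978174181426805877758040050640,
   3413043813404604987067167442323277434648, 1008525428252663845459302918205242818821,
   3607868218375697000247754547782985253873, 4469626950531383752849816857994086133471,
   4645256384195549280087257586436850091349, 3788768829271365494946355283838175210163,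
   3769063948620491662364658432197143752436, 1832098488641213985720355644442415374589,
   1274383338688847585226349336103997864204, 1192485229863054854669877770580588079928,
   1502797685105223301274381766714390048224, 3864391816312052430237771039330371414744,
   1322219962213672793841449318986432783705, 1502895008316594775633837531712693666189,
   3624167659321988476737624586104997652153, 2174351578038158054084323150565781693321,
   883333755370587081734345731465612986139, 2427456393377647141190468545402932755156,
   1630990190880510895185433595410570699999, 1104037173491377498885601951951583831283,
   2924000901092560433794319515522261445908, 1238212658582998035232668416688243440301,
   2628440807479758241095880176722958207953, 658270798907814150514373725767972292912,
   3879273086099361567478211801248675920088, 4921878800735841388972324273517997218816,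
   4477521904389662638598831191560902278177, 605048474911395284151141070268056094269,
   2126479968484725713799918260325330691807, 514626018049245298907164957045119679485,
   3789364399759601798297942536984263288039, 1519167604800632055518702510588971427071,
   2338427616581412911430357939651144861409, 4023198246127131705533889707732137895443,
   1791332424471186424582671576144403361617, 4629249835539957549881373865937055341769,
   1753283040751589974118064255129590472349, 1255883161856416202905721278354414683663,
   2786508094462727718250832111074832362808, 2698696674711612537843052164254731975043,
   1748932333575935139120057203263913869793, 533227573994238414456122163239021192825,
   1584066523384942333282461661811704169559, 1264516687664872801766108530327140107663,
   2052626056177934361363406577535845886433, 2157415046939979817102120358794499841237,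
   1065011787410667231213163306654337317612, 3274640409980074517322457642121280474403,
   2939089367399887531211187544175997593323, 3468037757520756593215165556821544537652,
   3958027441754245273327302687274043983109, 1265902066307051364122521775795076201253,
   1256919566385757153469131154285090024328, 1647839503151007275876903969789934528035,
   2285580494774577954229262755750741279685, 4901187449565976079066720727227584578167,
   3269475459841543282020842183066799137645, 3713535214157214449445070725532808060195,
   4762795674062934703591131551105842610993, 2842306474281110625796631461399889658217],
  [1765738251985534746655844349031219488233, 4247014304271077362075265162609984962793,
   1232380222707925740589967287911084467057, 3620481379480204485845890163923783379695,
   2429202874139186144340434602261502969029, 1773601199353711242624712885017845722096,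
   4214140128087522533900825335469991283151, 4262491772096270451342985289970741951988,
   1312074168632888176641099366676523183345, 4900739495448268449294470522013980589244,
   618526562444226985894516565972092281337, 3479076633968740872845835849876897492593,
   844075689792691717021001758693100814685, 3497688423889887716924001168182261107261,
   1598942031959463303144640251468527270077, 2912338642321127823724505554941997608776,
   4892960118949630010903386535161362111197, 1510853488732344644941867559486226930175,
   4446083022433731129487273268085698857328, 834009308803961063456985346475566951432,
   3147925168305355311392314892553065947893, 2022406350874865285175335724376913552969,
   3242407813286653139739166929867332837729, 554658641268830785300050106397812187857,
   3625837327116312501098899150945818458332, 1438630406612537376117940318399709904355,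
   1285850541781924143338664885032801913515, 2221124516532038306444220812118944488616,
   3577570656686225407136106050452806495796, 2671155284575018778428694552863856696332,
   3563368346664961972775744356693085588236, 810049432506237759868906493428278443089,
   2915494314182319867363826705796114769739, 3616874950882060539158113455472729130131,
   1768175034986876395585108060996793903480, 2275150550288160051912070534153704566113,
   1137310985834892341437617396863802354925, 1693847101525424065702415997406656674879,
   997499266350346033374059448617814860693, 4693239636081329218998476303622245768396,
   3508896437532229935984925154205368703481, 4055755218330543564443479334748457070336,
   416146362156473899659328493896235737919, 1725910703943598022176001120926096313032,
   2444903459291046445038721582772532505900, 3214297210093978485534114678440933892935,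
   674180381705527060276730753107173566075, 945803531049898356079165107263381760451,
   3990731155830762077163435931748410521799, 1998901182264225128630772357957910051828,
   4351362260585650843989892568351617871517, 2670376303171061372425349502902439223985,
   3203881139326786218534861703926306937100, 1773518037742149057901115281014029019847,
   2678020692583448937067669987422845328376, 1210136659180387647151663434444078711655,
   2945252912387011482247907988966369151655, 1755446968820914273817778492812890962728,
   2028667478868236304575890559669866455551, 3064489902730073896042630843723059142453,
   461491946866591159269025102156373712307, 4124423339270700484262660124475917512072,
   4040431999145807444570388513935549260563, 3448495436411348389398088155075386146641],
  [724823012566411971435074667122021844127, 3455490125710358019708788395317757155932,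
   1096461480386752600366402083898298557885, 3676934771604293282392782658796551527011,
   4087869622251821337400032841435209000449, 2021152384903070299316378295655314309285,
   2180945243319739342957708209109289311360, 1951002137584511595090871937724598175107,
   1776138678394884277334209758261301410757, 1055948906271525306395920496107384753044,
   3255517027926138194924527550118289989367, 2541125302118879668314654219428467685527,
   4662167743262384745168464231877787114057, 1543572696496728970240302636368844471809,
   4342043016753085664551306600644890274040, 1641405920320929402279814169183457447288,
   1511785484352659611422455570511721884123, 1536228557069607745612457261005377626761,
   1589405660625007739747559099645979206845, 2033468865238185618117622600445904885937,
   2429621645445452787444735907757442668767, 3744197876008800138052886339961500638751,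
   4149397304552397411765163174628877651344, 4672393125961440957851872096290561756280,
   3912884304742342155502508914905529713613, 5060448169957561881961988576981253753868,
   2277023474032444946418525840895480491125, 2305089619108891416309082778151871254341,
   3840564351304415130815465907136218238189, 4192951478231312061302252500813783718359,
   2682030672269632133014364136363125040607, 2381645942688839121675001458619113626012,
   4201833998418076518978815724331271792487, 2528975841867011547255711023685461132609,
   3160638529965908957876595737766459154727, 976410522044701826338137373550328343043,
   2891574688861747775643714753163164446095, 2795129026552221546028479640400542574177,
   4485590598727967848807946669054421903544, 2426912848815012380228436412507217759868,
   426590796482792374035759321674059211489, 4858792302600410644702950282964165114288,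
   594092629618208350771810322279377265511, 1167530195558013993249324920505125976653,
   4158294268264797529319616053166816975179, 3428032381586754747863245248765772430412,
   657409075292095005838289136932764582279, 2914059462636604938288418607740524501464,
   3668399893571104767473852649716758567076, 689281987217040675182440567381885282097,
   1647745905002335921540256693214102019960, 5012429714805936095779315955304748252703,
   514828591173680978901823775106301274269, 2662338617962015323498098670394566793552,
   1741606197771764493239613323013368430839, 1957481802414794892029706873959091577847,
   4318995626661298557105493217427376520836, 4035032946571878285786986972835248245047,
   3544977194215685587767182097978980114224, 2252087716188501767634358432058771258983,
   1298254887720419981860947644142794841892, 5044280803604003398034639072482603958423,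
   2556078260529949588157035446069550947959, 2635123318497332026024627474503820043699],
  [4157279574327615503138376738962184806611, 886490221295284103003618887181186170371,
   2779696221792258053777940953107305703277, 1135633922294990339198297078298874879591,
   2404772144348025867943240674533741504341, 1024414516615482697230679200280452324991,
   4392728860983699341631440270949565678747, 2556027634929792172352376036873517228615,
   3742805419802014874043301923236117969312, 3801017320738201070285184912085237189452,
   3529675568848465507822318738909185216061, 2411396814335394850660122280143711751255,
   2844258833994373429261081503980733359393, 4571491882233882599872127963491975342336,
   4927153034298592250857532659366381529752, 1789858935843857317145120962705517849813,
   492727569035421401073052463108386726207, 3094997284725998325419102576400069755661,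
   4092179217240053759145328239099061091160, 4860492783050158239602231793523384617843,
   809032146861166690034989848358011716683, 1032302937496138441165555042255421246188,
   2606059375209303379908538182655987246621, 3386598202687353356279892082956874033963,
   1629336854129446944089904310088505435895, 1334154760862813293737327029285612326695,
   2884239887712087405821149562052469688561, 1105309775766762244041896768283411778195,
   4309826335199302108085875107346534521719, 3448714687602124781540615579017916644983,
   3736304263853771669955407789250104207041, 4406043942377683315441684776014818228825,
   3927557368414881665566966080200605656841, 4733473395460984196905120435212605621005,
   3137465111383338242099744909845054709221, 1223812935227349241695528876713602449016,
   2875490213020651714299524131374248928401, 2269993374228888346425748295054454332797,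
   1797442516655207130129017650319486248323, 1518529085121417133015824225251237725923,
   778275256824573004271443255648709065368, 848645187583521814420149485383665378371,
   4582260736085802508147041222505153087768, 1337878667650489505063587561534181795611,
   1422618546375279536075691361296574881565, 2564681969054106209882435938201477989295,
   4734031870370462406485896336982919432391, 681617846915244431988881480254139195749,
   4559900581328518469163055352216216731883, 3957559785246366489573842093325352590168,
   4597570183081494760986633860089790393272, 838930785460656080086058834351511636679,
   1104843127797992174429189116381996661832, 4566117248110727390079553674849870018897,
   4496949922906775441992438194043588356572, 3042892448735790071137375691119013013203,
   2126577186599866939262776465052178426140, 966368478163475945830034043187752062156,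
   524558960360352193719372829307559495924, 2507198289808545941811015041128957543879,
   4319517954346077720293515503237325472131, 4444232646568887516136217403736881298096,
   4734011015035017299323494866836485566136, 4040116061645160009288204521822483148425],
  [1709647510565362091344857216123905868959, 3892580869958748219067998876156792694103,
   4241383714215595161124076308725660279559, 3049575191626257524738002449443541296533,
   2333937967751117824596039547267013199269, 1619585414886495645221368170802209317147,
   4298247451967859190034376073313896115740, 4828868911515314380510663278450021624448,
   1245810070245774318253772176097538492263, 2162996751733529996447161937945343183200,
   2684287811128388136973877693962926226952, 1135832163121117087178415926679669455497,
   5022806743294364024695638684601264366159, 1057007306873754567449872359952509551133,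
   4096150141959898465128925736572496759400, 658577380311922595654146180858729647464,
   3944831403659987044096484917633612638728, 4159298671025508666481736557518111122657,
   848894741052840497863325979305043352504, 905925508624408051623566668588124759553,
   3903863582607659665791138477660780907756, 4030921805845765873451300247879389250095,
   323032801787001230185958750312405232637, 4342718750380893119542754059511797834029,
   4861123453112174951955617690259840721539, 929156077364744999395668085614123543227,
   2496533329566921887869214644999415407685, 5148208361952358369900497181502324080147,
   1120621189839700820484244582174563763881, 2637053991653896631105796130023966399072,
   2110460636743752678883229458045104055053, 1380339982831805075399007048767790361376,
   1465297689291340614535442440546412821072, 2689203546774287892429475644574458518849,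
   4360445884530741768265620940551496589161, 3615940516020452031190636103213334471311,
   4796897332130637518365082354888257037645, 1139136912120491873389365523542458368541,
   2375124113733630239671550797864784042896, 714248858253455118492552490042550008181,
   4517930682657872795009408905969200709331, 3522235577033418972694052955946294713473,
   1065515962422273056515452252245145262400, 4619048836351881635856893918007328189568,
   1331045071448668592098298385545341434496, 1693711144283303818153434153329284741465,
   3860547660209791879663949640856180152639, 2275788229184171022579599949542033325328,
   2097224907055852563053640122142502079920, 275027535129211131343971671351658412160,
   1128648476632911699481940347737066319568, 2189129549250840040704502796771807077019,
   4477739748854397278119245043015197353011, 1710030816909017481279472651328663136585,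
   1669769230805812814865596750833724980365, 1966828768053252287877840198972291664233,
   3298839209139497895405001303264816847321, 3142013675287784229814565183504987825599,
   1886532918358286007990452626354757116385, 1831265020275552577100192861728038222737,
   3305219022191866114517457447745562970956, 1146224730159295490206924206983834894227,
   3506762221009529626058074574383439204239, 3553373138932063433655710800904906139347],
  [4860622908865032317788999798969555953875, 1280810175965456782876000495388784426152,
   2136614721888666573296472027981093112000, 1427138224494727080824922542970051445497,
   4043844407247993878658663450473015632395, 4478401721108539473293697701799826146643,
   4634337356536438708130192833440767420825, 4549210599577132656197505186210732957491,
   2173457899712363274175758939719629823585, 2691861995706239901283032649990532418960,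
   2861707215639114488834178430461188377411, 5115878578771665197536714146365554597119,
   2243920688750358018907052208351943558783, 4916254196440185175393761241295632982363,
   4204426211019248431835460735417590334893, 2652826571209512367435496244360477388424,
   3784379718805530274806910097685131805489, 3052197303471381481764016576343788276711,
   4160140233688131162914343118758146203747, 2543494805689113988873271165023150812676,
   4924417619031782236293032205568772582580, 1025719387309874734240662502783719923899,
   2826800742588476386635581693389236290599, 1927203405048043236392497645779544111468,
   2778616328223349612923305211702354030265, 3400608133064632559932419328296951022529,
   3466388221958844130259545663141815593612, 4692985212370292370232993278501739624911,
   5102642237556700368378234296990560431140, 5092461481510300308650514068041087819963,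
   2052874737565669575147617056420354992744, 4423031192330395598071583138709144713364,
   4086639085847957574979435335186304129669, 4416152876584569070397818627482910403113,
   4049165462591121912913943827994173979032, 946957302632491903978370688743457939979,
   3338841077031404283244325707399922721567, 926639608942951985725090902057230009237,
   4545351392766559875251887966555827809596, 365148977340124726327988074625837721949,
   248675385578226874123416533728745638601, 2935303056109502231875482257400248495188,
   1056534839420389506500184883282850439903, 1327722067548614595790237639720213960996,
   4778715153550565734180810152652869193487, 2023982095989904094800965331048621294225,
   4222579811752985823583911524135962757029, 1108147011417790559386663682674351503796,
   2625712171112437107355355268252223241816, 2372418918947985143998962275045942216307,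
   2397645972400787379973106356550789456387, 2226285616266086989979931050333856668651,
   1086069038514018616714473478809888351605, 1151502728007015694572959904559080842051,
   5062901368461407543226666768029481223639, 668150337086468545041294444041222275249,
   1757494307919291571194157463159283525175, 1392413334858669321251967020988661305115,
   3809066090195556913808671037152361120333, 2363975047593798003022154394107237993092,
   2507163224272994189443836038654650101209, 1536150462431101817411264160973615336919,
   4478996493855830928140778344183569681568, 641390662214029638497022431617240140533],
  [3393354295095556156248965950109591101144, 616103031043438724469575605185243032540,
   3099646098005503430694803636859610236649, 2116312207415583704079845176091106878053,
   1734771145139936835228315351418872962528, 3297758905880664605190902973124162937467,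
   546423395522571669025063169461413297791, 4381555483198663882871803756703162303431,
   1456487749160856812003956756994199624128, 2353996635004492462631565262041941777459,
   3086707165714665128019948509830600655047, 4719337677581654988076034406178809305407,
   5129288835346140774681717421933549840927, 2810386748353266929343777163372254875224,
   4597079660237702016387611114092534284455, 1064126490876227195161743195863720240713,
   1301376668469960975077802747111616552752, 2390554073328552360963277223975666420712,
   1662346456126478925996741920034498133657, 2889868098434938833812467693938841729191,
   4872209146640602069172435381993057532385, 1073493976580522794950230267086659116779,
   809628619594742791030241992765953338340, 1344519574834765582654979537231936937779,
   3577108392458745487483341436989311318873, 3609294182979753475785243411364987469544,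
   960466862992373680279695820158540849633, 4797884096536127916727012964783591688667,
   727216507353119709814848986196889960264, 4638262829788191121593733287685475399993,
   1160971357169421561405893812505178899795, 2061675524184568411959067405433074707144,
   4900403666344767760076096699052819658825, 1159563623850505908219786292044176152676,
   3684241302080186464941722261737101828955, 3264458625524190904470371515244238178803,
   1480369654781343064028247590867322455895, 2373732846410295356393996228953121481581,
   4666468091486706013308544565138886099275, 4980856542048015449922911909597619534257,
   4072402344455009046125517690079180555471, 3130948647771567552133202975388104588789,
   5198350488843768661783829202056694686923, 2563106225026482999238526234599395356488,
   615059078640931378961781434834230160833, 4432084352317993013020020966829513009321,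
   1520077090430400411830550174610229740487, 3360733861992115561532174599428797597283,
   4382967315049355611712673436688124350388, 2021658492922225922987396277443536332045,
   445681645771633200829805725151623457492, 5220062103636786411251246471770646389113,
   3851182538826481137340970134111803698140, 2444808623384854012914180211999269809464,
   4906804339116756285147634189824783464912, 2828067744156826560302876046136197892011,
   1085399311800234589608548074837503634084, 849874166429209733386651289593883902667,
   3719363640155758436541969502101920451144, 3163232620377704559275427160978526717585,
   2444604803806368161289356593252530390301, 2244498945011289776722346872369190977289,
   5140528987260173738416516458153925525895, 3703422052619234496683074670327137814833],
  [577860169187562262012674386420417894760, 3863370237591324520469696681167954292540,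
   1870378339881989562053609202175181762317, 2511881612561306178776318820679585995635,
   1326864768584693495895235984199906401469, 5063026439909920994981596192139655199780,
   4246511092486869773315854853067521623769, 1312046827326639342640999267582199605025,
   584065461165344312641382419113894117437, 977076241799979197299703155748155030144,
   2311278312585337248048855466376215017596, 4836893536984611535075112414066999856824,
   852880770769694235443912087883749649396, 3926775181484908738057782675666554681912,
   2886705215914520860601320687346914577945, 2595082934398746795329995300865215057773,
   274787332481849671947111753800596008203, 3512412478098448684224483597139357027464,
   3815097982191156110493360742131651235500, 4120250663398756502958901061792210338723,
   2285764804070081999169201266559999059277, 1211538351186024200197752179150674028423,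
   2128666594857237344015654775533636049644, 503637565519219366456488691946291687213,
   5166417931567086608843429431600103226144, 2475417385646631052255795269945901948273,
   1253430991981888875211974704382794163395, 2965145559666866243277186061902638364835,
   1582943195836637498315629069582264413601, 2947951521360145787349669653313344461656,
   4064503262350735745145040008110030466092, 3544271130416695165141996262671889145591,
   4358776333778195683767715358064732998815, 1012372405089209201203105573029142649464,
   721139053020987196230698158406754082883, 2445198132885880376882033207790766843311,
   2411511958256745580943059852869533005939, 2860339404989182291116943297479142366424,
   4661104443759981579247373776850323922215, 2945952415985645426641988368706423310741,
   4733068351157386259468187148575211650624, 722234546685281691742697378531493668627,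
   306786036078550877307437469668731620892, 163625445178768564234291069885808614556,
   4486638785749215568530276680535148495017, 2030630963665861370887039183790461140505,
   3106684966276484523405570861524655684995, 2810061390894973857160687094481044890381,
   4160103718058218349554253259280845355108, 2042778159025350668707797504788432251880,
   1103784028298051520359281131869636289553, 618648305017178156456776265827115470577,
   3946139252155351381548426526730953623483, 1151740008795010829981747043073587855647,
   2698857425576973215615157758504979160733, 4072500866216227559753784479125311783833,
   743412588700563596546841548462306903321, 1790553260397731572334499004614545632079,
   2491940388072892330136975962037600856284, 1439631916543531335951577389401544805637,
   2690434796180515687562948223639768121493, 2403809039217723801627425695432427600428,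
   4105522042442043358114220550984845086576, 5010293016782649087418893370081180829613],
  [504132707990606376480091576897492450421, 4455192570451715844223332881192163801304,
   2520280502637595683671570485600830424211, 3051821047944998305453129335922771361415,
   556320050132742134202303544838134515995, 2971915917303422165307678331218137455049,
   1887378525692794402902965998306047756765, 394232199656899518745542519307832770717,
   3329564303733843906298709465346034263529, 2254175060028027188090615321236765358696,
   865924863808279148916203762194413160091, 3390736052238659343202381523808352208355,
   2523534278924163459562466921853672785215, 5320962557551444449799068254355512853455,
   152717691164049659536669655306281008665, 2022868623885676006737545150106371931835,
   5254668788072780815940806312588472990956, 1299719457431925727667092475660460268801,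
   1574516170734005435667533537497829738636, 4497713517225087670370455689870783576259,
   4850988172091700217066342336989395827880, 302222197475378184431303088530073985637,
   3295736550193336615436950472278330484579, 5168920540405706548043994940997183375556,
   800845971757724247891269723955898792591, 5116678091063767519971760266423740417639,
   3535472927630580788994905954149743369359, 242844327420049521152564454780634217364,
   1000502605409530040937194415320718957412, 5139642485746325552273856978718422945584,
   1136273320663586373859185146991066384616, 4900863920427166922391677524083408825904,
   4391375173657181554826822708771921443204, 211632062403627490168102820940163792304,
   5265271469344394830135629293034145670099, 4677127835254113099978528674161989946515,
   1423742186687345151227615415755449211412, 4118327760102811567678299050220622634356,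
   1022133664186771673061359673584236144009, 3049472631717237308644806924951190715845,
   4288574056301492490033785594295587667103, 1248140026256323171656675773715766881796,
   874164214952478766462446138539153087143, 1232954014966974842246788794822133381724,
   2797281272398338099423911818683914414124, 2135310178243668844729817105027319735521,
   1326818189535232335331714613339896404620, 2858453011250380108059278710625679883528,
   2190225312839718505954782454950814156181, 4339459293635527496754849702607846205668,
   5347448585518171425494377190995836454359, 519506498220197878219341322425619344891,
   545659278932217978954739169296727747249, 1671500482543111626497642407791879360148,
   4596934600712935752983041766419593825940, 4639740085973436384209629180521529252792,
   2876399339129019908073868882881017415001, 3468162289081626536157573477793160921857,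
   131348895336270699091316708229746811223, 2012835159699210237621238726579267649695,
   2264442593914129690937621946757569749425, 4290354227585409135804323901476799489627,
   248457031542222473560132536867951955604, 1542770423666795537129412683607808395781],
  [359645066347460513227367439865227428893, 2045942851940273386867111641690642572747,
   2573620667853601446307298963857545201207, 3997670280560114166280674718110798415439,
   2538928476468722207579797207633590648044, 267238848218165259467501031738761299921,
   3884881828467914177120757103012548820412, 3296757039929711387292105216004923603197,
   5347660098580016021559741875888281477385, 1073206447539592161355843247927616644003,
   2746267300120284159378205661158357937869, 5275370319882740285496529422224040200916,
   4604876017463423806693415773369712634697, 4370893208104582299780521513696035240837,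
   3465563546425608233639851722619457198593, 118157757640733428761850068797887382547,
   3274407867648753320224524075494285534289, 2621153707479011125095582287007193253273,
   777701146716497842725773935045977995493, 1025511373449515072236633108947949642267,
   4831280689473079872845911171810713021088, 5317965391621853999462480301387366549241,
   4534775922056611165381303654144744320391, 4052002537862941989171597876843404287196]]

set_option maxRecDepth 100000 in
/-- Five-cycles for the values `t ≡ 22` modulo `24` missed by the families. -/
def certs₂₂ : List (List ℕ) := [
  [2750169457503568902709112585243338992670, 2699674369900689292732842184598869703678,
   2750208403512843037846828322147566343169, 2835221895197174926490789412410404899795,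
   2662409257888786129635389498885744333785, 2779456609830654507336908268827144301601,
   2707662707846540144344759270459601542190, 2572073707577205338210812139790565159879,
   2763425378064727573135295535203655496707, 2843269973708851214368118338259777395666,
   2678356082523944328974824697530026947593, 2630535028445683205880135153203816651791,
   2603908945340006625523804907543405345803, 2811252935792811037125498507716645139519,
   2907014480697064322369522274992889383951, 2577346500245148387285046288073883759599,
   2572052895301725539645742435060385100755, 2715708223187262040323046987345889725470,
   2835214068724543374694033525236150967299, 2715617287005646320259703710470497162315,
   2678511885637695509491019445020640844878, 2707688647775209138279309036120927280142,
   2795345000208074923442772960519364111433, 2484318666043839578316656381089806152635,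
   2795452756179162846551800555811739917247, 2832558191781731910665523809939947107337,
   2806106058228880048316400067064522238917, 2492234324523195709241344889465604256679,
   2444439242052781292974393030646381439898, 2465691295369023237530208934704697128023,
   2938834159349811610584019312687649471454, 2667897513143481592669212304641806523502,
   2556115107137388438815971914030388378743, 2784869564113366062845297005415236449357,
   2970864117123020908927868996871811558358, 2763420140123456938973132549823873870974,
   2697163876020546366022345905515001771065, 2380592153564939751847843054600526379978,
   2380577893164483373098206855301091527818, 2633026089881244562110270361578428570714,
   3087742762500410233682884584420006521778, 2667879289402146599980615339105214247849,
   2869983005609814492576016546170304269174, 2324837306047052060408765203014271953851,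
   2683884567310144778057846731846390545339, 2518864250506103552944638495253231268741,
   2428383328531758741774751799234254703469, 2603863446258924638910025191927324654499,
   2739704337572974932902598743685496454090, 2907020882978467266750389210124405234850,
   3098357072952463882157149074308693120033, 3093028478889736665598950047257827916710,
   3058500980014378043528150071362830777465, 2364663441198632673837684856094019793887,
   2707431724173046319244818432081728301942, 2846091949633796643320600402996357714857,
   2763691524488490317354724684331200033837, 3055806179903535282040855360204173327321,
   3007864486651821624649160437224366635897, 2508417374562095295887404248475959104485,
   3098403780754182386177821288808677485651, 2952064086769782975314314890571570932655,
   2300822874193731052623056378623372162171, 3008234439762948537127289159129923251062],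
  [2462923753621372897962795607927283682403, 3090373893014382601695098046912276040741,
   2412365118094727252507309592875318250322, 2931043042543763126399159206457328319497,
   2332942445345817757008850897264692849505, 2444415787945494199838993034394902334499,
   2965484838012836543965623435984998689978, 2558955291585970714937493511041898585238,
   2859411529783664991658483600571999447935, 2588242474388945747988059001086464062287,
   2508018929827978192528841612010514074579, 2970639530624162897036352534568956392627,
   2899261032733963350826860753681135672461, 2874951965187158473784001328364980038599,
   2306094336466981224715577737686770773187, 3183369274820269235351632726632706184149,
   2183941721327011365484663144787325844558, 3199335583751460154729397198041345305474,
   3241991585959130421920421841772451214237, 3250005900624934613633830772457449821331,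
   2410089559682983675244487065219591044034, 2239667988477358750518076796719341777715,
   2388829712965641132535477739386476473175, 3119616889337426031216465958615495464053,
   2821725745381062278095923128734452610051, 2205308015257146259954301613436986727403,
   2548126693178302348874044804027631340614, 2781798337656520130516495552436699740974,
   2939040461236031093634916852633960447186, 2710409339703085998211486893727520363389,
   3132847015746963253001672428780204618707, 2718119910035468501350315352526524980254,
   2667649475051893444033080159942119255135, 2388671274367316776259036887713734081690,
   2827120498610517857564607150443762199501, 3013196865331250568366418610972960863447,
   2955131469116102128729944413140162573237, 3311095923191909578265473235274590254077,
   3313798496593547334209820164122098924331, 2229166547729538836325602241433976147167,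
   2577163351918885441459517458562313546905, 2842935030022954589174251828254431410990,
   2737091279880893131373383947328048698275, 3193999163274301340079727569912960162717,
   2859459519793855552988201524417248828641, 2548033229300480663652849769759356656442,
   2747814788289979663401793731252482755610, 2364765933824678191419424022582158750645,
   2199736635214445251258778655321110223830, 2707566536344081964214173238969738681379,
   2152024733408677336945341610901917711378, 2268974560518454776697216205872443714797,
   2789742572732546801161258491951096222727, 3188845768114533432698326136654458319935,
   2941796289343700841743300360577065252065, 2675755924560696930254310979461135119185,
   2146586995964674258929033873479077227530, 2890766504137764316565481179587954103533,
   2120162081989472011524629316725889141610, 2561383904779414743506337882511551436019,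
   2907138962665734617575795134441070244895, 2226247233330764552379628704340836717331,
   2927997807951211833801404268691075773593, 3007988942034838434943267132100141042867],
  [3050301071812517015672532013809360286849, 3087910090492986050661984798574190099690,
   2343608635539149203473064770131476438034, 2314011249180460770719055145686898805847,
   2292720252449675044130006850259566465823, 2843538613537279849266038335173876659185,
   2707766433390349970971050096400596122555, 2444323583508886825377878715140772656219,
   2516386173618727929089173909743007765643, 2197145623811763247497536158667889996755,
   2332928063271642727952789428889085479741, 2963006780140290812518428953939916872663,
   3247343473022727829275271097313141116150, 3210177008334270195127932530762905615313,
   2252914778678000009795845822754982648626, 2178593541462115595693403375224462767371,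
   3441381015002742229131015071082899411773, 3018986413209351514095270019691631326187,
   2199927385577598881336799637288916251585, 2390966370310617670376382715954972679349,
   3284495657093083948921049675135058410511, 2388305323967256503869111707036085480241,
   2112147925899846948784769286623528172547, 3409585958561394936279568722156995578699,
   2082924198569625045480458090773057719377, 3205010726241538370243442346100640308333,
   2619745316365326369779970480039155272846, 2348835939196963608748246795643042950222,
   2962970416273973533772446202827840344985, 2782265511229018771307355029139713798985,
   3098151949358397860536380510034225515746, 3274120307635046814511222806482381255575,
   2773854007428307313061662951116009335613, 3026809716360219476119236652509607513130,
   2971026562140338846470770229440038411158, 2484682155927315581147205805794771458793,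
   2178659726160973632796480653637294724051, 3125132347734616816861965791960546688039,
   2412490882291653574292597948495476219059, 3491874830481700178808760719410871671571,
   2101288162194167753575737694177040444307, 2763383692589124250995147957324767276131,
   3173062466553041566156214613821873413198, 2311243775826499809756237911453753439163,
   2444287219698592231496066411305631652606, 2992084902528421362404224082000402324671,
   2385801194293794370325208051713526545126, 3154579286696896328918886433086328855594,
   2505762711366280542207973857437264424179, 2141368650071659996042413193296164076526,
   2465372052705697155921545044598616005374, 3289582966476158172628817664270535478053,
   2561804636809991582464524589792665443625, 2890717096262569764281942545878560857346,
   2970896435206868082546696253916959585211, 2651606539742361475958877587942003102951,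
   3090202496507737686997319082748666071958, 2045553940550842471456728146401416009001,
   3082555490581320807250025885915513566385, 2356863218131949167225506827621994925317,
   2508157639226462959014749400505465805889, 2907294737910090771050014992981508682719,
   3497274842058303131666604128416355293941, 2237379470903499227785579299826196282506],
  [2790046124295420002922021423123881811154, 3013644676088590936052159565213430418498,
   3002386518484177749074479029177716444458, 2365017798362591938382058421010502562973,
   3162557326256390275583553854791773015234, 2229330061993762260423595267456694367419,
   3313580313571351655322343479455030016818, 1944618306092931695316509886888350931855,
   3497061881867085297735027389605235962925, 3122714183731588070373806339776946056069,
   3537030873550563504412360205136518607857, 2173031488084446447970486695078892841681,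
   2252702004961386398091436701870134301607, 2497873029552683459891327738145652356335,
   3494708507582359684669482657801123869579, 2420152234907951412273288126961237281666,
   3146612955794394131779070032738369819393, 2444065368741475513847416947933388024742,
   3268256885517297751221954025794632823547, 2728520274573871355484550910782682512363,
   2317211088429017197203597896961473565781, 2917909380540401903108722989172730583759,
   2927974617595698606119424798682703999703, 2566685190485530565784592344329880104131,
   2763333054415370592086003956299005041646, 3417379504211684029628819584097657574631,
   2955225067390885218701697634898357656345, 3507700989378080595136634029657974950867,
   3337392275228141359435652490406396285683, 2867393203090195122434355168691762859275,
   3090124631161533114036286349198298721367, 2604000922964322752907003229018222359631,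
   2524591361557828141911869042577366690939, 3356188271337185080098839663593067793378,
   2579947610793321230700668845006372887482, 2099155417407652145917163064060245330626,
   3029657734917991042621209256161428575103, 2694540319795923018127763591582225945567,
   2880799989229867465284412301884473949054, 2622236341188439941429259213350468012834,
   2292707201921703964517697235008756781897, 3411906864000279428717015263912829484047,
   2120438638338952837703970290196910123783, 2236730473085068023849168161250170088370,
   3003123960283867869250743394363224988630, 2141140424778314933961043376579704490782,
   2587746475567398530015231209697338879177, 3513085241458099884374650287112524860609,
   3050919107286792394695801720959988739026, 2200188501790792772601299065687628395231,
   2877378069636634840281819493079317296259, 3034530609159637698721193429691561327610,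
   2728473521214444651717754197910462084183, 2654106666789186081020636810755007970430,
   3385480600651518090010897394135906618638, 1899338871842761727725547788532182455407,
   3321550455745568739179180845074665983291, 2494669373009283746675703618152762387618,
   3146476557271587251808399660538959328169, 2293314822448891441657862580123157451521,
   2582713791780559124693095133490268132691, 3603557144716790529502950885779468374773,
   3114654287547134460518468795605507781347, 1910120860127129329897567620208262794210],
  [2747074928999629069354666560244544199398, 2588294260363064574973781964836636216014,
   2401864803598155409126761159314403808223, 3579802460760403550268263832115209448594,
   2253350920374240803949252144800336960185, 1859641327832527276981886331839217040234,
   3494731960321750361915225409307101748326, 2399003884278830756063745298780000857145,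
   3047628219098597758184551618437130613853, 3292681265512488287345988869776135918495,
   2954605606375449598604104095907887502651, 2508578241924240890647988020196992404123,
   1942224794773100427034082544181196385269, 3241594415837479751565217580629435563227,
   2888798488736260773551348212024536962243, 3409352183476743157399789161423731096638,
   2779865455749057345040621688263172123375, 3640836669297595747587920546019449336959,
   3577115517584169162652075177141388852005, 1774435637606260376865732580516921619147,
   3481491430340248751430421923861711445022, 1824933261555151270625915290293958716241,
   3337366250199485366162107054937084168862, 3568792259914038016622335541381062056789,
   3497456585084913886032434682912502592607, 3433143340297463529946638126565438082114,
   2731571737764270987749156426061309285121, 2141342631664645375859543048392460520610,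
   2587824316982762341969810913794606681439, 2123139873902786272999298618563556146302,
   2024126632668555931728442894206565264219, 3704534413937355899385475323665594268462,
   3226434149433551918888833689980361372331, 3279540913420846169076278726997445489961,
   1774387635941546910124013154641078950642, 3220949671163069586473790719394641132547,
   2226383350557347321996925280756911631574, 2141762036951634313414624431344646515657,
   2949861144442259910524245577247954213937, 1870180185163550814505742919280682840977,
   3098698334043544736451124662433618521214, 2785177144981348717553014382796826991934,
   2261301589310907444272054616561342125129, 3470673203812698434946272204491994639450,
   3257541313922717046695263371354959952661, 2859173725484526627331886409630999737491,
   2708106611147347908921814600156742880518, 1942300050087120496157991684614144163125,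
   3199051250409474150866562500378069095061, 1934215486157392266351208834833567707833,
   2183649496903128231723986566023574197361, 2005490191257624482669920554713560370405,
   3077186598682195791836406531763434855082, 2481910555918851697853650696618890933203,
   3321821699259632619287557743877355613322, 2954605586041039593562014807344269048486,
   1782317523295559022572133905756079168521, 2843668365230984155854846981175349488265,
   3449265353576167654236725648931949185934, 2739156458884888442039493752774738713531,
   2856040333361140786054765152460096167266, 3696738151793583486957166116988204366761,
   2459942074633315738434627638980633521335, 3439036614949925548950172880237423743927],
  [2133765853596429861218690387845404406441, 2875003741225904919553209717500461948255,
   3576694812122223026397389426708631745843, 3619464992932061604562259383460099070982,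
   2045979675995817374049708688893624659199, 2891047930899275978658939945634411834325,
   1782545914619918072803576194153821141854, 3143184738137005161331878016228771736942,
   3217634627338313639248141726563428764559, 3728403344978601315449372945565172202366,
   2428196261366069075415298307456857926982, 3601116768379657053053361327791533194411,
   3282296825167149612238138955295923743953, 3132550906432002510482218316378021518153,
   3076754440632685658077584209995148653417, 2335208702307861431532881145032548625734,
   3037578494269833913776679814004970206385, 3034433232582010033342801752610115638281,
   3505116294302968239017383028807966272353, 2189590803337537025600227883376757584635,
   3481578551472054905514582414261572897939, 2524309515355921639821022782050252352647,
   1742461541915772499971291668290986056419, 3278777699060213708600318043905486433062,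
   2954835295187437383414852691192554075529, 3536830899073912073334163846523058211717,
   3688829008428327696711059941385032178598, 2141010400634152324059417132248313343141,
   2996923066619693153037827541274093941643, 3778921832187240561941904768143143326585,
   2529357730232322097222055442510525377683, 3505474634851970300319552556083337231562,
   3598232368235427907801477632155831377094, 2556196701453312481739646053495397575894,
   3401570182954906931988536873671206668994, 3353993244174227980687881674384131841261,
   3454687387384033109641140766927802903510, 3359337439240544280733033122366330469325,
   2242723539158522364976930521448657040423, 2843646250330953845413569750409408328911,
   1856795722944315093119740970495767866622, 2558651359804650718744779444543173399643,
   2465566467239253090831745233773742150911, 1742412113628761029535985928894749037505,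
   3728296924417786114015671379684521102126, 3294868509314641925364345838091075169481,
   3186576719917959173262741624153616030531, 2516583432604793268399936899589951265875,
   1761426275042256097350611238240641588050, 2029782224879132031052417110377402776370,
   2083068176254352847734277921433471438073, 2133859407323239919733137814860924580459,
   2930425246655859027197052079213192932562, 3592580707892303871033887246214442283741,
   2082725484774111341785311715110401112782, 1697405235636139817659857741416469589378,
   2364954058899506596207981332644283997018, 3608640360344217481198097508182707174326,
   2082686550242603641391939363629503951983, 2716100109807097582171599099454001271679,
   2572453857629786911337337448071532112806, 3821476627567629677852115569302390000418,
   2685922446802060694497381149301020703897, 2636395843108248901251015142253831129698],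
  [2285143254993343880025621654247588713491, 1668302562086585068685348812846047705818,
   2922579519403087123640107607767040447167, 3295495492253375151627286468704068950761,
   1846146315693493807633376362260697847147, 2210160056930730838539290832160172895481,
   2867156855783129271387897449484782539923, 2317183659513163976039069669611978575238,
   3082981369263715488971309483306008212321, 3058594255077636447241655065007538081137,
   3398458790307616230826992997932636844905, 2037469443615619731017058149038702023953,
   2832359402043432529144096910998988155970, 2229283224941219945386185265166357453738,
   2835759214332562363998786255353295420019, 3568620826593527239595614810685356731071,
   3696374630149591186314134520155554575621, 2476006918151781282512512696501191628175,
   1886373629984129600735837004638333734182, 3800131040662142689087146981527111264881,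
   3002562886714103079090491555453048157207, 1982235158927415444296587645629208270007,
   2221453279834268752536132268399412417929, 2390763832732714327696644217184803232929,
   1726663793628111044114791681367624858701, 3728556451709175090899412025463267169621,
   3281998046311532200758410762742317864149, 3629802932099540505641207871537974359061,
   3090729414468508382044368994138884758942, 3050068681706441999265034998472054911731,
   3175561130190191286272400841903050208421, 2731988474851311173584718804289092746603,
   1790438152016092091016872999502092211337, 1973612008730973983759242553534351971363,
   3289556766633666309164682436071080516754, 3773752816862838207883712575221372095386,
   1952367719812702053700071324432400841731, 1790722485363617995975383485245588032665,
   2888806208511122625970669317845122415934, 1732101427135169342035438667684398328774,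
   2093338524429331840892311396055977069858, 3824255718434934214050653971123935759338,
   2268533201480882309555818911678467656454, 2492845681410550037178513521690844926889,
   1889133610061295784097206426302515788819, 1822016549698814438025042994733091527569,
   2386097048634626677432146941469402125507, 1758561344165802441193834474887096005365,
   3262830775680200044808253362384431541279, 2300581265033880909600864543853194654915,
   1614895769856443261898603150351707769973, 3880044467977519756493457398410685854837,
   2539809842905965870442181051274052219775, 3454578322576705898888594490889313525138,
   2515664587640780034546496760217335925326, 2567296725968400143508592430504897729617,
   1992069437550113614628105933740807932931, 3603284480629061090436540214373802457687,
   2508073182802460835606182195242865659150, 2132950863225201960976044478066853376673,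
   3600823284432203596134287563369065034935, 2476806566003271747057766131424804768474,
   3399019448143614555278872176681448664301, 1683887111826595869627618100775391263717],
  [3524075976819232913689750327214315181281, 3338193190005374647637289981067587538306,
   3855926162032223198202403981626356440342, 2123256666355564295085305516295430908838,
   3374419837774008247342055384822275415465, 3377684281247412046935777406472514870406,
   1673502449700079848631529367829542426015, 3178483121944042038578775949079776885630,
   1955540180833894260910349401799145198989, 2109515087178986300071430104412394763477,
   2252617798004612570744601456092185480015, 3465445798634916807186228548756706079477,
   2125230888930746516461112928753038701775, 2986295510651148027073994716561274572214,
   2428059969244582710443816338967213116598, 3058794158434807876889706125906805001369,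
   3034090657580450614013968938449048562373, 2062129175180160402044938115625417001745,
   2364641159056578369224281673321479662145, 1665815354864178626548717314328264569889,
   2742178240597269636797285981062433458993, 1623184130849222670505900072405359647327,
   3633049315460769187029757996251884631491, 2162121071067433387402308013127129639507,
   3257651368110909102193192856095595731550, 2412416781201479120470335225621645601930,
   3911890005301726367384870360198731550050, 3720246182566528407669835136576599856131,
   3853642834426383443499858530586271544431, 3752351408428600237775265686904253765073,
   1824839689945636666252949687400939646078, 3470186473401273985836269306227374845201,
   3845694741324977789096638382174404127666, 2630608762062433314280878399197966089630,
   1590996879783382949520779616507513354823, 1559046116602849805548621436284113837338,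
   2632675442514660306602880879153115640973, 3004804963689024304047652039396040151857,
   2874963452131527480355345382998813232338, 3331853460388825605434280455857100853997,
   3593316636760851275649711749332054641797, 2620387834690771169742931298427300097147,
   2629974188128023893205777925866497378974, 3856058485913809429465582496362782543134,
   2835793179685759096228924154069000633549, 3242170502079154669336665466548482444233,
   2133804717143065460965027874417126345425, 1615044975373401090977931132254838029342,
   3153688781360030259231850368357746644065, 3377853048692341962405871828230311332918,
   3513494068273758384679918853941383519506, 2189071447074426955829288765183767690417,
   3763383860826971666317502432972924050087, 2572582387891117789826629822813647498079,
   3856016946119612494014444135261386151313, 2429058261100547742384594468029960074535,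
   2197272666483466665617342447241606638742, 2364777447446363083160111112109784386534,
   3919960116314913556862730493513243718941, 2545760169413847887724781616167195614401,
   3231536673313656684244742039695827086162, 3072442359986980437649929197649208709763,
   1460767680609374251045847666718966330149, 2652429675961666853294344118608624606531],
  [1939628379542970682503126867802923128195, 3816524499203835360901109148633230633774,
   2388803510718761691632130532413256567619, 3114738581780275145395373312195917018475,
   3154264886642769761295278928327501460795, 3641060031877906209095836393995715828725,
   2429084413989875733845977703408321770385, 2740143072778343497720769550504688773963,
   2739083714819468726710983067910266641887, 3768270979060307293051690297881580965050,
   2324310422421479808305338385778026116145, 2029291605880491059166558905484323773894,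
   1774107176056676096430093442451551542609, 1811309972805334165379820575219985210422,
   2046021538910580943292637972565653539453, 2675888178427807162827092241581189238039,
   3949331692129740938304114611800566443326, 2516534024818415938340751346544591011299,
   3513127927714767896391641022986658108629, 3218150909689240665939568668617684651170,
   1476702942146228763545772344926080168699, 3709790112934270642456252229300114402781,
   1981400496473380982116121813996570729594, 3218171680091317778657398647349817783479,
   2896926020370678056000874810079053042247, 4015488101563993573791507853780487320117,
   3760219022433095014192838547733688015746, 2204798957325688471034833033928534772550,
   1814351204814679867033448818278469053923, 3345185782744043591117264133714812238491,
   3019176999876982434118610428245707549243, 2644423032069447014054171188902848351425,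
   2870060623708757064403819961066198789218, 2016801482089779402037871670158498861707,
   2250519656969155083608209542339028663653, 1583072090945927733912087018070484371991,
   3656349754638761671730280743142252784313, 3954508339797964984878330508746728584537,
   2930515889934309110467669256222985177882, 3609292006331592824566718194931378648187,
   3369959463249233066210609270891189590759, 2029801625687953095955461395213624376349,
   2133041852696296809399794585290968502903, 4023425799979648796292296187503992247459,
   3051178511753652571983205702851094026877, 3688366708749602626149708357925078408527,
   3441513159944034317370311480510792094219, 2794715470404268046122342536590129420943,
   1846683712111720269905246066116579466541, 3608364001815958966545319786350843173769,
   3768104842014853934242680879206838274778, 3760032165408040840090270549272853708166,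
   3515718874462269195809401893862076611518, 2445003749007106744908544121873277817655,
   3864384381379807796282722327846012545595, 2835902110129199854989576474076253663803,
   2794711638844241645310111913401104833647, 3597714571569254169672427183568787823175,
   2771031871638582987528375830077105613538, 1527513268617472969234152403064050169113,
   3757303764967202179177639482167807679422, 1686374236437114009595012762836682298621,
   3975558129308337230045679467923730828057, 1572122967497366717209101814591420488818],
  [3720402286203542252797456511118908838555, 2316245229821096144341798730583885362041,
   1391768495690830387764022142655635108543, 1572142531763601207368477299399983357285,
   1583129184614566576933844901684141602101, 2547872101823023195744322202956687047690,
   3667040648145922971624234167493989504069, 4002064708415408490979058217467800665169,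
   3177917104436319551630379064854477501551, 1471697418459887550962313923490103803090,
   2157016807477487119382039757910179501341, 2412421936815077165051643634961308696038,
   1710559803891898127126204523182316885319, 3920102871314785557935473355793382865806,
   3508117376527884964173881802719530208661, 1654921748588803869232977748948044059447,
   2796013474920079895231895663762110362477, 2612448785504040399221722300145537113019,
   3449896301546122671570026679944669379599, 3651709468187201112985972476135258716758,
   2588664312365446761395139649856819657923, 2317325544564192031212569629473402156011,
   1806308321105453713339265209489872024581, 2444837495289038112042382183740731854199,
   3782078708541690566745964575101071471691, 2835356570464035538461352514596982811159,
   2524601558602080938042829364458294401565, 3210474136122909298791833485539890424946,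
   3114619688897106800066047429791179848454, 3090822826486780350489790350425498262897,
   2859695576660962213959937990445406524615, 2122438708386752985463605255097621175233,
   1814751050802896066152022040800006720143, 1537586509662615759770702368334136846874,
   1367671041521526089473394445233434504237, 2794705019829235838997570256311353611315,
   2014369127409406739388026151495832008061, 1838856469674696563403082924592096735733,
   2548586093646961203852708820287904849058, 2420899701168054158994310619458707340683,
   3164950603240279473380517735093164569525, 3151327340802043867999640206543370844869,
   3938600392902270935468011839798019068613, 2194458406762310711413689688338847224545,
   2045980835291363686189038525529490995987, 1824520470374746134103210702610580761110,
   3295538239491181805226561446243738651702, 2108906425222964129108956800291922213762,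
   1814579648083202644470612492373087275557, 1439669964319149965838870830794588973870,
   1750358749855360459662096525073777571059, 1375894495027859437332480579969157282333,
   2324172752804761474506239855470515860489, 3099009883087757231441950938931627455213,
   3210185895094767472570371205429326633790, 1495258665918651269337732721712384662867,
   3863772921750733481385288698326338710735, 1742191352225614970251167938359188708842,
   1813897201984423552659962683170736731013, 2899304911080065729384118747638375599410,
   1880643826340137094998194993227518137659, 3539808514855831301658144212207917356481,
   1567480955367642209495529000405814844569, 3069861828357065309641735120120235515390],
  [1604740884994540106690085338305731706075, 3986515212572106823121135246990115411181,
   2941889545208344366938758763371094391834, 2572746051623956219176726223883261498089,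
   3697083405127945476761511659707595300306, 3943540909083969988613658373890399247489,
   1845782899300655923705800277665623231122, 2484183357166749017974943787023809088854,
   2045071188856997733933876581105007143470, 2866463871720214865021039153663066762247,
   2643425961379628172389630985042803643815, 1455213315413396316137415353178853569491,
   1774870310571702618059997234219565890986, 4087509230511491435620907057500495158122,
   2963533878106411710427883359069360717030, 3145905303234799796527790485811313253423,
   2986456328412379330003150432598764295125, 2675921896821097276308026970887270995087,
   2443757774087176655936734589713533957099, 3813816870258778085536840412224367373162,
   2643176884511563300071304458178847509066, 1551592572606734154999529653636455693714,
   4175112280138355319311468362751699333763, 2874766132132045251722441810750734921102,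
   3959442348518008077227961191373355406587, 3996704859379494275740883137667946556593,
   2708233703480372124055736327309742140845, 3986347447067362900107403600838169328606,
   1848820223603698368281485539657776000546, 2349013611311394793947923387251693087486,
   2133005036365836799526836270056770399358, 1598629599887294687604954093086811310738,
   2895862500073463224162578039121982206955, 1998449494488113712113245096891505399321,
   1365000858323069792713258068649869303099, 4151274504203534474095854186266558770563,
   3081787226020781308313433168475139516950, 2093034782520340494775754585239924569193,
   3354256974473381212416936581208691625470, 2144508588914624179070871256470160675357,
   2386233287525067342847152151416042929558, 3154846536608695803629381826174245051086,
   3258553624204316012452220568987992412893, 2794662339742806014955091937759670621159,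
   1460460095705738018435495737810199137406, 1346629217883663426316984685819236953001,
   1955321990372935776954574945473986575854, 3326583005254907831265784485185440983911,
   2412023512358700773551459469336436634771, 3949522495705103703467443161315709481959,
   4143099085288945021438575329722027539010, 3162918094507575422685061155798146751554,
   3332024482931170235632268205458604084535, 2635887970790113645828806571797666910905,
   3483762845428292829158801343663498296737, 2772148545309498932998076095484962937673,
   1892017666834684642389354777374453175287, 3898279640097955138872180525418541028277,
   3101007444482846854760273101908393792593, 3002054405511909529852757511927558544213,
   3661579666968261722191949508970203176366, 3824468483470472715021380836588004482081,
   2757502137852070980832098346972172819551, 2843503284837323782378776377359992053174],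
  [2579903330427056121303359687899175517686, 3717411148717988875355741511654027197947,
   2045678322342298183191133229640434215407, 1375878978929059486428775015124241970035,
   2045320107324455871539847491356535182277, 2460532429063657510816915617359552582699,
   1328140801212546693905811191372324123863, 1856367400149420924083559066200588072353,
   4025877830417899657298414122987534765542, 1304044595239500967866189913151237067575,
   1930796600236246796919256265305791380306, 3984100663366385043816011734838264290190,
   1526877226154969927209420044305188265047, 1365000827867392307444787926411423525366,
   3451510984625281417127697590052694496413, 2210354600730886027499001155959839763558,
   3760922733200237245574113932376489134978, 1886093098894237664191169185502099919809,
   2094205828212910456261618833634842923633, 3545135788516220053739745753581790100982,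
   2284721275164630775873544911257519152398, 2515506277066516973357127506430050565054,
   2848827980154294998796312866760895805990, 3401419480975161096674006166304002225363,
   3760141078364804713777082845939105836021, 3856266080072191407943603567835261619326,
   2951697843313101416574900769950201459491, 3717294451223950001904500952245305391567,
   2115289400465622947467555786591472241418, 2684395917243918956912645690411945380375,
   1376069588628813114457889254980339935893, 1974375640247486914344811709835253029725,
   2356364609346304559424520648929741509349, 3972701074397940120190801432568068712986,
   3879924773742296303127461125095576947178, 2173924343855304675851263461814959381906,
   3751863511181013454656081520825360927450, 3600766065124786989432921007360690052494,
   2349153822230752904399127795842952997462, 3215718295306151491245214556939131599923,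
   1431416764552861775334680306155948743449, 1264239179846661120938835329851727088082,
   1349318799190628635048515683818123826027, 1200326008121443112238818145222385568894,
   1768945836241779203811186747987369244047, 2683372849744307439681862904642696041079,
   3002407041804373375460462568365325446525, 3991437197952022301743311707404850713093,
   1856336261776099231867322940075013116757, 3959808276238977427777167567613591179763,
   4214855349797453947689244942308427926158, 2055720386853861651279902128789934779413,
   2731924724029811240302682038281782293465, 3481822673010039673693446395055377087287,
   2784211210294047139754248359854302321403, 2399252928249336262595909061758455630998,
   2864743654903492117772619703525508070349, 2657785715240202857658652906769540447405,
   3516435590130271468879146937177169762758, 3401684291747941436991484314868320980298,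
   4015454149028167805106499604561265126082, 3050128182589642690943881745061586785347,
   4143488545361702821271913430162577976607, 2061717314941831695175118557149049331222],
  [3003462751860586561652758790000507264469, 2941056223523680382045015789465100636769,
   3130594457736785724157536743807070760265, 2813232453491288293597886820536062721530,
   1461203958942596814832934953429935823347, 2216006408215004699488753755911819689338,
   1455585574277143705698014813757265171849, 1439255861641340181672330950789231285815,
   2130106550542441684193028441378275275941, 3486530311168588611910306332330414879585,
   1428647991432334344946982808499154916227, 1614671069324479512324290834742503674883,
   2471058491924069335274395099493738990875, 3060904749265264217216162889134952033319,
   3154057137839481372988023404956014169469, 2779162913104845353001520327266319592506,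
   3592527231253853648968953433476526251290, 4023722877084571175056479712608205094227,
   3632799929164207028009959578593110121038, 3295865631874803351009419821781905543811,
   2859494250300437116515360475641977506750, 3417737590134683536288098344790614560227,
   3401885533295468018023906611985878384179, 1878839797917922565169877330876834831870,
   3529509619187320502125795531608113951841, 4079405073006519394518575385674447551938,
   3962051426500869500914967365857701165537, 1184414115597873399749973437802188315690,
   1579950463538005406098012069373579979638, 3991286672247138344939570408431050321158,
   2314899128180140310716857297524237057450, 3250421043471683167751257216094423068074,
   1367468491060714443812305755449956662146, 1189620674149914695608584756971798293834,
   1495715576624048183438318222580486937690, 1407645518361737209429342215237357640279,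
   2005788483450849560837895845799469790793, 1654464846817109164118580168907986418474,
   2130526929088212022857353605446346198325, 1686981522406661821974964041573364292989,
   1261138148869596144562325603108921928767, 1208039158120326353289677635019865084643,
   3473424950568976440658540854796245544078, 3909287191563202814685697256172738316850,
   1909520877334586627991747675430003994005, 2828046161829294050904676878292123798279,
   2683385810049877398757841956764478520690, 1686397442245136757623747167911271759154,
   2684176377307915735921195728888602713367, 3081979594472743328558656831438726826561,
   3587318015746558693141729387907242421002, 3656778568002904354214837002500442853825,
   3975884916913536518535885540354422101121, 1846597906086172343669877390783070344501,
   1960790752324550270485171195149620964853, 1386050410872757000212691182017480379638,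
   4196283718458492247756056961440455758749, 2707293742828203042532224023160345222270,
   3345245353377837831269965438526528781177, 1742273011134247928116957902167016625139,
   3984139495169759253064109376429670086001, 4087022254278811665701752000160958692226,
   4029307291209478347838547460323529297026, 3704052646445727153967408897304839754633],
  [3612100998762670938237652346744479519729, 3370298398248589975027018399543890680975,
   3853907850832762889425734203158309583447, 4188094251866231716211912868537905113590,
   3757155647636653225453437118419835120111, 4135158664986512378582889313499165805154,
   3282592726489926680769241719171404903665, 2261769093841101629866679485528066055058,
   1450667424026153596420503791828555412091, 2263153832386750393752350238711280981381,
   1728707054446225268550924692759132386427, 3922186596249510560834604506438423309590,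
   2221776490919632194558727243082077687078, 2172693685655731003143210472885397363891,
   3441827820059037953453203089550917302957, 2832152926296953958945516582390228282425,
   1216084481858621018213383972894766822507, 4047958126373827445284597680700373128325,
   3577582869921107767838947553008260224471, 2207867454420048610817946153427370576866,
   2047667163119778325481659857875986398634, 4166993952102221118775504896369330935075,
   3528999394444422601658543401475988239373, 3225285365963456125468126296880390593494,
   2125355374538422385557774361375393274998, 1263844523512046991618135066544578489818,
   4342667659771933844405354642364521305097, 2005726164325944976422759257608045376797,
   1559640553341128796936900594010430110181, 4025932577795352532477401458279585475113,
   1651802891045442681674153183967078953597, 1144394462778448929656284728797074789879,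
   3324699389049979822941066489065561881243, 1216324595832179838702742167176088554475,
   4305225961506932439821485317997423492637, 3408980820071788122892520019362229353721,
   1559749723447192756164824740725542402786, 2156794834854557377879886142188548177178,
   2168489172057200806711468346217770999245, 3025885729530792730166643191790787272074,
   2908960474086128163100028964614272252661, 4299811802277475921755520330740012145303,
   1083263101966521522497709047953960359385, 2843263073246542130991938693633053719698,
   3402017959771115701602097530140242310333, 3185387757349599042184738753566629449063,
   2417239164219787474910608126740379429834, 4302879215004458287624621964250176745993,
   2185836999033340401562646445710344958751, 3369917808076012886053052247686635249039,
   3327022905995030101901272550580677733355, 1535791097826061842673176200714912803963,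
   2923754355647926922208047849945127075202, 3465935559932944909551812656293020840515,
   3592942526469110850862283389899420055011, 1710956930762137010517163596891751232359,
   4199409618680778578905695673407300464053, 3697176782760093720664016118450770368994,
   2475550230650373981636826744681504926937, 2326688323654715625073629667409526922153,
   2101451329016033781144965618662607809477, 4175247089929790647865059404797251460234,
   3654285647588955281766823229371987721774, 2920029906865581216370310542612406644295],
  [2381342265389298229040751959448341880317, 3984222616462825263398537452811547028087,
   3572286476049297227314057598922755922398, 1907672251749010591577571512519309612573,
   3185743146915693549111371653916191216381, 3004936983339129602162843745286518591002,
   2029953421094506997245761457360040803841, 3895397978144032469748026256337613803921,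
   2810925490324964543460079395461764396293, 2949533809406048993858120670012297565193,
   1348703702124147404708828643510543018822, 4118844577343357660281215825276655823386,
   2676415271272231528079846624834556050159, 2973121157457800205909767501669668661810,
   4230738495910731301376541891183558858005, 1997365333120784768171929665802169382295,
   1803120369355961084356213219724589839939, 1998024687638521697763588681633889227923,
   1815052278909481548205495531156741987454, 3431029836683197638825174183939589846597,
   4326896111420611582726362873963842351543, 3442115761982357745070217990268120969949,
   3504809805387554243170124286308927027798, 3768582391308152986987705166388394990683,
   1495648495139714172518974243033237957350, 1609216568984836985354956475236683840398,
   3657353189377325643841091443855213862162, 2556315984694642225684127386569145908482,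
   1303530713834398524769590075672425200306, 1854717374361242766021099099013590769255,
   3737070513144108562314856442377637740051, 2257996505590900065346035037656260399957,
   1048643369722075905828470028211563207725, 3250491128043431641261232587668185193454,
   1679435982929861271618319177233309093035, 4100400115162066880663677966396833370665,
   1059235658928535205204896902865371631030, 1072669368103806124531502616731706002630,
   2126177532868311706764293880644150004165, 2009219620771228698261656909048694811630,
   3039971936041374591145127835549403534399, 3880050620645650258620710949485494930315,
   4422322757064082439399827266593458501243, 4150969193732313444445417007073320932163,
   2491521569728086836080174806728449842518, 3728987752183784836515757630792672304106,
   3672976626739900801796344059818828709262, 2211047818205892865163454149913383678883,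
   3194563556026833150903414926918833470278, 1907294490949092483353074950178310788285,
   2269406585173014239393849958294346885778, 3327794197775479953682704716125896141593,
   1950151705580800117168817042159871063307, 3420762598140373560741812459482622520663,
   2376105895105394653421509952930602529423, 2620726903840947550419729920554813328630,
   2991831570882375577824799943082870840383, 4044475191425742681078634284896784758141,
   4278964550489257422360742846895084526598, 1869504062741646076622545557006528023498,
   4374569055689557242738768758327576654297, 2859857813667645245279318927035642531410,
   3719987766242721083449342781161620974970, 2423771028228580311527296653193236171907],
  [1880434086133723460636280502592648653290, 4302725785054325332654775016178293273463,
   2707272947279806964402672837685964641421, 3313930519884108052061928103435067381311,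
   3991154509344588006819493443503851182846, 4057631272538596910586769907376913681591,
   3104176039655562778917844329223100775182, 3815785617974342251208236772476132043503,
   4071897080801398805612556400558222785886, 2110121305042369924168325431759867489865,
   2333535862424214901949420415761773312862, 2475965942681550787244219448284499751315,
   2611306414270918906788236870016280743466, 2140595070240016502548321207140450778213,
   2421068412704828824564046045288423176626, 2970478260099995290235247488119778397193,
   2058806988700403631847433712558787450367, 3751749350518594420705919954339588636213,
   4055934637424021362310650561376405813687, 1152720289925523212043789147641394432910,
   4068288431340320439843169738090767150289, 3305045726697786189410894228170933271294,
   3952266496004392621404227704641443665099, 2295323889570636286327974575171471291605,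
   3167978983709470601932739388144753498674, 1495710308115981038291798459922750641747,
   3799830978242754341175546137044932294175, 4186125004742787472131115953965438503478,
   1559450910490011799805411623767962325875, 1843709616057864072785680056528932239910,
   3566903265170920261683911809474822716215, 2714934297046923729492378152115477370237,
   3431138882300009926892289991037977705262, 2762663295053527610976549579289430037033,
   2708382081940170719176095087040910420530, 2835434373702518153168569385153313657229,
   1378351935888129901246894203536472836571, 1571862181920501018032267283302537695635,
   3162159656781541432159362179790146670141, 1942717851112378007258138279108339555127,
   1869745167257489886893871979864104965223, 3199751913664505802665588867233751883329,
   3961911215171980822717580286133134429430, 3047371044679498221481630652215097035863,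
   1864245336738001185995400565260846476674, 4398209610451671009403832090595073602521,
   2940993874218126405498262318651739782423, 3183026271174505352089114394912422919366,
   1359865528599069291141118450604260832883, 2444318119760184698830763980852080098710,
   3864629631767461060095707797551335713354, 2859804543770700278643575747218153747525,
   1582463396341144960694230329190607748633, 3508012097465645994208049392160425040434,
   2842467540932019528645735960891853139118, 3752131879734018949756130573138029976966,
   2683881606184500565450719017219941618279, 1934763511781560751573725212964784462461,
   1933446891795387623008729090210705716647, 4060414646124039874196157595232410391051,
   3122924163818657938984434429412502746673, 993122148926696873509043644734721457054,
   1679513932124427744721185004226809809967, 1136140018934670756738893618931742121410],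
  [1296260374967988918719954758586644634162, 1091121447347782297305536992398725000482,
   2280459966871868560474209108166991571514, 1486787548525273929229354180852497757407,
   3816900887449515623261062373201438378747, 950480426139439436780710490104443231202,
   3867234821075331610330855781793968346595, 2028997246718147279228528088454532413934,
   1578055493661358388179254680995320564535, 2662934645044996402301606187434028658138,
   3087851386163731879303981096524657868334, 3099190289447033634655994967466834324882,
   3728242104714295022550464050603371943581, 944990913726009559767070128512496225046,
   2484998609868895797964639686052667100317, 2853081900560433966236873747317343218279,
   1941681775153064962537943268028787448706, 1303468451905688920478992181652771729831,
   1845536329909867966669846133031694521371, 2497958459073684978606471739534767731889,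
   4278524481123404093753139888510947621918, 1997282252437868861781785471688726049195,
   3842245605752465652315192164993752657142, 1497409673800754885451567306093921787450,
   1370609682923078937794085636933151175155, 4454424175215949194167521571670354751843,
   3274599032943836784362986587993739553942, 3481291217427538427819500243838964453925,
   1391327441928668166668456425539884110251, 2229945384851101079259212745229395762494,
   1216131562420522188145029994818104021773, 1104752499440367208983127133276869483106,
   993097611620361239451460326270043925378, 4101000251402070075423232041207961891441,
   2409030323768286359590268950410308056001, 3778863093523259537022738714909040295518,
   3905935790238330547866814010664975927858, 3353957940906391949067455462574697807239,
   2253849639314852239929377721078624760217, 1314058095632069530589821721976511073794,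
   2082550071706014077545821997228445067898, 2003010549626147975441935417605591436199,
   1910507243675988220218725106019034291553, 4515368753906194590089770513705137761378,
   3242676763861156339618596590275883944738, 3065976325824133801004990182013400085645,
   4119214880070957342522093982880165376589, 3975520082860628416373251024436259432974,
   3295771854622649713806646452419527679549, 1803338255780498739933664536961764170098,
   1615088296709972781876192646148879887229, 4374611825618553375279358795699845020477,
   2609870697791357281589915098317613087855, 2890249693065594650826321403219441096075,
   1913312431719763874137090026767782321099, 2165989098460636147759216836876893854190,
   1838845806336497940402360047577864196457, 1719410178420194718788555232456792372665,
   3378401008275140673968103211916281648089, 3320902913775878690202015553647740681171,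
   2484821979312391692108707659422543901909, 2656461207933287792705180257668084411179,
   1647529233611835062262308810183897299534, 1529330828015858872267319653948470735729],
  [2785414504452376320645107239043900607611, 2516261261950206707522200889718929878531,
   2508910408346121366770822363660793068574, 4007434535361238771054676126834860321802,
   4015020646499021370338758828760444583218, 913337375954388074500488510791634504830,
   3194719341746289255774581827004973078195, 1646267861874418796663315100654323895050,
   1486834157231677692085324995724325816889, 3561757796974129946977014924388498057954,
   1304036639311881690758327612307053300742, 1813718162852128487151248738064661092711,
   2784522584652114496707456041868665142893, 2907633348209949301008432188987538936931,
   3641234816290757494087249563957980044478, 2891971106765553310070394611473702055486,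
   1646917671752134967570009647805852117893, 3193836565024375494940519292377152498773,
   3472646169458008010699768009548955735595, 2204409565622637481859324434812800703994,
   3576581588899435694484026403899217496422, 2045057883542474412453993198644492008214,
   3624367619415555275204119777965790966817, 1717930507067374543503049104398941211159,
   4398170599785132278523314551164863820355, 3852712204370311028184095952567003567491,
   4098438709998493230236521099043187511843, 4235934630624527555287259981806601767669,
   1439281679655708147094320049065794317334, 1662410255248891882274110388633286904379,
   1673116744877129790521211522922011724983, 1154947672933516793899233981570430875123,
   1583753578058204864408642689667367414409, 3847862239073061725770770774514849207779,
   3313699419673879160982032665969836323911, 2997681955159142918911924929102068126561,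
   881354165383215488490500159783428459619, 3824886540436131029892361051346570791749,
   1194614268543123987682367382530083646515, 1559102963224066373799454258172768968022,
   4390592782996589488971794032691652932447, 2699868667739115094707170692540422790835,
   1527616919179922509820670747195927639269, 3544514007625938619390925191982508772741,
   3422921994869446806839190658220601490754, 2164558658573888332634683537738554929929,
   4079911329555826534016294785197840717431, 2164444689151753278842481037130633628070,
   2289380325194616898705416737180039638649, 3884676098085196669151219628237009112577,
   3194092254690351448055866714579137985215, 2929158202763504032559750700931430906930,
   2229960918656490885228599636330915304031, 3537757607663926474419057049962066597277,
   4411326792444848303956090919978980013501, 1359565652594059483965479097177891482974,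
   1774398921318292077975481704121374863014, 3226790951703508680766228610391081795257,
   2653911727479958547675476964371722821289, 1556031811501302510530440854324251011970,
   4517972488885700102609016708688862333514, 4406758723087127023200892830261715923821,
   1024718424357823714408301051538204932538, 3526212373241350161744907226403784654247],
  [4406632734424675384775843180479492903849, 2922559825711581711169780158033714821439,
   3559150012391611599443272118899358624938, 3976409550620737670188164252409289725093,
   1232167466797788946666698767506080983842, 3198568503712956193527206997403582371095,
   3496528154496132091851477419073786385993, 4135559700967985832307005019770368313979,
   1303364503255434921677719373812148080963, 2048546975863307919727930267559368501633,
   1537461544448618562445391800454575306317, 1048773011107271694632634438423829173475,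
   3296036924464172871157869121384336841446, 2962173252951654235414918021863589964666,
   2555385373981015329121958533437064244702, 1900257855337515153018076389374918669567,
   4131982553630849158031799097184191408651, 889110004335475613162877710921009031481,
   2780092377216924479307617196466515597703, 3099276314886388695275065064256761031269,
   1495471369950847125267870189239753710130, 1675638940814820186823239385059291233778,
   4366978032399030736710928228051737070491, 2459485257843952646847448786205619222937,
   1614266321206741160091085898250499404269, 1304070371416270990225278792325743327743,
   2683501243042237620279493730754184607337, 1163523122179167407129529954105555057133,
   1290497719601098767448763601077375013357, 2381418805666710502927813740970001136758,
   1559609265370210037989059687410109074081, 1178519733514799973910341197992110991994,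
   3519312234873545537293229142519815477981, 1849525053087137380116043434701092679989,
   3454029167052091155249275079910107698297, 4454249959578991919317166927649668936503,
   4262524367673366574886014067942987052023, 1375172526153871289109165192877647936782,
   4366263887366106085939805775415296596530, 3576342811507644981238675602986998931078,
   3177916960153527679373011083203060208805, 1375202355683672319129805274151695403330,
   4454033207039579467669684606391567895189, 833318919759447178733638243901451790775,
   3697153280522563044274328946022273264714, 3561426564138487655042922500812916743145,
   2858325218517253459443748589533679309485, 1348656720142899495910619016539564784203,
   1439581487548401101583490750512586142621, 1452142011561411063325851325014356413014,
   2737761025572619226058578459935042491181, 1400359194544678165533552725951043733982,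
   4150880851292716215305914025927142364799, 4174502248871925842582614437976786039823,
   1743003731256819041262239333936753743487, 2197124518656269598781102899640101064123,
   3920609340795633110853463095212993092167, 1679435031628368974894513638230174694603,
   3962183635936480942859578051230836612278, 2395734040521630896808918448514071989830,
   2876011133004947025543468413334134721718, 1376403165140867363037189800413965073878,
   881326980139229208702432899467358252069, 1375572170751796149484221062270433480229],
  [4183596316439290091285415668799301733106, 2230031159188861314209244556571634489753,
   3129836333038921409250383053498591507261, 4494212481725458473841284802180446622411,
   3880673806470197691911121969956992809909, 3152032086557586010243873012628487249057,
   4550021915731841166835391469014668725830, 1719490835050333331199534238298336178591,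
   4294553017912923071012425629239423561154, 1580736666795295173512181960531013934726,
   2013601505770506330788140447556116167986, 3432769287056841626132189378069058425959,
   2296410562249405536681396065350519004247, 3257197004110094186869259193960235242595,
   3943182572048942199037586397256328830507, 1579880032865719040456795984860827520398,
   3002968986545644785766432332178551846503, 1934626784615431479344075932785902850947,
   3508093836431530535390541437823284735525, 4218244629130982681261667102102742084414,
   4640327704902928903663498778629591231809, 2027310470324020280077956563149351304326,
   3570830318224523261857529563271631677801, 1051836542761542091197396980616460045717,
   3973799150165654518609699931100189363629, 4384804673250141784243234876260853869442,
   4438236885668251918581267152267981941533, 2380633250711064663067242625034631886259,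
   1492065394023413572100601668957531073863, 4438248566591871610336898556852283446161,
   3689389635500083937293037375207103328543, 1663527963846934098752332092024011190939,
   2672135661640028837520125706162781688481, 1311508389503994149551054408802742006619,
   1463024766495625520832013618281523465435, 4443224185607991305804596639549872991790,
   3504602096930863474576903512767341030969, 2515329524484458489032944377983852996978,
   1759286913650502232676863114369867479677, 1846255080291480703224355535538804711078,
   2199097784930015285622840689718321402997, 3689441742347590855026833397682386246698,
   4438725278557038214842581624640912831803, 3347445760591291153370879553651414608521,
   1647316198958828340033432644535814040183, 3386381443770999853267383989958754751203,
   1406944298300518297063762434242464904617, 3153320161275462005382960533004466477375,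
   3791920414455353440016900333342146448766, 4666787786446867878144161056239790509521,
   1454921391161572410279216553686459028663, 2094393917716416347964813197771508028767,
   889211514014409980435391606638925919181, 3770650166587317868279243034910065374013,
   2430259242299539084598045523447406271947, 2899312562828258971829630017281541480070,
   1239538167384599262054255749642095891807, 761678091585287138337827595452190364819,
   2747305466520149647960229380549061585381, 1312279402552274322444330842203995425717,
   3832722853678730841274421607172438932129, 2126336984859543237467473047511945892957,
   2764294880030906602453160508532223718037, 2147303916942222974757934188992044346122],
  [4493996982589910627926091934148788834971, 2590381284418510157611273499985982887293,
   4406800197806437887983362746990399108605, 1344444494244836554936249339780205499483,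
   1049227434551589757247401428344927761849, 4336983189639160795440140373540455329086,
   3189418676942784353039209752496687507829, 2815707808404416934037532525717925628298,
   825353746882685038259020431428297913751, 3153392679492858285170265315252753003325,
   3355954336546255818093206832421425266317, 1165597591131780451015471486981040106454,
   4366985679977393344227758717125159971390, 4590015599304668274152615439339856128775,
   1354830863265765147977058560928650095114, 843791637826898016326101239624696085381,
   4207119875828116119668478081853600034185, 2386879903252178496417047296241579035174,
   1759406468114747527010899298740771599445, 3853778841216860495906869010185378036874,
   3727645295011431506874438168027492856415, 1453582782601982429421910170395472360361,
   2804187302423552352403284076824649334105, 4589987328071008609821549796665322875259,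
   2668578764243950607605102699053203704261, 1104366885910999674571182953448683908111,
   3640105514310489235114778182964028972017, 4142937896926897918601404934782638691991,
   4717512584371559687911601139588921268806, 2551310597956156268375711657887341362785,
   4310268852425572473911894809082229889537, 1438955078410715232858372334515244627439,
   2237266151379156995153560773906676290701, 1008379743606895000144710076723402143181,
   2523463104835700882487816456015799334459, 3725674440150179540546787686147796516379,
   1142317485045174758550741749936160972441, 1655716348982418345819860540755045896809,
   3761138416391389032381697147316968324546, 3187096156184835610995478785626018376998,
   1637067064934359628154553171365048666698, 2357582296522467846542641875541522828582,
   3378009432339477053859330862880754233789, 4183753579032885610935794376204094212781,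
   2551341759305883394007986687049559151429, 4124696029636396073328440722309963353335,
   3641245150059632493454726328054904028474, 2704087642026348067633103200295759285511,
   2855799298414313051541263822985541129243, 4409115852524635973080373596953643496619,
   3664641569190833768494943000713927359635, 2963822065715836735532058231756766163353,
   3593425397240379355668212191552138433459, 3145321448492927661582934259682400965497,
   3866027619956097837345388298484405390657, 3258422249509222823595172162762105997829,
   2165134763787608572902094702251394448195, 1088610835694880641124927966953134109827,
   4736125680866620389627633389033101794073, 3175537544320887485126640254754187418398,
   939912607836812610421179272314232334689, 4326682915340262776408460269342077140446,
   2108979616965272656606036065152526266797, 4557924541679417248593125078346953315129],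
  [3951651017678625557527739504974460608198, 1700600856732426116805876387789801126879,
   2642161881110163773653430446925840525819, 4193815897025550790034137324324852291846,
   2293772000413462929336707207203173456755, 2121862496319844854154229812608500077307,
   4582250646658895906190430814863315727509, 1375131345323299492960194433671046667645,
   3856686603073197073347526138090384768450, 1253969124507601240861709335480715082242,
   1226453364357252588762229067910867692418, 2587859098316332404134658072362880718291,
   3157886827547411719764078512125006893783, 2111960451868546204722659370286294633287,
   929095741174321260016040965659948293122, 4709280265421615807738756366734440805819,
   3927249146469745151219168569800384670561, 1232250487772807720902680094375903676810,
   3729218815727315355284908527557471193887, 2424160800335647499144614362356737358510,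
   2992797383819839141303185935471724800802, 2706847252269284212263292706849897835593,
   3704196521566918107671620156890795191618, 1550397082302962914445523961792969730622,
   3186386855999374655749279027050576770315, 2076740047609757050159326838627576392098,
   3133173594294138296706219648044462832353, 1647461606082937879138727313588033672771,
   2131044748377156404571245900459782042847, 4175171643072528591319812455231868845626,
   1615196589744714965012552310117912788706, 881477224730385292219068064403639913530,
   2684637313196129529721957073770849496499, 4008276197263558477650227482582220351858,
   857060784851932047432398445404728736854, 4206692125022105789297685650305606331614,
   3656557157403353816399425384510403578754, 4621499377742525905205286575268764641650,
   769679624647478036292135282523941328115, 4047607265799907843151478433644696805111,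
   2087380348353295561375963005365034781786, 2620903287315042102765896313845977241135,
   3524492523603636591922424000725903780669, 2519253303604072076083673128735890929015,
   985416675467089085579565919022026852986, 2103879947588542930804128485319129783862,
   4566307615731076234014389277138405407391, 2572792495669210632164606875128307291283,
   3352688751074710456094787524508345834031, 4141266351837887735040215758004435145703,
   3154885281322194866398474943578199195119, 2906169181384982307168347705711978976925,
   928635194162441657748002889105987949739, 3184303629507001943280200774819549615849,
   1005747106554593286252980103223612659027, 932175164211801007529121940297164648859,
   3185302365794540452747609339301629667623, 2994305645267814215091285608249896123278,
   3093588862716207145001747623388163767662, 1591783862439575496430022526490552425514,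
   1813910461729769385475072270780649208658, 3380924185102246835071041651615979876845,
   1950899845046758815833404403141791412849, 4762819267502269323472271442143100709222],
  [2934549061038856424182010649161469204733, 878943409501646916596041709303088151747,
   3504459933875111568395299993132749918791, 2407874719733508385829929701876039482614,
   3249862670113384474579257560672550243754, 3791437976029636197815948337285341699321,
   2269965000525007692375466659506530769938, 2699161220288309980153017801673630161962,
   1930617066449845254628337215802007538178, 4757268598333260712635110271286249576738,
   689661023583730702060100802454261057850, 4717626924205419382538286552579974910799,
   2685493975792564859962945227194249763474, 2910533298943183152655211851215010517845,
   3763831542519530155545321838746210613547, 674087949281519922993592936401783117237,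
   4453675128677936437939987900301919877466, 3672228846153315017933177270044963092107,
   4485597364752999648202183031722490763551, 1548274385073796600061128653439085612707,
   2548388553102568065772940806929490750797, 1335193466637326512179344744658810826253,
   1392488962920034839642804795614277696530, 2930045988425285650157713714382160679681,
   3177288899856365996354522583436466077258, 1166329252443178997203321996347071281489,
   844488716928550013834065252700362234739, 4526012631861776429561426550317101414027,
   1473985589962993661070880984611599137898, 2269699942577549609587278350094367675317,
   1807287155430741486487515225448588585614, 3336894849765611116409444850767054006795,
   1067172417338853667596700282309173128258, 4810593617478874062671614802610268224602,
   2357652411919983213417925543220359441510, 4693849938753734930850844744975377489118,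
   3741893848912667229648002799123152278105, 4821124826848421522116290826769698732417,
   2764064955430579210651141870756196539719, 2365701899278421636896171748002811032151,
   4250169359875272517889406018964690948571, 3452087063436581789774956062803273858125,
   4656496433464785903809739035225023567521, 2750519484975405335631893902421183367878,
   4621789777456150087799689400801770525277, 4561057087630321721928686772479157140054,
   4182372290358198931907503592330215838683, 3083147207146953832627204333961300774278,
   2242419470305353735215049338761858345713, 3899385538582611358837377968432553964671,
   2923977614257580261099509190418020086507, 4773120894616072309603337242220708943073,
   1699432612806477946230809793260778744870, 3295277088672896158765234266841212296551,
   3560133849719131546475399543958824050365, 3816472127293865571845176335153500994818,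
   4430679479292395421799176846709275630370, 4845014624656898371673653397765385845757,
   2321168820947416473551438308349491171833, 2260491327583178595212967345984628518614,
   641839878191209304896407241886288155691, 2068931990347892496434489285840879841889,
   3122796809219472797781732657508335525317, 2285959952116465088549150514905856266733],
  [1687456586997418376838391726404300102374, 2866806160247314687754783929408905210917,
   4007813479462574075465894476064563007863, 896738768824353296646023346119118773386,
   4813284571029840808248165270858396283661, 3593020287703759390364472188169307393247,
   849426907167976819061770617081387583763, 2860174907631266017751556834253281909029,
   2253294746116627558952796052012233358483, 1392488891969691534346916197237476092442,
   3801160424567831746778231885921486948942, 1790047178541747805082868231742852877453,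
   2981205428878628173302605934037434588103, 3887689684420460333029384389922200227114,
   2738551548859901044646045195301226124843, 2109612205066168552584495900695694685957,
   1974834793235369034950829139746063494147, 1792283965851620067501256383079797699637,
   2158248722506541316430538463119534224855, 2454722119610135402450990742959899360661,
   4496696895116970537196179946124313893081, 2174242341091959329134139609656230578714,
   1009297253388569650437613081858898561546, 1025098657925379382119928607416100003479,
   3258463762590675532664423306116255936097, 1250893389870350706047425118628267725149,
   1264867522615261946836742614213012273777, 1411031780774640900164060524098996874033,
   3792673245757802404243471112779533888977, 1582220734157994781704143229701275439473,
   4324676432966634353605865384971543891130, 3747693735686514188800023949139221394609,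
   1838277067303644989971112664985599306605, 3901241550722896646737464165402143988490,
   4214223264615534392366878106411137805318, 3960604102629970172978518907692687952210,
   665643971454981646907515398505206938597, 849265455080126020121394734332580014874,
   4579366085629527298847364784354116307674, 1718117041756715619185202982469535068833,
   2652431396648782104525126080709885737522, 801459993402727555325528981591072070446,
   3879220347333761309396085959476259516681, 2874610211293273971052943467445939621497,
   791354669853342055749157143021068339957, 796184619480926094029210104155087654458,
   982276466965301962461705984143026261202, 2682784899988513607948730994857785629997,
   2519529841177790436587250059735649105151, 1088147467106630824502311495893303393902,
   1471993113243858346247511999074750372795, 4621330320019429574374043200666115291873,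
   2923774888098232367868990578726295959329, 1751465108457199600102403117562121685338,
   769465082826186079416768406310538337049, 3785142023550596559487899727801582351399,
   1167906306002402634741779745836472077723, 4389769664285389267270369189261516689781,
   3313411201489294142140102464670846872370, 1327253216470820026369955790849219422587,
   2229815289251444943780735041669384140423, 2450815441017242447309297806236148726463,
   4110852075669778850378546921400700079135, 4693684037435286556169644162419295992218],
  [3069409562297848291687415961623210224258, 4279521528840717666501245612564353972751,
   2700398342702905305311228715311048871530, 4884844785470851967290467057080224920701,
   2206071024591774984149181579836686905891, 4738818986991651371717193902228998782645,
   2045278381371732110556838581598296402803, 3992318480883575800565301227667965474335,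
   2451575756991698075985764852534369287186, 965842969001437473575578676843400402019,
   4820884817303408437901338293546009815638, 3432562921626596348487785733133963504834,
   4024422790573713918095077322774130186626, 1279705462189473314134808039793806577254,
   4821310384979257241555426646891349944614, 2966279008309860620782278168640019264287,
   1280299962363035881750898440619717143591, 1790061438939444442873752494031222017610,
   2966294593037863825459182847529149054726, 1270211712418543930368525471282991164098,
   1354569245196281160779789626183746483947, 4375183208936613131500647888694866557911,
   4890082440704556038183462840815000783850, 2349615936722081741476943472359787576695,
   993571396642345909867981375196983857375, 3225113827509309364360408579238402173903,
   3731894933058641545700994676932935456227, 3944379244535831001028402575972279276007,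
   2285979521576907832793511215195067984587, 4526547542308733206227842607916520123665,
   1104212974870046990235638228501850089774, 1752294353295828841480547606142548556247,
   2109343490135297068736612221414489369441, 4008430297363135408920276626213251361522,
   4270632000351237267008920201459473550379, 2270044258805276540381765843105239814673,
   4389850281937161392940736206891620660463, 4097441701656219161917055671542649297557,
   997775549153600588627029658253297194197, 3512887557808730649393632429447597739461,
   641672447654278646340667286756077570694, 4502730651160366564899547506552570565431,
   1420551682185701356088942900245804272797, 1709861439912453719144089015323482469895,
   4853128763953104817512187485056169831106, 4654127546951011161436505921219336466977,
   4501636569085869172513601549999159327510, 1750348127013969917223441715607085673394,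
   4661887296947948928641394941672913295718, 4853085913808671332801217789250417109618,
   2475281531252276824840114213652769345961, 2140684315914877475042936260636648336414,
   3101022842392999053170223770598233641813, 4459427850361539629627948038369522513451,
   1576945159146864937692163071033816120355, 3472277884222423185889914412353532037966,
   1231518495615644776802122909517155717391, 3751531001583566105254648699694759255622,
   4656402892293127840542019878826232871822, 1219241870708207739416123580532442764021,
   3295959389666030613537901238441508254431, 3528137656662933874311525248630487375433,
   2986534001305052874514429409085277320805, 1812400066325559692490003739685948782019],
  [2062665286554000720203943443838014741831, 3039605779902253303083618709620330552007,
   3480432582205909337414185876298015156723, 2332882231925493941359743413683414641938,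
   1811948222297164314284273110725891549734, 3752640582986704798235158466022352983623,
   2355653519628613309300916626968405244519, 2205761910139253924241126356512371686301,
   3155072237815006995972310487038503531997, 2718002683833360467741737972500115618771,
   1484518133641522896838221412648915414121, 2983451171245275550307052860294812933355,
   1641620123864565938907985117177646615734, 2923800839102568513365450279572953746269,
   1004089385945149213768475088766925061354, 3642545936323366221610140583213296463582,
   4501906042087260814652077835082759788179, 2741208645774906528394178568476509888206,
   4590397277379327151763284955572067570903, 2453250234329391711970442046003755907883,
   3401989209447702767132461202712272221847, 3338742269920411937498624316001892523331,
   1868574615809151704424277517946969557861, 4385851985242110883171186348920280912797,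
   716073051507760081467099000531797383590, 952648488438357456630348678823043986357,
   4401300744700249070366522560891704638062, 2145667894915346550258476674625031517241,
   570523679881237697580374538650947885901, 3145212352297076691451277720187733749959,
   1558256902515147991950463732179295901221, 1398801467263719525890802621287431884466,
   2279754650483713904152023111100067888122, 2684233327576011161988644489369857864701,
   2183100234832129366105192319567728533177, 4284378608427888123400125956836364335919,
   3863139516157718420560094040252626237645, 4111373813967339266350949228839517049801,
   2079257405158315504329339076902984600426, 3399876454955514672783489489378483804929,
   4908609938784389880916535392851461627270, 1622695520163154738160366784259855772987,
   3018477001457603276900736527920665342859, 2498375146447233372177450562023191925865,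
   4071975421679951735906630087009492446247, 3453030024101104807757966110277935870891,
   1088509504987599881716135955908839050422, 2592272875054276757949881132252419536245,
   1892196580134719575234975345135939612987, 3672135360540796525090159156201433492441,
   4693517422846318990380984489959444175646, 1717727881726171153111853872605404269967,
   2399766855043106737217027719751443059733, 4198521424104552071107582091623920077149,
   4430765120421239400413072010618973532869, 4693095640352674743658048698153007455955,
   2070037831738552828189040522357935398197, 2060602704225578609179798930126711995221,
   1668469502148862615609325787811460721701, 1663604465497036936941981192259539243761,
   4079721591784381497765219931879172865258, 1272909156746146212129347475469530059723,
   3657707725439470034970353738479926225945, 583737992714537933004777755471026269422],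
  [2355775326773449962089825122158915189590, 3633036005088497757947577570153156613681,
   4056365718464138351358057051177512062582, 3014955976329763246836865998970744596750,
   4518629605667508901591305516485483985550, 602339696901467381695038271563698867002,
   2368418712582437292449370852876696843355, 1272316781311027443737689837436223494481,
   4303502218554245373385515106906400354851, 1520209235647964657146114585733243319833,
   4788836445122349942247964723955337161106, 3640712800231075773145254432891428744309,
   1784332452132656595899171875650986563771, 1016606607638469658717456358690962732269,
   2863559860488647932421304631627164089254, 4624096413465087861615934499452372716494,
   1322095373733959074284200908841960281381, 3098578558731923783414308652191696317118,
   2268024233352459235658032673349514381766, 2572686831972146890899309653948934468445,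
   1088597761069342487638687650816353736097, 800977231479133375943333042347220489267,
   1752356482131988431799863993940623298270, 3768545870453652187979435920781541416350,
   2317681960310748780102326044084862258723, 3544098728065992453562286099535903571313,
   1199543073478143697327506467993641292303, 474694741702592820234130446377241656197,
   2668869835974651545022369284193354906654, 1762881538112718026323070988067028069646,
   562506706127474566094660617473414040655, 2634869087015653223908119892491721586161,
   4996642654042777671434594914747880707029, 913821422939919100183188941323466100459,
   3633542398664067919011427902115113954635, 2834318135327553818629849217676178550327,
   1295257819299388138530363342942934924663, 4845033001711191687002334417448412191262,
   2813138698971207707599835279009900671615, 4951526711525244843196358765891948285395,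
   4678101846760545702944968586200713226842, 1024314643872009743633491596115245446303,
   888863193936987538769752938394747089375, 944642737124170785352444993256888523914,
   570263938496326434477349553061994664861, 1272643975576433584089485858921833044551,
   992297729197061748889478787217819203421, 1791382232997590138473829203816098419217,
   2780534013743460596080655123408575943951, 1376371783308830748741774467203767172457,
   1121092547198704713859760225003823582194, 4122578912411479412291679061141408726865,
   4311494424687431990836352633953749570107, 546067896898632548591509801328228215130,
   1455981306513671460906122716122774675215, 1985398368085793101889650324442440496407,
   4453815006770200821006925906002440344007, 1183591035200633556148518374540347850526,
   4001379272197670792970538246494714680329, 2050045122624573535785101552073101293067,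
   1420894301333583907572407296022717158369, 4359080264065026583669968748392687758963,
   1665441064729038240630050556624218500679, 4365739603728779504751207907675097214561],
  [506144422902467668180704960647779745330, 886135962953919057095341000718152038009,
   4941001949517959656349038763201632001474, 2392383950882266090833514718429910497806,
   2235993206022206267433561728511637614787, 4901032861844605099430267631911923497843,
   3504518941578889123800050634080429771662, 1918208540603114356384622526689823247805,
   4153210863909042236409435994228992207866, 1070025674058417562565011243648632998519,
   2995507699675870972042397725505333261051, 1711690503245146735991033007200341019038,
   4305872166638666693481352904496714536671, 855352393195929809053226551825573303089,
   4327103461120842260021283426746671756201, 3163868123094113091462112263690175438418,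
   2231283301325901670107333920127448461961, 4104138574914070585711429201712700879179,
   4598327112741963080617107448150786542314, 4101404767479144361389393482327480155006,
   3771943208534275766746806136071266360359, 4887832756301361030735695953506847537831,
   889810855176129658928555823419040095290, 4310113003667884819248923790504740645741,
   4142618551639206911095139405952546885229, 2696836255538785100499989398065544562973,
   2700719145349239435582513926637689253122, 1631886514971832753026860148700823096070,
   2134147195670121552265602981280074529063, 2577458856622418828107186352007119169930,
   2475364308830263057971460339281659351259, 4589389814994559902002197726859235292547,
   1470613807516645266941871472553352689906, 955006740692351705851048947351951195682,
   4230364488396171568239465061367608318906, 3812803863107073006464754169545547854251,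
   4799367928523622186555148111587140663603, 3122848693159100785297080775073956940551,
   4263553746409808253723419064017298837026, 1406959620282500850975631841147220823121,
   1390806571032715196314451978336868849878, 817897501290234254996101211540815614811,
   3440765294187163277905357240160972536514, 1494619888161546138279116859513993103706,
   673906002192463736721805021541535113050, 4024029818385508702314574077538710899410,
   2323279580659451593383024222739297872143, 1935083937642245543160492465882489624895,
   4954352691265780761229788510888889907390, 397451491188526835084577390483084307183,
   3068373820893012793173452341214402955886, 2810236393456646804586897582384739283497,
   4379335378838840100168534145589176259935, 4964534672626311205218758344769212290165,
   3279836536065793910499971789622036077417, 1183701269061884510158782063164591524046,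
   2728519673890192154673642809680334175145, 1136181265635092085515584269970113146446,
   4525628362424466601976619073112358161578, 1519886275909684913452017667665470834905,
   1549388269432648642357958305741396143650, 1685813382166237000031309276009884318690,
   1678449086725252469819742215741663088363, 3083516018720879781793471190261377858390],
  [1051972694073090930645269223795310621639, 2994069393331839158937690159594941578981,
   1624890684104515364765425324132576169554, 4933007043255718778716600097655699370661,
   4716835008678828710126781566592272456733, 3129498846097475954185436186227613884250,
   2953764507378059029537223056629045075262, 944902267046678247412369641758296259377,
   3976467676873883623507356901911127208385, 2331832324014440256980732007629884592851,
   2261503754464422853033571149185530682562, 793550743373843387561837561413921132809,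
   1784394120660931140316657864829942372518, 2453549046345055805163128187741320713431,
   4677166895003289341267663496365718350986, 2142453818405530019952967688266905487910,
   4278166095826958368387699793499624174385, 2333925130024740838087578021719699789593,
   1933224820476406406541277602296452774690, 1591630040816270854623740410590164282710,
   4081191584077740768803844570356750764181, 673427140203786430281777426736656028405,
   1764890762860729925339511706704770100875, 1494580957172730321128625191095572463082,
   2728714354426406885137421340880838185361, 1103874962069032267186354442203730613445,
   4590436143808465690416228821982347868003, 1438980441478278004854691148023276887187,
   1895944168234162213025445462435883850419, 4725526604766850902647801908525644732001,
   1897723863953078799218561546642764617499, 2962728574970776175972980878823473987294,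
   3528397020688374512526738496151069553151, 2603513833744711235434624766287630945694,
   2578930283009766682004633506949474325125, 4323282019839117809482914532071761104094,
   434432259931847628261944877416814687073, 3547674595437667888678037804929909981042,
   4037009696627236442730740379047720612273, 1486567971800173698487955375232501167453,
   4773141282339445117613336505680762224210, 1487668525457173713370082123231434149719,
   4295500675670648955732049805491907210246, 402830622362383396256084764659200556801,
   609608802097722874959158996808399066097, 2418492875633905886198353934272013180246,
   634056417720559628746896459981589656927, 4773791783023496655095938402027168248421,
   5015454327304391478034261795923484300645, 3614552715290370005314283693428299124309,
   3193401689180440239831988026267507505859, 2187082564755409551197454285211033836487,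
   4230389120911162533106695470262377315346, 529923853620206599547462465201386658783,
   4294664487485907185455426653793477856775, 3544206334300935949813504631411703925418,
   2900026655894997955190368688405867452687, 4703970774273614666559565115899114806410,
   2046276594874756750651773234270768559191, 1271618423725497307073389765883342276995,
   3391971161802860750246962427541105351842, 858060216143489768840980960815482640895,
   2579280173977197279294412090517117826333, 4506645617237124725833926071451207277190],
  [2038585630445122392138117234913808276883, 4448175032928577521862528798677886807066,
   3983412213453871542949952828837969977186, 516653720802734396600395508528091027958,
   1406908997658719075145934082035951146095, 2603995370529355726069270831350304378711,
   3513924813714191129757196270669543595670, 1296624579418639129732409148823803247165,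
   751064774364118865008926855469349007821, 764349260145417548979685085139319609978,
   1780764021035946579685124251588533864998, 3493438968271714477869854245049570014759,
   2710023384037191280034275147442889017995, 1116028893684666695894484934224247675418,
   1944232346287245315948601843821248617746, 5004851617647732939617175398153132366795,
   4422662446773322698330192760234501484222, 3195242921023307319790761119208876799419,
   2828300300360160607319364178550201745059, 1527344133725811861245803261968995184955,
   2789430547995089374035902976539547410119, 4845391266758446825385773028502693783754,
   3033498964136656991577463855863985797289, 977765887919374016563697841550661529039,
   4826466716175112837186511443082692064019, 506412067444421158857014753254756481527,
   3227161227909463910981925912026429492221, 3831259956306509276139865247648185105105,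
   1264129377933831967852280273126325090446, 2359741968159653094310304287278607791863,
   3911271816322604672861347400812477352589, 4885415925158910870945964869949370264221,
   751056978431918382577772258956936999841, 2579773315067894884181195510888499033253,
   4653356251598464582047794266696158473669, 1440231810527181120921032902580131715701,
   4525911263826153373795900498770875063050, 2641760313871923297051841341825190288973,
   2828440750923168941046465935003898368985, 2349818942270079454331170412376460998219,
   2938572723756846107424436831463906573182, 482092471770829769545992943506388381957,
   4270157570668225272472150864528972174819, 4629428839120729637537409059273443639091,
   2859869270048677840952554864738958397561, 1438700685066167697526214669277900774535,
   3640791708890580631501652250994771839358, 2044553217452872181455312848415612435598,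
   1323540481815922712348321057960062391503, 4508172046208288112438276574817221224838,
   2955072525234553035934718080007909563302, 2739200200598712633733514345333797607159,
   3503158520198513289000096036125348806115, 4342954181448312394767890274408838847282,
   1477173605135745241521097194129436260045, 3760397811494940672598597531535720259170,
   4433217067575819934288507964580987092454, 4104281471676058302107489597275049934706,
   1270351843449964343428290468778868954481, 4037593962978523605304313099550509457022,
   1591383330475421563756229995774060142006, 881923751779065112119698988464412456019,
   4676906352786995413235449374468393244881, 4231788619862689053212601767061905209930],
  [1910953764841560895690263207278377186117, 4271587516146912998263117929836313194743,
   3399720275191840890960316397171853737435, 3162029694675321915749983694737118264638,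
   4980648014402970187808824510754845276959, 3849163249415403931784259544652195679943,
   3051188505764142648918956397792802918105, 2384940443508768583617125298205989630239,
   3759517933014862179525114185298446202525, 4533449279974707529952109081565061885521,
   3187230846363873207799709893139175750299, 476780630487591219315457100431905233806,
   864567397607270712616380074007926057138, 2940022130961420014447953704325081974905,
   4654348294398798685967677899705666854278, 645225447557454702405909937025176193691,
   1240511335198018456774247934226959423271, 2046706960182361766240191467155653578875,
   1168504547936251452770021223588884491747, 2889966670033050940249245211840939731287,
   375864502105794927432667209891512685695, 3726768863011513497098431357436498586183,
   3282109354922382644257988596395376569575, 1154480270970488867972535990602691778189,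
   4451378415875956519540740056346014873231, 4517811279034746698658726515095674722950,
   349532961693641609613465398218746309495, 4772824591306282120381935891088101637891,
   2102476869766388240626575486180330351562, 4290326688300988660150819230217935893527,
   402620265628492797380944134288803376510, 1176801883016811102051747510875314658095,
   1486396971930552553144193861391512467639, 5055128878493615846310891205492372400327,
   4462931457985890314952484411383601649323, 4972882529283019515930003445648705945174,
   5034125771411202761956339733777914515026, 647322692701139342096069665545540500198,
   1040367819625732493835462304436909600086, 891433337358691496921829574799987874069,
   5028171469258200354056178247752818073170, 2260919543758906905009203508534880664906,
   2779839015098895406151561353591417544427, 3943318612940898402906462883467814960887,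
   3504890060543175134484650433277388983119, 503657578605951191345332585044776509067,
   3274098931578999118252728091137498099506, 3280941293714237687663738691535900774661,
   3345629305624855319656153651312365310877, 4917274391283772002819582064686676120345,
   472305049421083229737560652046137903281, 2715608966054267204102626463190902550062,
   1528299890215519373630478049311953385251, 4451495227575325992113930658033451605498,
   1526324543300794586072510353722711021774, 4885111879589797671062458120443458556607,
   477384100197042011162459739223075862077, 4557179510528591854873284856202580880243,
   2101300563648922404392763329485886518737, 4182159380697619725574949742781302403193,
   623131817772610920216777506556210519874, 4889774658456049577923451123117999819969,
   1049090348475945454725836995456879040906, 4055559148556111717863434742840241663162],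
  [1600657309172274823859992537121672903113, 5068042042897380796621142616942679280454,
   3803875784556724859432481389191319320377, 1966573537701682856697945370066990702063,
   4120190567844140811407061911622806969471, 2030394654839392600942914323705017644133,
   2675420606943166168198393463652645895798, 3498093533239443969399146371839925712751,
   346909837927870127080596205469357332858, 2791567476845962861417992220644474202793,
   1931054029354564883355303799190516511653, 4246938154137709523830359131049486171053,
   2014903771677908714964097934566099898669, 3725927437164541337590991399950247867015,
   3004462587624977870965968608787055369150, 690208488595947681078459134716018875910,
   4628941058655679903676852443615911327115, 296437860670334999248266429709032275241,
   1535454201963078033598968658321077637685, 516809657062509590392162842885961496850,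
   2113840840774102823447211624896723169875, 3001536292843518141682968664347528903605,
   4674260567668744434261729197694566397797, 5118787426095880026687473434315650576721,
   2668434449601892073008873894663496597197, 2922383175045997178209136009262304836869,
   2035507710184635717348507497135095537174, 1763056369071550779983388996273260935889,
   1887264103882262546251594766737758092227, 1590280110974110025854133518627125957501,
   2910884045093209382566360962877016513521, 5174837094445898069499626263794323593938,
   2249258035465816401277128180251050923541, 2538952051035359862303383147683013753253,
   2816902899577665701625064518225281948897, 2161836399397427565107686030445498602775,
   1462565290011553441614411475723022874990, 3410296934389224308000589282603638827525,
   4837032462051496186859269805573081012741, 2876311043483457905853885472699299396962,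
   602331458976802298059329660879876030347, 2539326750154629500201719838833627323146,
   4040139415846269678099744813011136995122, 2454161450197826564271682571667590689717,
   442894291748716629209044510662579407425, 3066438186712981864818275985585215491798,
   653317510963019585024172560657849013487, 3427701374797291016540635740047010483250,
   721297391854676813017786656984288784477, 2812528969846044284601797328835653585325,
   3663720078622031541797328109550235697001, 4486999269941903098599166028729654759673,
   3305199553015459940022641614436619414945, 1494820513977590890500600264642355613871,
   3920403696130076343750985889570140745434, 1751698499453215772939663092086890519106,
   4514558611158464155255841105980668087359, 2515080264066134746492645927044797437015,
   754354555193373307248056930617015547329, 832717683614015497545305560272371805817,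
   1144677093196116718238152974500821897393, 2356535681480446367531569992794178041567,
   4783802308078379403955645776792946576627, 2260460079847460442941164909822280062579],
  [2864723945826659114718702494001566189826, 1502787220789281493467596513630607026759,
   2803034273871857439900805589539169564119, 541070148884180476452109903701774202411,
   2509429787397983678333338424975602936946, 3801240694321337622248093383681544179618,
   5150872190942796085151215990322067436189, 2182812183660982122037844024399983343083,
   2764631150481810867630510825884117422179, 2349927649273547424059665004356637662025,
   1885030231709940666120965723164079319286, 4858897395642077035903980420738387316447,
   4421640203266279525767912625728903943093, 1392254915540954947395943918843769312305,
   3217011205696013760026452774629507849318, 3418309956395226707156709746596569054538,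
   4718010821599176613303835452260130092785, 4590080261301476514493319982952275924667,
   4525804795304749798757662975178379434549, 673517855722334289329968353759391955305,
   2197428133957628677159367567298803471945, 1967078851667692261187354407714001578642,
   845912825972004823642269668512703452607, 3770533206907681951604942199970388651569,
   5132034254419010553523637105174556388774, 1120719435853227882337464925386583571174,
   3788578052061739814017822969166202385273, 921875858125097786988729909814448463442,
   3337174990090983413925265163113597621563, 882112170815209418868081625021431344227,
   2971029727848599070520100377657942660681, 2602518666274884356483870602144093071877,
   453793099144889119544358698961333572677, 1487869718970319048124279654332593659713,
   3273635506803395474189219777402192988750, 2005934775557102666968465873545579108790,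
   4706162024487840659724436880470905248486, 1803829798388531345423894649875190847850,
   1695350010493337540724388789791408618397, 1336839085218549916328631617100849224726,
   1965738771595606561501200188432436433845, 2994017434643743789753205383706076854515,
   1665409853939830649016699953122616841531, 1035882443368097266361001617012405981443,
   4419328952483545490257187990553843797595, 4575699276875947393727816836986804472846,
   1991458335600216039346476727579050177107, 1048710464849717820230029505454299242018,
   2141326655543274538422297941755935915878, 912363919426036791783941503822337937533,
   2875870268573022888457734003429630380327, 1072040874358544654429206651631860051437,
   5081300346594740132166801185947456449671, 4736312257223128953370370666994369707209,
   389912224727877095139581897282853671795, 961064512474891604132668583283398654298,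
   2620823769510144056311947895929011877233, 2453632317285470424465737811960790112545,
   3984723586927889353636430220563042621011, 2131614156960484083461155957227174484182,
   2619485292075993859098128098528095747749, 1615985961931523031550684346122824273313,
   2785048150781305474242452710832643528217, 752918821932103323960251581141025329613],
  [2868783269566086805419622220450425836055, 2828269060682182321567281890795318385703,
   1789534524808139202450016937679611948773, 3121146044296454077721305695943064237737,
   450228790686494192816578101304249104763, 1410486285307597962364086251736832695349,
   3098286429254380500055524231682726123133, 2930341656773456163741605582766687420266,
   2165986267584234850861451168362370640181, 793607787576605669408323929336767362515,
   4359336019813233014865890742960254188402, 3661034361912963222401638613408542738598,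
   4325690122664736266731590916199826303622, 833502790044588471273215057975971622306,
   1783631284786669184717151234522490535002, 2550948239518047938847064167163179449011,
   2923942302074086791261623173915298597770, 2389603044544429736018008841338597700827,
   3858164929256505984532598221571262518449, 434286770086718046205975770125366328071,
   1399447467197648801777737449233801678238, 370464657829378336314791873274610637086,
   5163723028446201123803598822722152158967, 4654387362081616709836617639561429226199,
   3746167226786646549955937626644832588365, 3193404232289627253738250609350537271495,
   1473930949058738100168551611089171156526, 1396913615750927324894556229353444125978,
   1789819959187187459535156531590033120862, 3123513598253255489130941261029434845626,
   3695447816439249852001748060995391212607, 1470393010642554496195167197025245614557,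
   3081009499583164103598719593390402591627, 4215831301436563708713654838913735701613,
   5140289993638387913444990525409186945167, 3438288460553613831445663231219901988038,
   1252504832444182174071994258384070811050, 410227093759068598049503431071028000910,
   4820443271796572181507360541885490623323, 1158731840588154874610478867166447995926,
   4343032037641267969939051927056571399697, 2166245991286368395863886236726092622071,
   4469302547143904362877593605285934128605, 2844188614820483537204575153202676740499,
   3556502912368732699562480391165036023483, 1089459822038055516402338924244224929947,
   2452406226602282649487250250479291494713, 4951409687117625179751502617801375159293,
   697200012490692363054642379239658378067, 4472957560127389049355554706261886193117,
   2802419154023960667733606923567812541530, 2006891940284561528796147352528091749847,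
   3147379918081507475369951520299635851194, 2198428170429397448829229584347165436979,
   1732065947789206550394093630627947968699, 3326111657523496065744829993975452277862,
   1934240996094487014389137773671557532462, 625385448593858896891336869813556199303,
   569659057591160350873838851540637142361, 817184179263710155860931841119269163397,
   3145113563997501382786269133717974559903, 227540024801674798812232383410598709710,
   219256949839727550660578572323537556099, 2058269483365392077816909114346892905145],
  [2923224243224938928660478237443792444566, 4630001234913430750434556224937237671401,
   3018937748550750427153720244268457119359, 3163456772033510856324005408466094006090,
   2124301486948686427880293544845843272703, 5224938853363577771996102035499193561631,
   2331610811441003180694550551568380121539, 2714363423146886145554870071481929775633,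
   3831693259513301981061515112941156258453, 4501765271577200118251624163343442222038,
   546081996030337010877362579382082313693, 4725740731820350985759601661608499153377,
   2069601556996087479272743516918456548697, 1206518012038998692991683266005568237147,
   731852019555475344616334345914199936519, 4092151906295482330357358562586871581262,
   2355301760600450455163165379862818789442, 2368791275627677298608338410200634756762,
   4262141305877983434169873506580189703770, 785270272138307798588478247358065184027,
   2780066200362435095121067082785816442065, 1983071150522059717590655580836217368637,
   4034912071304194666415244121779265033747, 402981059241980505402859360803915934462,
   5172268077653124322693528889571126081201, 3416362196943270971932434093919677387153,
   2014972599235864187658737135881458323969, 3794455401276346744590727343573281029847,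
   1775666333568335927785519591208595518643, 2094670341034576877789343428917718080717,
   4430367724484025799709204543472452449689, 1886841904452386949964782775096638928739,
   3400951965194906314929455482933066139934, 1121201510644145970397574125944631973515,
   3123508833454699192802771884019231723635, 4675420920525276699750838341381666897251,
   3705449185305577965877864944893487491406, 562920816432713559485077544184090956557,
   144874793799490123960901308421423002433, 1835379672327644097035173485391000013815,
   450014458330715220740128998061344643565, 2644921308453452321076840614848093869593,
   1871348764041468531409703764570518489410, 5283818178510208136516387518414046125775,
   5099865383148390604491261042226955025114, 1550457726149748840179152085934536051570,
   3227209352694246654011282686156306430323, 487866576268577492346567569921199100049,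
   769444130083853174729410932513391532462, 3186898270655500957180785961196806895057,
   450145335794378658885583460220441030987, 5018221644436905599719723850395162588997,
   1898334428806810933207003567513914849935, 4247147121685202232808329716378565169079,
   3440334459425567416604967747536640048089, 4437464529439172939194688002530161720375,
   2987723145047908596095769667227632140182, 3663528125753466657990903758378002895887,
   3314354599665770238247273781783072715719, 4597020338033349602588580238513981354561,
   301489882172727910546009733642806228897, 432275980972877022382732289878020297311,
   1838501526599233319456902878055913642675, 4750023963532404492660935992569492164923],
  [3229937728944803022828996354694239553603, 1195420108547964758573030989318435535758,
   1390619712987073392392919721865172064019, 928874868241495832004064950917461351109,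
   4397858826106039470802338530362955239159, 4463082434712220767274325760488658949375,
   2897983449823920815925041980296117670185, 136813811343815196144875339560761236930,
   1523838133946475648239206515671011453709, 1837131300625209159645900866478219877505,
   1828736411671302627532291584272794623699, 4113594746818668916498117199222326033363,
   2929706004324665351641314029248141333425, 442795544374766630534915955360424647805,
   5076033968772741796998978857114566072077, 1009230849460431050805995463226168726465,
   1885009358439963680189695609900702937563, 4143075286484748316914715765780988394595,
   2932034549449735542176274961462887124030, 1179796608522577174614618953879672904758,
   4438015989831228430310004772828404798827, 984333872311208704682810399524784175906,
   3058229046105401030573532811417324720951, 4303460327547839993486691117664171734915,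
   4429775873575968506214257314435716519059, 3345595517858926753520911461962172019963,
   134194193368943271218139287824048688182, 2983653511321554075382366508446144580857,
   1377922826084955967212329837073882955137, 1190520051416458117567066329767753478035,
   2618909125855968754546745268983469652070, 2396247652070049457980015221152426081790,
   3405775814064844293562851302590596803867, 2461183920476087001152677428012859103103,
   4940760910778019161419874539156647096857, 1944828069373165561007638575764422473517,
   1432689042352535904041354550957578876309, 795919648809631609056534079197232663426,
   2157048921359688790042391146974589287667, 694804909280307560325235840407903349429,
   3693609258288277336157960609194515003121, 673126154003743844511361551303418245331,
   4983116436251360135951471048010484517334, 3696581827883356835185094022660329668298,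
   4921777250489660027481095186931644812883, 2931203490026916303954760801621312172299,
   1762706330387668169820383478676756222193, 211557038785669159731613760939140786378,
   4048456849292570951447387237824932059263, 4800329419313550064779257584721439347637,
   992868588691782554396661159667172679475, 1495206357392265268570452940833183290909,
   1495333562777337663403491964594824224726, 1456260377755320382782201322649513909479,
   2251087989255609932921622371499139803302, 1605098826279110919162205175084542634357,
   4262184100123395333063457418012863852486, 1972468486259218288261194161527135797074,
   1774746612603614613865435267381980255601, 466878720198968486225468491957267750569,
   3416306354806336193163218486114802939101, 4558843805944888401542294029680253205738,
   2004783770514083652408378805539581798465, 4833994294109260695650745238899982133795],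
  [2700276146768105690561153411347101817670, 2939008796374450178878134654620556218951,
   2610696765508540706068651752276764964149, 4710292641855585149546762499887242054761,
   3432504365681724229839634523140069640862, 1678525578405020414447023951199902321306,
   3697758354183688261327792766314193425367, 4246319001069149522833547039083849346429,
   577849089589716140834345903154289488035, 3633461763420269305894096896544147499407,
   2732065955908941017821995492216563956354, 4676784014463858466199689942667158990550,
   317367021400140141138016989471294050485, 1492590731486259983467953395227161825689,
   145116338135114902925294807517498408779, 1265058111572406112855319978398984803313,
   2772545356852517697732786735665040788138, 99679842238900992888823422171904645814,
   4356702181326852786167243390079864090569, 1693600557514209078454545687141076611671,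
   155726605220710867887348181086617235009, 2248523022947303438921066747602228796830,
   5323785975437402296173867982491176064603, 147247701652364998811822470273123858562,
   4628961608632419870272585346153210260639, 3580627701218212943570201701198319303029,
   5005108551352924241151674356943536902455, 1183814032672606055581192011343498344291,
   2844798740697584676140935528741220258671, 2556436484639488392114118633310625087322,
   4269767912741639532573136156830746905787, 145007086968187120705263389229519384179,
   2581401608054808785240878366951524658674, 2483806669724030522623222754870232120362,
   229571669113464847685699873988975145045, 577630455397891491143008889248916888701,
   3721705281514773842285225125569620380735, 3461420563266908211159145323292543843183,
   1950355281824517415709317650368302337018, 1566022170967281197592038794609206129631,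
   2795323655783664389951204872907745186853, 2839109399498622541697530229756457897074,
   4909393677891323191837644363735262811841, 3623194177694195125058632915159111772495,
   2940518722143132256751222622584827374854]]

set_option maxRecDepth 100000 in
/-- Five-cycles for the values `t ≢ 10` modulo `12` missed by the hexagonal construction. -/
def certsHex : List (List ℕ) := [
  [2726240768196449030567631501162602011640, 2758170806595993330742140293546111892478,
   2678388561611817539306038868802996818951, 2704984797233894168678814684793870011400,
   2686379499510909991869788610143738383385, 2800663270452515924376174542280827397137,
   2694288670782108451816878114542540766248, 2646535143174705336555730588132286866391,
   2806007467981617808820183834750774828015, 2784793027797319278761018882248046185462,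
   2614546698411922073589166919358108038121, 2574778875862654659449969891297439169592,
   2896432601259951824820674051601204392953, 2657204027211593054480230652810102973433,
   2577446442442063338697741351653614830527, 2577345138145894432302157459676108837871,
   2790111178899627660098706122896306031536, 2617275187652471775032896598080768279575,
   2494929144945538742526724105892620585983, 2471038085251657521901489637343923149814,
   2944262687951915133552425460591866344477, 2441845691660130977323255709715233139782,
   2718122596239126179164510017909803938817, 2407257229579853918026601812743237325801,
   2848503721478984934420329557787980915597, 2989425267684595512360413975664904061867,
   2742052672988893196778698814147469927351, 2784782543003808938827263568480237784006,
   2824767166146560402056450680267795756159, 2673259898927720331939342057491006327692,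
   2749987800676867865918767743213567462245, 2720713552984944329809384343981330045804,
   2869658431206830754071992820291252544409, 2518682627823970013572954875022723027871,
   2322036013108047959587723345265116167274, 3039887868516909610567925102135159317383,
   3108931170274824722561561296683598605298, 2457573082819931980796135113310838549412,
   2781811254962574112959756740369882270595, 2510887526114281385159640644691186031821,
   3156715841468638022425963458699900898071, 2290394059726779024768734051788334052597,
   2162622011056440059538322727935311852717, 2758369250337106869745831625822035254225,
   2290331698949137115557211584988195556555, 2609583948312763013112476876587501141147,
   2518332035052310469111907510378600147888, 3236287669131138201196648424132345120097,
   3677687420137666104311680334673346080097, 2418334551457853233935931251504020720725,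
   3794115649481127784526013901850140441244]]

theorem table_ok : (table.all fun p => p.2.all (familyOk p.1)) = true := by
  decide +kernel

/-- All `24 i + r₀` with `i ≤ J` are reached by the families or the certificates `L`, or are
exceptional. -/
def tableFull (J r₀ : ℕ) (L : List (List ℕ)) : Bool :=
  Nat.beq (Nat.lor (tableBits J 24 r₀ table)
    (Nat.lor (certTableBits J 24 r₀ L) (listBits J 24 r₀ exceptions)))
    (Nat.sub (Nat.pow 2 (Nat.succ J)) 1)

/-- All `4 i + 2` with `i ≤ J` and `i % 3 ≠ 2` are reached by the hexagonal construction or the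
certificates `L`, or are exceptional. -/
def hexFull (J : ℕ) (L : List (List ℕ)) : Bool :=
  Nat.beq (Nat.lor (Nat.lor (hexBits J) (residueTwoBits J))
    (Nat.lor (certTableBits J 4 2 L) (listBits J 4 2 exceptions)))
    (Nat.sub (Nat.pow 2 (Nat.succ J)) 1)

theorem tableFull_ten : tableFull 41666 10 certs₁₀ = true := by
  decide +kernel

theorem tableFull_twentyTwo : tableFull 41665 22 certs₂₂ = true := by
  decide +kernel

theorem hexFull_certsHex : hexFull 249999 certsHex = true := by
  decide +kernel

theorem hasFiveCycle_or_mem_of_tableFull {J r₀ : ℕ} {L : List (List ℕ)} (hr₀ : r₀ < 24)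
    (h : tableFull J r₀ L = true) {i : ℕ} (hi : i ≤ J) :
    HasFiveCycle (24 * i + r₀) ∨ 24 * i + r₀ ∈ exceptions :=
  Covers.of_full (P := fun i => HasFiveCycle (24 * i + r₀) ∨ 24 * i + r₀ ∈ exceptions)
    (((covers_tableBits hr₀ table table_ok).mono fun _ => Or.inl).lor
      (((covers_certTableBits L).mono fun _ => Or.inl).lor
        ((covers_listBits 24 r₀ exceptions).mono fun _ => Or.inr))) h hi

theorem hasFiveCycle_or_mem_of_hexFull {J : ℕ} {L : List (List ℕ)} (h : hexFull J L = true)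
    {i : ℕ} (hi : i ≤ J) (hi₃ : i % 3 ≠ 2) :
    HasFiveCycle (4 * i + 2) ∨ 4 * i + 2 ∈ exceptions :=
  (Covers.of_full
    (P := fun i => i % 3 = 2 ∨ HasFiveCycle (4 * i + 2) ∨ 4 * i + 2 ∈ exceptions)
    (((covers_hexBits.mono fun _ h => Or.inr (Or.inl h)).lor
      (covers_residueTwoBits.mono fun _ => Or.inl)).lor
      (((covers_certTableBits L).mono fun _ h => Or.inr (Or.inl h)).lor
        ((covers_listBits 4 2 exceptions).mono fun _ h => Or.inr (Or.inr h))))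
    h hi).resolve_left hi₃

theorem hasFiveCycle_or_mem_exceptions {t : ℕ} (hlt : t < 10 ^ 6) (hmod : t % 4 = 2) :
    HasFiveCycle t ∨ t ∈ exceptions := by
  by_cases h : t % 12 = 10
  · have h24 : t % 24 = 10 ∨ t % 24 = 22 := by omega
    rcases h24 with h24 | h24
    · obtain ⟨i, rfl⟩ : ∃ i, t = 24 * i + 10 := ⟨t / 24, by omega⟩
      exact hasFiveCycle_or_mem_of_tableFull (by norm_num) tableFull_ten (by omega)
    · obtain ⟨i, rfl⟩ : ∃ i, t = 24 * i + 22 := ⟨t / 24, by omega⟩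
      exact hasFiveCycle_or_mem_of_tableFull (by norm_num) tableFull_twentyTwo (by omega)
  · obtain ⟨i, rfl⟩ : ∃ i, t = 4 * i + 2 := ⟨t / 4, by omega⟩
    exact hasFiveCycle_or_mem_of_hexFull hexFull_certsHex (by omega) (by omega)

/-- For `t < 10^6` with `t ≡ 2 (mod 4)` and whose square-free part contains
an odd prime factor congruent to 2 mod 3, there exist five vectors in `ℤ³`, each of squared
norm `t`, summing to the zero vector, if and only if
`t ∉ {22, 58, 70, 82, 142, 190, 298, 330, 358, 382, 478, 658, 742, 862, 1222, 1978}`. -/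
theorem five_cycle_iff_not_mem_T1 (t : ℕ) (ht : 0 < t) (hlt : t < 10 ^ 6) (hmod : t % 4 = 2)
    (hT : ∃ p : ℕ, p.Prime ∧ p ≠ 2 ∧ p % 3 = 2 ∧ Odd (t.factorization p)) :
    (∃ v : Fin 5 → (Fin 3 → ℤ),
      (∀ i, ∑ j, (v i j) ^ 2 = (t : ℤ)) ∧ (∑ i, v i) = 0) ↔
    t ∉ ({22, 58, 70, 82, 142, 190, 298, 330, 358, 382, 478, 658, 742, 862, 1222, 1978} :
      Set ℕ) := by
  change HasFiveCycle t ↔ _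
  have hset : t ∈ ({22, 58, 70, 82, 142, 190, 298, 330, 358, 382, 478, 658, 742, 862, 1222, 1978} :
      Set ℕ) ↔ t ∈ exceptions := by
    simp [exceptions]
  rw [hset]
  exact ⟨fun h ht => not_hasFiveCycle_of_mem_exceptions ht h,
    (hasFiveCycle_or_mem_exceptions hlt hmod).resolve_right⟩
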